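/- arXiv:1512.02279 — 2 statements merged into one kernel-verified Lean document; each statement's English description precedes it below -/
import Mathlib

section
/- Let n ≥ 2 and 0 ≤ r ≤ n. Then the ideal I_r(M_n) is idempotent-generated if and only if r < ⌊n/2⌋. -/
/-!
Partial Brauer diagrams on `n` points are formalized as set partitions
(equivalence relations, i.e. `Setoid`s) of the vertex set
`{1,…,n} ∪ {1',…,n'}`, encoded as `Fin n ⊕ Fin n`
(`Sum.inl i` is the upper vertex `i`, `Sum.inr i` is the lower vertex `i'`),
all of whose blocks have size at most 2.  The product of two diagrams is
defined via connectivity (paths) in the product graph, and the involution `*`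
by interchanging the two rows of vertices.
-/

noncomputable section

open scoped Classical

/-- Vertices of a diagram on `n` points. -/
abbrev PBV (n : ℕ) := Fin n ⊕ Fin n

/-- A "diagram candidate": an arbitrary set partition of the vertices. -/
abbrev Dgm (n : ℕ) := Setoid (PBV n)

/-- The equivalence relation ("joined by a path") generated by a relation. -/
inductive RGen {V : Type*} (r : V → V → Prop) : V → V → Prop
  | rel {x y : V} : r x y → RGen r x y
  | refl (x : V) : RGen r x x
  | symm {x y : V} : RGen r x y → RGen r y x
  | trans {x y z : V} : RGen r x y → RGen r y z → RGen r x z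

namespace Dgm

variable {n : ℕ}

/-- Vertices of the product graph: top, middle and bottom rows. -/
abbrev V3 (n : ℕ) := Fin n ⊕ (Fin n ⊕ Fin n)

/-- The first factor occupies the top and middle rows of the product graph. -/
def topMid : PBV n → V3 n
  | Sum.inl i => Sum.inl i
  | Sum.inr i => Sum.inr (Sum.inl i)

/-- The second factor occupies the middle and bottom rows of the product graph. -/
def midBot : PBV n → V3 n
  | Sum.inl i => Sum.inr (Sum.inl i)
  | Sum.inr i => Sum.inr (Sum.inr i)

/-- The product diagram occupies the top and bottom rows of the product graph. -/
def topBot : PBV n → V3 n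
  | Sum.inl i => Sum.inl i
  | Sum.inr i => Sum.inr (Sum.inr i)

/-- The edges of the product graph `Γ(α, β)`. -/
def prodEdges (α β : Dgm n) (x y : V3 n) : Prop :=
  (∃ a b : PBV n, α.r a b ∧ x = topMid a ∧ y = topMid b) ∨
  (∃ a b : PBV n, β.r a b ∧ x = midBot a ∧ y = midBot b)

/-- The product of two diagrams: two vertices lie in the same block of `α β`
iff they are joined by a path in the product graph `Γ(α, β)`. -/
def pmul (α β : Dgm n) : Dgm n where
  r x y := RGen (prodEdges α β) (topBot x) (topBot y)
  iseqv := ⟨fun _ => RGen.refl _, fun h => h.symm, fun h₁ h₂ => h₁.trans h₂⟩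

/-- Interchanging the upper and the lower vertices. -/
def swapUD : PBV n → PBV n
  | Sum.inl i => Sum.inr i
  | Sum.inr i => Sum.inl i

/-- The involution `α ↦ α*` (reflection in a horizontal axis). -/
def pstar (α : Dgm n) : Dgm n := Setoid.comap swapUD α

/-- All blocks of `α` have size at most 2. -/
def IsPB (α : Dgm n) : Prop :=
  ∀ x y z : PBV n, α.r x y → α.r x z → x = y ∨ x = z ∨ y = z

/-- The partial Brauer monoid `PB_n` (as a set of diagrams). -/
def PBset (n : ℕ) : Set (Dgm n) := {α | IsPB α}

/-- The position of a vertex in the linear order `1 < 2 < ⋯ < n < n' < ⋯ < 1'`. -/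
def vpos : PBV n → ℕ
  | Sum.inl i => (i : ℕ)
  | Sum.inr i => 2 * n - 1 - (i : ℕ)

/-- Planarity: no two blocks cross in the order `1 < ⋯ < n < n' < ⋯ < 1'`. -/
def IsPlanar (α : Dgm n) : Prop :=
  ∀ a b c d : PBV n, α.r a b → α.r c d →
    vpos a < vpos c → vpos c < vpos b → vpos b < vpos d → False

/-- The Motzkin monoid `M_n` (as a set of diagrams). -/
def Mset (n : ℕ) : Set (Dgm n) := {α | IsPB α ∧ IsPlanar α}

/-- The domain of `α`: upper points lying in a transversal block. -/
def domSet (α : Dgm n) : Set (Fin n) := {i | ∃ j, α.r (Sum.inl i) (Sum.inr j)}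

/-- The codomain of `α`: lower points lying in a transversal block. -/
def codomSet (α : Dgm n) : Set (Fin n) := {i | ∃ j, α.r (Sum.inr i) (Sum.inl j)}

/-- The rank of a diagram: the number of its transversal blocks (for a diagram
with blocks of size at most 2, each transversal block contains exactly one
upper point, so this is the size of the domain). -/
def prank (α : Dgm n) : ℕ := (domSet α).ncard

/-- `α` is an idempotent. -/
def IsIdpt (α : Dgm n) : Prop := pmul α α = α

/-- `α` is a projection. -/
def IsProj (α : Dgm n) : Prop := pmul α α = α ∧ pstar α = α

/-- The D-class `D_r(PB_n)`. -/
def DPB (n r : ℕ) : Set (Dgm n) := {α | α ∈ PBset n ∧ prank α = r}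

/-- The ideal `I_r(PB_n)`. -/
def IPB (n r : ℕ) : Set (Dgm n) := {α | α ∈ PBset n ∧ prank α ≤ r}

/-- The D-class `D_r(M_n)`. -/
def DM (n r : ℕ) : Set (Dgm n) := {α | α ∈ Mset n ∧ prank α = r}

/-- The ideal `I_r(M_n)`. -/
def IM (n r : ℕ) : Set (Dgm n) := {α | α ∈ Mset n ∧ prank α ≤ r}

end Dgm

/-- Membership in the closure of a subset under a binary operation. -/
inductive MClo {γ : Type*} (m : γ → γ → γ) (X : Set γ) : γ → Prop
  | base {x : γ} : x ∈ X → MClo m X x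
  | mul {x y : γ} : MClo m X x → MClo m X y → MClo m X (m x y)

/-- The subsemigroup `⟨X⟩` generated by the subset `X`. -/
def genSet {γ : Type*} (m : γ → γ → γ) (X : Set γ) : Set γ := {x | MClo m X x}

/-- The rank of `T`: the least size of a generating set. -/
noncomputable def rnk {γ : Type*} (m : γ → γ → γ) (T : Set γ) : ℕ :=
  sInf {k | ∃ X : Finset γ, X.card = k ∧ genSet m ↑X = T}

/-- The idempotent rank of `T`: the least size of a generating set consisting
of idempotents. -/
noncomputable def idrnk {γ : Type*} (m : γ → γ → γ) (T : Set γ) : ℕ :=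
  sInf {k | ∃ X : Finset γ, X.card = k ∧ (∀ x ∈ X, m x x = x) ∧ genSet m ↑X = T}

/-- `T` is idempotent-generated. -/
def IdptGen {γ : Type*} (m : γ → γ → γ) (T : Set γ) : Prop :=
  genSet m {x ∈ T | m x x = x} = T

open Dgm
/-- `a(m)`: `a(0) = a(1) = 1` and `a(m) = a(m-1) + (m-1)·a(m-2)`. -/
def aSeq : ℕ → ℕ
  | 0 => 1
  | 1 => 1
  | (m + 2) => aSeq (m + 1) + (m + 1) * aSeq m

/-- The double factorial `k!!`, with the convention `k!! = 0` for even `k ≥ 0`. -/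
def oddDF : ℕ → ℕ
  | 0 => 0
  | 1 => 1
  | (k + 2) => (k + 2) * oddDF k

namespace Dgm

variable {n : ℕ}

/-- `{x}` is a singleton upper block of `α`. -/
def UpperSingleton (α : Dgm n) (x : Fin n) : Prop :=
  ∀ y : PBV n, α.r (Sum.inl x) y → y = Sum.inl x

/-- `{x'}` is a singleton lower block of `α`. -/
def LowerSingleton (α : Dgm n) (x : Fin n) : Prop :=
  ∀ y : PBV n, α.r (Sum.inr x) y → y = Sum.inr x

/-- The upper point `x` is nested: some upper block `{u,v}` has `u < x < v`. -/
def UpperNested (α : Dgm n) (x : Fin n) : Prop :=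
  ∃ u v : Fin n, α.r (Sum.inl u) (Sum.inl v) ∧ u < x ∧ x < v

/-- The lower point `x'` is nested: some lower block `{u',v'}` has `u < x < v`. -/
def LowerNested (α : Dgm n) (x : Fin n) : Prop :=
  ∃ u v : Fin n, α.r (Sum.inr u) (Sum.inr v) ∧ u < x ∧ x < v

/-- `α` has no unnested singleton (upper or lower) block. -/
def NoUnnestedSingleton (α : Dgm n) : Prop :=
  (∀ x, UpperSingleton α x → UpperNested α x) ∧
  (∀ x, LowerSingleton α x → LowerNested α x)

/-- A chain of `d` nested upper hooks of `α` around the upper point `x`: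
`u_{d-1} < ⋯ < u_0 < x < v_0 < ⋯ < v_{d-1}` with each `{u_i, v_i}` a block.
The singleton upper block `{x}` has nesting depth at most `k` iff there is no
such chain of length `k + 1`. -/
def UpperHookChain (α : Dgm n) (x : Fin n) (d : ℕ) : Prop :=
  ∃ u v : Fin d → Fin n,
    (∀ i, α.r (Sum.inl (u i)) (Sum.inl (v i))) ∧
    (∀ i, u i < x ∧ x < v i) ∧ StrictAnti u ∧ StrictMono v

/-- A chain of `d` nested lower hooks of `α` around the lower point `x'`. -/
def LowerHookChain (α : Dgm n) (x : Fin n) (d : ℕ) : Prop :=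
  ∃ u v : Fin d → Fin n,
    (∀ i, α.r (Sum.inr (u i)) (Sum.inr (v i))) ∧
    (∀ i, u i < x ∧ x < v i) ∧ StrictAnti u ∧ StrictMono v

/-- `λ_A`: the planar diagram joining the `k`-th smallest element of `A`
(upper) to `k` (lower), all other blocks being singletons. -/
def lamd (A : Finset (Fin n)) : Dgm n :=
  Setoid.ker (fun x : PBV n =>
    match x with
    | Sum.inl a =>
        if ha : a ∈ A then
          (Sum.inr (((A.orderIsoOfFin rfl).symm ⟨a, ha⟩ : Fin A.card) : ℕ) : ℕ ⊕ ℕ)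
        else Sum.inl (a : ℕ)
    | Sum.inr j => Sum.inr (j : ℕ))

/-- `ρ_A = (λ_A)*`. -/
def rhod (A : Finset (Fin n)) : Dgm n := pstar (lamd A)

/-- The diagram whose 2-element blocks are exactly `{i, (π i)'}` for `i < r`. -/
def permDgm (n r : ℕ) (π : Equiv.Perm (Fin r)) : Dgm n :=
  Setoid.ker (fun x : PBV n =>
    match x with
    | Sum.inl a =>
        if h : (a : ℕ) < r then (Sum.inr ((π ⟨(a : ℕ), h⟩ : Fin r) : ℕ) : ℕ ⊕ ℕ)
        else Sum.inl (a : ℕ)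
    | Sum.inr j => Sum.inr (j : ℕ))

/-- The set `S_{[r]} ⊆ PB_n`. -/
def SBr (n r : ℕ) : Set (Dgm n) := {γ | ∃ π : Equiv.Perm (Fin r), γ = permDgm n r π}

/-- The domain of `α` as a `Finset`. -/
def domFinset (α : Dgm n) : Finset (Fin n) :=
  Finset.univ.filter fun i => i ∈ domSet α

/-- The codomain of `α` as a `Finset`. -/
def codomFinset (α : Dgm n) : Finset (Fin n) :=
  Finset.univ.filter fun i => i ∈ codomSet α

/-- `A ⊆ {1,…,n}` is cosparse: its complement contains no two consecutive
elements. -/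
def CosparseS (A : Set (Fin n)) : Prop :=
  ∀ i j : Fin n, i ∉ A → j ∉ A → (j : ℕ) ≠ (i : ℕ) + 1

/-- `id_A`: the diagram with blocks `{a, a'}` for `a ∈ A`, all other blocks
being singletons. -/
def idd (A : Set (Fin n)) : Dgm n :=
  Setoid.ker (fun x : PBV n =>
    match x with
    | Sum.inl a => if a ∈ A then (Sum.inr (a : ℕ) : ℕ ⊕ ℕ) else Sum.inl (a : ℕ)
    | Sum.inr j => Sum.inr (j : ℕ))

end Dgm

namespace Dgm

theorem RGen_label {V L : Type*} {r : V → V → Prop} (φ : V → L)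
    (h : ∀ x y, r x y → φ x = φ y) {x y : V} (hr : RGen r x y) : φ x = φ y := by
  induction hr with
  | rel h' => exact h _ _ h'
  | refl => rfl
  | symm _ ih => exact ih.symm
  | trans _ _ ih1 ih2 => exact ih1.trans ih2

theorem RGen_setoid {V W : Type*} {r : V → V → Prop} (s : Setoid W) (φ : V → W)
    (h : ∀ x y, r x y → s.r (φ x) (φ y)) {x y : V} (hr : RGen r x y) : s.r (φ x) (φ y) := by
  induction hr with
  | rel h' => exact h _ _ h'
  | refl => exact s.iseqv.refl _
  | symm _ ih => exact s.iseqv.symm ih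
  | trans _ _ ih1 ih2 => exact s.iseqv.trans ih1 ih2

theorem RGen_closed {V : Type*} {r : V → V → Prop} (C : V → Prop)
    (h : ∀ x y, r x y → (C x ↔ C y)) {x y : V} (hr : RGen r x y) : C x ↔ C y := by
  induction hr with
  | rel h' => exact h _ _ h'
  | refl => exact Iff.rfl
  | symm _ ih => exact ih.symm
  | trans _ _ ih1 ih2 => exact ih1.trans ih2

variable {n : ℕ}

theorem domSet_pmul_subset (α β : Dgm n) : domSet (pmul α β) ⊆ domSet α := by
  rintro i ⟨j, hj⟩
  by_contra hi
  have hi' : ∀ j, ¬ α.r (Sum.inl i) (Sum.inr j) := fun j h => hi ⟨j, h⟩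
  have := RGen_closed (r := prodEdges α β) (fun v => ∃ t, v = Sum.inl t ∧ α.r (Sum.inl i) (Sum.inl t))
    ?_ hj
  · obtain ⟨t, ht, _⟩ := this.1 ⟨i, rfl, α.iseqv.refl _⟩
    simp [topBot] at ht
  · rintro x y (⟨a, b, hab, rfl, rfl⟩ | ⟨a, b, hab, rfl, rfl⟩)
    · have key : ∀ a b, α.r a b → (∃ t, topMid a = Sum.inl t ∧ α.r (Sum.inl i) (Sum.inl t)) →
          (∃ t, topMid b = Sum.inl t ∧ α.r (Sum.inl i) (Sum.inl t)) := by
        rintro (a | a) (b | b) hab ⟨t, ht, hit⟩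
        · simp only [topMid, Sum.inl.injEq] at ht
          subst ht
          exact ⟨b, rfl, α.iseqv.trans hit hab⟩
        · simp only [topMid, Sum.inl.injEq] at ht
          subst ht
          exact absurd (α.iseqv.trans hit hab) (hi' b)
        · simp [topMid] at ht
        · simp [topMid] at ht
      exact ⟨key a b hab, key b a (α.iseqv.symm hab)⟩
    · rcases a with a | a <;> rcases b with b | b <;> simp [midBot]

theorem prank_pmul_le (α β : Dgm n) : prank (pmul α β) ≤ prank α :=
  Set.ncard_le_ncard (domSet_pmul_subset α β) (Set.toFinite _)

/-- Merging the classes of two points. -/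
def mergeS {V : Type*} (s : Setoid V) (p q : V) : Setoid V where
  r x y := s.r x y ∨ ((s.r x p ∨ s.r x q) ∧ (s.r y p ∨ s.r y q))
  iseqv := by
    have hs := @s.iseqv.symm
    have ht := @s.iseqv.trans
    refine ⟨fun x => Or.inl (s.iseqv.refl x), ?_, ?_⟩
    · rintro x y (h | ⟨h, h'⟩)
      · exact Or.inl (hs h)
      · exact Or.inr ⟨h', h⟩
    · rintro x y z (h | ⟨h, h'⟩) (k | ⟨k, k'⟩)
      · exact Or.inl (ht h k)
      · exact Or.inr ⟨k.imp (ht h) (ht h), k'⟩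
      · exact Or.inr ⟨h, h'.imp (ht (hs k)) (ht (hs k))⟩
      · exact Or.inr ⟨h, k'⟩

/-- Blocks of size at most two and no crossings, among visible points. -/
def VInv {V : Type*} (pos : V → ℕ) (s : Setoid V) (Vis : V → Prop) : Prop :=
  (∀ x y z, Vis x → Vis y → Vis z → s.r x y → s.r x z → x = y ∨ x = z ∨ y = z) ∧
  (∀ a b c d, Vis a → Vis b → Vis c → Vis d → s.r a b → s.r c d →
    pos a < pos c → pos c < pos b → pos b < pos d → False)

theorem VInv_merge {V : Type*} (pos : V → ℕ) (hpos : Function.Injective pos) (s : Setoid V)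
    (Vis : V → Prop) (h : VInv pos s Vis) (p q : V) (hp : Vis p) (hq : Vis q)
    (hpq : pos p < pos q) (hadj : ∀ x, Vis x → ¬ (pos p < pos x ∧ pos x < pos q)) :
    VInv pos (mergeS s p q) (fun x => Vis x ∧ x ≠ p ∧ x ≠ q) := by
  obtain ⟨h1, h2⟩ := h
  have hs : ∀ {x y}, s.r x y → s.r y x := @s.iseqv.symm
  have ht : ∀ {x y z}, s.r x y → s.r y z → s.r x z := @s.iseqv.trans
  have u : ∀ w, Vis w → ∀ x y, Vis x → Vis y → x ≠ w → y ≠ w → s.r x w → s.r y w → x = y := by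
    intro w hw x y hx hy hxw hyw h h'
    rcases h1 w x y hw hx hy (hs h) (hs h') with e | e | e
    · exact absurd e.symm hxw
    · exact absurd e.symm hyw
    · exact e
  have hne : ∀ x, ∀ y, x ≠ y → pos x ≠ pos y := fun x y h e => h (hpos e)
  constructor
  · rintro x y z ⟨hx, hxp, hxq⟩ ⟨hy, hyp, hyq⟩ ⟨hz, hzp, hzq⟩ hxy hxz
    have up := u p hp
    have uq := u q hq
    rcases hxy with hxy | ⟨a, b⟩
    · rcases hxz with hxz | ⟨c, d⟩
      · exact h1 x y z hx hy hz hxy hxz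
      · left
        rcases c with c | c
        · exact up x y hx hy hxp hyp c (ht (hs hxy) c)
        · exact uq x y hx hy hxq hyq c (ht (hs hxy) c)
    · rcases hxz with hxz | ⟨c, d⟩
      · right; left
        rcases a with a | a
        · exact up x z hx hz hxp hzp a (ht (hs hxz) a)
        · exact uq x z hx hz hxq hzq a (ht (hs hxz) a)
      · grind
  · have cr : ∀ a b p q, Vis a → Vis b → Vis p → Vis q → a ≠ p → a ≠ q → b ≠ p → b ≠ q →
        (∀ x, Vis x → ¬ (pos p < pos x ∧ pos x < pos q)) →
        (∀ x, Vis x → ¬ (pos q < pos x ∧ pos x < pos p)) → s.r a b → 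
        ∀ c d, Vis c → Vis d → s.r c p → s.r d q →
        pos a < pos c → pos c < pos b → (pos b < pos d ∨ pos d < pos a) → False := by
      intro a b p q ha hb hp hq hap haq hbp hbq ad1 ad2 hab c d hc hd hcp hdq l1 l2 l3
      have n1 := hne _ _ hap
      have n2 := hne _ _ haq
      have n3 := hne _ _ hbp
      have n4 := hne _ _ hbq
      have a1 := ad1 a ha
      have a2 := ad2 a ha
      have a3 := ad1 b hb
      have a4 := ad2 b hb
      have h2' : ∀ a b c d, Vis a → Vis b → Vis c → Vis d → s.r a b → s.r c d →
          ¬ (pos a < pos c ∧ pos c < pos b ∧ pos b < pos d) :=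
        fun a b c d ha hb hc hd h h' l => h2 a b c d ha hb hc hd h h' l.1 l.2.1 l.2.2
      have k1 := h2' a b c p ha hb hc hp hab hcp
      have k2 := h2' p c a b hp hc ha hb (hs hcp) hab
      have k5 := h2' a b q d ha hb hq hd hab (hs hdq)
      have k6 := h2' d q a b hd hq ha hb hdq hab
      by_cases hpa : pos p < pos a
      · exact k2 ⟨hpa, l1, l2⟩
      by_cases hpb : pos b < pos p
      · exact k1 ⟨l1, l2, hpb⟩
      have q1 : pos a < pos q := by clear k1 k2 k5 k6 l3; omega
      have q2 : pos q < pos b := by clear k1 k2 k5 k6 l3; omega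
      rcases l3 with l3 | l3
      · exact k5 ⟨q1, q2, l3⟩
      · exact k6 ⟨l3, q1, q2⟩
    rintro a b c d ⟨ha, hap, haq⟩ ⟨hb, hbp, hbq⟩ ⟨hc, hcp, hcq⟩ ⟨hd, hdp, hdq⟩ hab hcd l1 l2 l3
    have hadj' : ∀ x, Vis x → ¬ (pos q < pos x ∧ pos x < pos p) := by
      intro x _; omega
    rcases hab with hab | ⟨a1, b1⟩
    · rcases hcd with hcd | ⟨c1, d1⟩
      · exact h2 a b c d ha hb hc hd hab hcd l1 l2 l3
      · rcases c1 with c1 | c1 <;> rcases d1 with d1 | d1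
        · exact h2 a b c d ha hb hc hd hab (ht c1 (hs d1)) l1 l2 l3
        · exact cr a b p q ha hb hp hq hap haq hbp hbq hadj hadj' hab c d hc hd c1 d1 l1 l2 (Or.inl l3)
        · exact cr a b q p ha hb hq hp haq hap hbq hbp hadj' hadj hab c d hc hd c1 d1 l1 l2 (Or.inl l3)
        · exact h2 a b c d ha hb hc hd hab (ht c1 (hs d1)) l1 l2 l3
    · rcases hcd with hcd | ⟨c1, d1⟩
      · rcases a1 with a1 | a1 <;> rcases b1 with b1 | b1
        · exact h2 a b c d ha hb hc hd (ht a1 (hs b1)) hcd l1 l2 l3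
        · exact cr c d q p hc hd hq hp hcq hcp hdq hdp hadj' hadj hcd b a hb ha b1 a1 l2 l3 (Or.inr l1)
        · exact cr c d p q hc hd hp hq hcp hcq hdp hdq hadj hadj' hcd b a hb ha b1 a1 l2 l3 (Or.inr l1)
        · exact h2 a b c d ha hb hc hd (ht a1 (hs b1)) hcd l1 l2 l3
      · have up := u p hp
        have uq := u q hq
        have e1 : a ≠ b := fun e => by subst e; omega
        have e2 : a ≠ c := fun e => by subst e; omega
        have e3 : b ≠ c := fun e => by subst e; omega
        have e4 : a ≠ d := fun e => by subst e; omega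
        have e5 : b ≠ d := fun e => by subst e; omega
        have up' : ∀ x y, Vis x → Vis y → x ≠ p → y ≠ p → x ≠ y → ¬ (s.r x p ∧ s.r y p) :=
          fun x y hx hy h h' ne l => ne (up x y hx hy h h' l.1 l.2)
        have uq' : ∀ x y, Vis x → Vis y → x ≠ q → y ≠ q → x ≠ y → ¬ (s.r x q ∧ s.r y q) :=
          fun x y hx hy h h' ne l => ne (uq x y hx hy h h' l.1 l.2)
        have p1 := up' a b ha hb hap hbp e1
        have p2 := up' a c ha hc hap hcp e2
        have p3 := up' b c hb hc hbp hcp e3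
        have q1 := uq' a b ha hb haq hbq e1
        have q2 := uq' a c ha hc haq hcq e2
        have q3 := uq' b c hb hc hbq hcq e3
        rcases a1 with a1 | a1 <;> rcases b1 with b1 | b1 <;> rcases c1 with c1 | c1 <;>
          first
            | exact p1 ⟨a1, b1⟩ | exact p2 ⟨a1, c1⟩ | exact p3 ⟨b1, c1⟩
            | exact q1 ⟨a1, b1⟩ | exact q2 ⟨a1, c1⟩ | exact q3 ⟨b1, c1⟩

/-- Position on the line of length `4n`. -/
def pos4 : PBV n ⊕ PBV n → ℕ
  | Sum.inl x => vpos x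
  | Sum.inr x => 2 * n + vpos x

theorem vpos_lt (x : PBV n) : vpos x < 2 * n := by
  rcases x with i | i <;> have := i.2 <;> simp only [vpos] <;> omega

theorem vpos_inj : Function.Injective (vpos (n := n)) := by
  rintro (i | i) (j | j) h <;> have := i.2 <;> have := j.2 <;> simp only [vpos] at h
  · congr 1; exact Fin.ext h
  · omega
  · omega
  · congr 1; apply Fin.ext; omega

theorem pos4_inj : Function.Injective (pos4 (n := n)) := by
  rintro (i | i) (j | j) h <;> have := vpos_lt i <;> have := vpos_lt j <;> simp only [pos4] at h
  · rw [vpos_inj h]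
  · omega
  · omega
  · rw [vpos_inj (by omega : vpos i = vpos j)]

/-- Visible points at stage `t`. -/
def vis4 (t : ℕ) : PBV n ⊕ PBV n → Prop
  | Sum.inl (Sum.inr i) => t ≤ i
  | Sum.inr (Sum.inl i) => t ≤ i
  | _ => True

/-- disjoint sum of two diagrams -/
def sumS (α β : Dgm n) : Setoid (PBV n ⊕ PBV n) where
  r x y := match x, y with
    | Sum.inl a, Sum.inl b => α.r a b
    | Sum.inr a, Sum.inr b => β.r a b
    | _, _ => False
  iseqv := by
    refine ⟨?_, ?_, ?_⟩
    · rintro (x | x)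
      · exact α.iseqv.refl x
      · exact β.iseqv.refl x
    · rintro (x | x) (y | y) h
      · exact α.iseqv.symm h
      · exact h
      · exact h
      · exact β.iseqv.symm h
    · rintro (x | x) (y | y) (z | z) h h' <;> first | exact h.elim | exact h'.elim | skip
      · exact α.iseqv.trans h h'
      · exact β.iseqv.trans h h'

theorem stage4 (α β : Dgm n) (hα : α ∈ Mset n) (hβ : β ∈ Mset n) (t : ℕ) (htn : t ≤ n) :
    ∃ R : Setoid (PBV n ⊕ PBV n), VInv pos4 R (vis4 t) ∧
      (∀ a b, α.r a b → R.r (Sum.inl a) (Sum.inl b)) ∧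
      (∀ a b, β.r a b → R.r (Sum.inr a) (Sum.inr b)) ∧
      (∀ i : Fin n, (i : ℕ) < t → R.r (Sum.inl (Sum.inr i)) (Sum.inr (Sum.inl i))) := by
  induction t with
  | zero =>
    refine ⟨sumS α β, ⟨?_, ?_⟩, fun a b h => h, fun a b h => h, fun i h => absurd h (by omega)⟩
    · rintro (x | x) (y | y) (z | z) - - - h h' <;> first | exact h.elim | exact h'.elim | skip
      · rcases hα.1 x y z h h' with e | e | e <;> simp [e]
      · rcases hβ.1 x y z h h' with e | e | e <;> simp [e]
    · rintro (a | a) (b | b) (c | c) (d | d) - - - - h h' l1 l2 l3 <;>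
        first | exact h.elim | exact h'.elim | skip
      · exact hα.2 a b c d h h' l1 l2 l3
      · have := vpos_lt b
        simp only [pos4] at l1 l2 l3; omega
      · have := vpos_lt c
        simp only [pos4] at l1 l2 l3; omega
      · simp only [pos4] at l1 l2 l3
        exact hβ.2 a b c d h h' (by omega) (by omega) (by omega)
  | succ t ih =>
    obtain ⟨R, hR, h1, h2, h3⟩ := ih (by omega)
    let i0 : Fin n := ⟨t, by omega⟩
    let p : PBV n ⊕ PBV n := Sum.inl (Sum.inr i0)
    let q : PBV n ⊕ PBV n := Sum.inr (Sum.inl i0)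
    have hm := VInv_merge pos4 pos4_inj R (vis4 t) hR p q (by simp [p, vis4, i0])
      (by simp [q, vis4, i0]) (by simp only [p, q, pos4, vpos, i0]; omega) (by
        rintro ((x | x) | (x | x)) hx <;> have := x.2 <;> simp only [vis4] at hx <;>
          simp only [p, q, pos4, vpos, i0] <;> omega)
    refine ⟨mergeS R p q, ?_, fun a b h => Or.inl (h1 a b h), fun a b h => Or.inl (h2 a b h), ?_⟩
    · have hv : ∀ x, vis4 (n := n) (t+1) x → vis4 t x ∧ x ≠ p ∧ x ≠ q := by
        rintro ((x | x) | (x | x)) hx <;> simp only [vis4] at hx ⊢ <;>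
          simp [p, q, i0, Fin.ext_iff] <;> omega
      exact ⟨fun x y z hx hy hz => hm.1 x y z (hv _ hx) (hv _ hy) (hv _ hz),
        fun a b c d ha hb hc hd => hm.2 a b c d (hv _ ha) (hv _ hb) (hv _ hc) (hv _ hd)⟩
    · intro i hi
      by_cases hit : (i : ℕ) < t
      · exact Or.inl (h3 i hit)
      · have : i = i0 := Fin.ext (by simp only [i0]; omega)
        subst this
        exact Or.inr ⟨Or.inl (R.iseqv.refl _), Or.inr (R.iseqv.refl _)⟩

theorem Mset_pmul (α β : Dgm n) (hα : α ∈ Mset n) (hβ : β ∈ Mset n) : pmul α β ∈ Mset n := by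
  obtain ⟨R, hR, h1, h2, h3⟩ := stage4 α β hα hβ n le_rfl
  let φ : V3 n → PBV n ⊕ PBV n := fun x => match x with
    | Sum.inl i => Sum.inl (Sum.inl i)
    | Sum.inr (Sum.inl i) => Sum.inr (Sum.inl i)
    | Sum.inr (Sum.inr i) => Sum.inr (Sum.inr i)
  have hφα : ∀ a, R.r (Sum.inl a) (φ (topMid a)) := by
    rintro (a | a)
    · exact R.iseqv.refl _
    · exact h3 a a.2
  have hφβ : ∀ a, Sum.inr a = φ (midBot a) := by
    rintro (a | a) <;> rfl
  have key : ∀ x y, (pmul α β).r x y → R.r (φ (topBot x)) (φ (topBot y)) := by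
    intro x y h
    refine RGen_setoid R φ ?_ h
    rintro x y (⟨a, b, hab, rfl, rfl⟩ | ⟨a, b, hab, rfl, rfl⟩)
    · exact R.iseqv.trans (R.iseqv.symm (hφα a)) (R.iseqv.trans (h1 a b hab) (hφα b))
    · rw [← hφβ, ← hφβ]; exact h2 a b hab
  have hvis : ∀ x : PBV n, vis4 n (φ (topBot x)) := by rintro (x | x) <;> trivial
  have hinj : ∀ x y : PBV n, φ (topBot x) = φ (topBot y) → x = y := by
    rintro (x | x) (y | y) h <;> simp [φ, topBot] at h <;> rw [h]
  have hp : ∀ x y : PBV n, vpos x < vpos y → pos4 (φ (topBot x)) < pos4 (φ (topBot y)) := by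
    rintro (x | x) (y | y) h <;> have := x.2 <;> have := y.2 <;>
      simp only [φ, topBot, pos4, vpos] at h ⊢ <;> omega
  constructor
  · intro x y z h h'
    rcases hR.1 _ _ _ (hvis x) (hvis y) (hvis z) (key _ _ h) (key _ _ h') with e | e | e
    · exact Or.inl (hinj _ _ e)
    · exact Or.inr (Or.inl (hinj _ _ e))
    · exact Or.inr (Or.inr (hinj _ _ e))
  · intro a b c d h h' l1 l2 l3
    exact hR.2 _ _ _ _ (hvis a) (hvis b) (hvis c) (hvis d) (key _ _ h) (key _ _ h')
      (hp _ _ l1) (hp _ _ l2) (hp _ _ l3)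

end Dgm
namespace Dgm

variable {n : ℕ}

/-- the column index of a vertex -/
def colIdx : PBV n → Fin n := Sum.elim id id

/-- all blocks lie in a single column -/
def ColLike (α : Dgm n) : Prop := ∀ u v, α.r u v → colIdx u = colIdx v

theorem colLike_pmul (α β : Dgm n) (ha : ColLike α) (hb : ColLike β) : ColLike (pmul α β) := by
  intro u v h
  let φ : V3 n → Fin n := Sum.elim id (Sum.elim id id)
  have h1 : ∀ x : PBV n, φ (topMid x) = colIdx x := by rintro (x | x) <;> rfl
  have h2 : ∀ x : PBV n, φ (midBot x) = colIdx x := by rintro (x | x) <;> rfl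
  have h3 : ∀ x : PBV n, φ (topBot x) = colIdx x := by rintro (x | x) <;> rfl
  have := RGen_label φ (r := prodEdges α β) ?_ h
  · rwa [h3, h3] at this
  · rintro x y (⟨a, b, hab, rfl, rfl⟩ | ⟨a, b, hab, rfl, rfl⟩)
    · rw [h1, h1]; exact ha _ _ hab
    · rw [h2, h2]; exact hb _ _ hab

theorem domSet_pmul_right (α β : Dgm n) (ha : ColLike α) : domSet (pmul α β) ⊆ domSet β := by
  rintro i ⟨j, hj⟩
  by_contra hi
  have hi' : ∀ j, ¬ β.r (Sum.inl i) (Sum.inr j) := fun j h => hi ⟨j, h⟩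
  let C : V3 n → Prop := Sum.elim (fun t => β.r (Sum.inl i) (Sum.inl t))
    (Sum.elim (fun t => β.r (Sum.inl i) (Sum.inl t)) (fun _ => False))
  have h1 : ∀ x : PBV n, C (topMid x) ↔ β.r (Sum.inl i) (Sum.inl (colIdx x)) := by
    rintro (x | x) <;> rfl
  have h2 : ∀ x : PBV n, C (midBot x) ↔ β.r (Sum.inl i) x := by
    rintro (x | x)
    · rfl
    · exact ⟨fun h => h.elim, fun h => hi' _ h⟩
  have := RGen_closed (r := prodEdges α β) C ?_ hj
  · exact this.1 (β.iseqv.refl _)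
  · rintro x y (⟨a, b, hab, rfl, rfl⟩ | ⟨a, b, hab, rfl, rfl⟩)
    · rw [h1, h1, ha _ _ hab]
    · rw [h2, h2]
      exact ⟨fun h => β.iseqv.trans h hab, fun h => β.iseqv.trans h (β.iseqv.symm hab)⟩

theorem cosparse_mono {A B : Set (Fin n)} (h : A ⊆ B) (hA : CosparseS A) : CosparseS B :=
  fun i j hi hj => hA i j (fun hh => hi (h hh)) (fun hh => hj (h hh))

theorem colLike_of_idpt (ε : Dgm n) (hM : ε ∈ Mset n) (hid : pmul ε ε = ε)
    (hc : CosparseS (domSet ε)) : ColLike ε := by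
  obtain ⟨hPB, hPl⟩ := hM
  have hs : ∀ {x y}, ε.r x y → ε.r y x := @ε.iseqv.symm
  have ht : ∀ {x y z}, ε.r x y → ε.r y z → ε.r x z := @ε.iseqv.trans
  -- no transversal point lies in an upper hook
  have hnt : ∀ u v : Fin n, u ≠ v → ε.r (Sum.inl u) (Sum.inl v) → u ∉ domSet ε := by
    rintro u v huv h ⟨w, hw⟩
    rcases hPB _ _ _ h hw with e | e | e
    · exact huv (Sum.inl.inj e)
    · simp at e
    · simp at e
  have hlt : ∀ u v : Fin n, u < v → ¬ ε.r (Sum.inl u) (Sum.inl v) := by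
    intro u v huv h
    have hu := hnt u v huv.ne h
    have hv := hnt v u huv.ne' (hs h)
    have hne := hc u v hu hv
    have huv' : (u : ℕ) < v := huv
    let w : Fin n := ⟨u + 1, by have := v.2; omega⟩
    have hw : w ∈ domSet ε := by
      by_contra hw
      exact hc u w hu hw rfl
    obtain ⟨z, hz⟩ := hw
    refine hPl _ _ _ _ h hz ?_ ?_ ?_ <;> have := z.2 <;> have := v.2 <;>
      simp only [vpos, w] <;> omega
  have hup : ∀ u v : Fin n, ε.r (Sum.inl u) (Sum.inl v) → u = v := by
    intro u v h
    rcases lt_trichotomy u v with l | l | l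
    · exact absurd h (hlt u v l)
    · exact l
    · exact absurd (hs h) (hlt v u l)
  have hcod : ∀ a b : Fin n, ε.r (Sum.inl a) (Sum.inr b) → b ∈ domSet ε := by
    intro a b hab
    by_contra hb
    have hb' : ∀ j, ¬ ε.r (Sum.inl b) (Sum.inr j) := fun j h => hb ⟨j, h⟩
    have hab' : (pmul ε ε).r (Sum.inl a) (Sum.inr b) := by rw [hid]; exact hab
    let C : V3 n → Prop := Sum.elim (fun t => t = a) (Sum.elim (fun t => t = b) (fun _ => False))
    have := RGen_closed (r := prodEdges ε ε) C ?_ hab'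
    · exact this.1 rfl
    · have h1 : ∀ x : PBV n, C (topMid x) ↔ ε.r (Sum.inl a) x := by
        rintro (x | x)
        · exact ⟨fun h => by cases (show x = a from h); exact ε.iseqv.refl _,
            fun h => (hup _ _ h).symm⟩
        · refine ⟨fun h => by cases (show x = b from h); exact hab, fun h => ?_⟩
          rcases hPB _ _ _ hab h with e | e | e
          · simp at e
          · simp at e
          · exact (Sum.inr.inj e).symm
      have h2 : ∀ x : PBV n, C (midBot x) ↔ ε.r (Sum.inl b) x := by
        rintro (x | x)
        · exact ⟨fun h => by cases (show x = b from h); exact ε.iseqv.refl _,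
            fun h => (hup _ _ h).symm⟩
        · exact ⟨fun h => h.elim, fun h => hb' _ h⟩
      rintro x y (⟨a', b', hab, rfl, rfl⟩ | ⟨a', b', hab, rfl, rfl⟩)
      · rw [h1, h1]; exact ⟨fun h => ht h hab, fun h => ht h (hs hab)⟩
      · rw [h2, h2]; exact ⟨fun h => ht h hab, fun h => ht h (hs hab)⟩
  have htr : ∀ a b : Fin n, ε.r (Sum.inl a) (Sum.inr b) → a = b := by
    intro a b hab
    obtain ⟨c, hbc⟩ := hcod a b hab
    have hac : (pmul ε ε).r (Sum.inl a) (Sum.inr c) := by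
      refine RGen.trans (y := Sum.inr (Sum.inl b)) (RGen.rel ?_) (RGen.rel ?_)
      · exact Or.inl ⟨_, _, hab, rfl, rfl⟩
      · exact Or.inr ⟨_, _, hbc, rfl, rfl⟩
    rw [hid] at hac
    rcases hPB _ _ _ hab hac with e | e | e
    · simp at e
    · simp at e
    · have := Sum.inr.inj e
      subst this
      exact hup _ _ (ht hab (hs hbc))
  have hself : ∀ a, a ∈ domSet ε → ε.r (Sum.inl a) (Sum.inr a) := by
    rintro a ⟨b, hab⟩
    have := htr _ _ hab
    subst this; exact hab
  have hlt2 : ∀ u v : Fin n, u < v → ¬ ε.r (Sum.inr u) (Sum.inr v) := by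
    intro u v huv h
    have hnt2 : ∀ u v : Fin n, u ≠ v → ε.r (Sum.inr u) (Sum.inr v) → u ∉ domSet ε := by
      intro u v huv h hd
      rcases hPB _ _ _ h (hs (hself u hd)) with e | e | e
      · exact huv (Sum.inr.inj e)
      · simp at e
      · simp at e
    have hu := hnt2 u v huv.ne h
    have hv := hnt2 v u huv.ne' (hs h)
    have hne := hc u v hu hv
    have huv' : (u : ℕ) < v := huv
    let w : Fin n := ⟨u + 1, by have := v.2; omega⟩
    have hw : w ∈ domSet ε := by
      by_contra hw
      exact hc u w hu hw rfl
    refine hPl _ _ _ _ (hself w hw) (hs h) ?_ ?_ ?_ <;> have := v.2 <;>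
      simp only [vpos, w] <;> omega
  rintro (u | u) (v | v) h
  · exact hup _ _ h
  · exact htr _ _ h
  · exact (htr _ _ (hs h)).symm
  · rcases lt_trichotomy u v with l | l | l
    · exact absurd h (hlt2 u v l)
    · exact l
    · exact absurd (hs h) (hlt2 v u l)

theorem colLike_of_gen {T : Set (Dgm n)} (hT : T ⊆ Mset n) (x : Dgm n)
    (hx : MClo pmul {x ∈ T | pmul x x = x} x) : CosparseS (domSet x) → ColLike x := by
  induction hx with
  | base h => exact fun hc => colLike_of_idpt _ (hT h.1) h.2 hc
  | @mul y z _ _ ih1 ih2 =>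
    intro hc
    have hy := ih1 (cosparse_mono (domSet_pmul_subset _ _) hc)
    exact colLike_pmul _ _ hy (ih2 (cosparse_mono (domSet_pmul_right _ _ hy) hc))

/-- the diagram joining `2k+1` to `(2k)'` -/
def shiftD (n : ℕ) : Dgm n :=
  Setoid.ker (fun x : PBV n =>
    match x with
    | Sum.inl a => if (a : ℕ) % 2 = 1 then (Sum.inr ((a : ℕ) - 1) : ℕ ⊕ ℕ) else Sum.inl (a : ℕ)
    | Sum.inr j => Sum.inr (j : ℕ))

theorem shiftD_ll (a b : Fin n) : (shiftD n).r (Sum.inl a) (Sum.inl b) ↔ a = b := by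
  change (ite _ _ _ = ite _ _ _) ↔ _
  rw [Fin.ext_iff]
  split_ifs <;> simp <;> omega

theorem shiftD_lr (a b : Fin n) :
    (shiftD n).r (Sum.inl a) (Sum.inr b) ↔ ((a : ℕ) % 2 = 1 ∧ (a : ℕ) = b + 1) := by
  change (ite _ _ _ = _) ↔ _
  split_ifs <;> simp <;> omega

theorem shiftD_rr (a b : Fin n) : (shiftD n).r (Sum.inr a) (Sum.inr b) ↔ a = b := by
  change ((Sum.inr _ : ℕ ⊕ ℕ) = Sum.inr _) ↔ _
  rw [Fin.ext_iff]; simp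

theorem shiftD_rl (a b : Fin n) :
    (shiftD n).r (Sum.inr b) (Sum.inl a) ↔ ((a : ℕ) % 2 = 1 ∧ (a : ℕ) = b + 1) := by
  rw [← shiftD_lr]; exact ⟨(shiftD n).iseqv.symm, (shiftD n).iseqv.symm⟩

theorem shiftD_mem : shiftD n ∈ Mset n := by
  constructor
  · rintro (x | x) (y | y) (z | z) h h' <;>
      simp only [shiftD_ll, shiftD_lr, shiftD_rr, shiftD_rl] at h h' <;>
      simp [Fin.ext_iff] at h h' ⊢ <;> omega
  · rintro (a | a) (b | b) (c | c) (d | d) h h' l1 l2 l3 <;>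
      simp only [shiftD_ll, shiftD_lr, shiftD_rr, shiftD_rl, vpos, Fin.ext_iff] at h h' l1 l2 l3 <;>
      have := a.2 <;> have := b.2 <;> have := c.2 <;> have := d.2 <;> omega

theorem shiftD_dom : domSet (shiftD n) = {a : Fin n | (a : ℕ) % 2 = 1} := by
  ext a
  simp only [domSet, Set.mem_setOf_eq, shiftD_lr]
  constructor
  · rintro ⟨j, h, _⟩; exact h
  · intro h
    have := a.2
    exact ⟨⟨a - 1, by omega⟩, h, by simp only []; omega⟩

theorem shiftD_rank : prank (shiftD n) ≤ n / 2 := by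
  rw [prank, shiftD_dom]
  have : Set.ncard {a : Fin n | (a : ℕ) % 2 = 1} ≤ Set.ncard (↑(Finset.range (n / 2)) : Set ℕ) := by
    refine Set.ncard_le_ncard_of_injOn (fun a => (a : ℕ) / 2) ?_ ?_ (Finset.finite_toSet _)
    · intro a ha
      have := a.2
      simp only [Set.mem_setOf_eq] at ha
      simp only [Finset.coe_range, Set.mem_Iio]; omega
    · intro a ha b hb h
      simp only [Set.mem_setOf_eq] at ha hb h
      apply Fin.ext; omega
  rwa [Set.ncard_coe_finset, Finset.card_range] at this

theorem not_idptGen (n r : ℕ) (hn : 2 ≤ n) (hr : n / 2 ≤ r) :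
    ¬ IdptGen (pmul (n := n)) (IM n r) := by
  intro h
  have hmem : shiftD n ∈ genSet (pmul (n := n)) {x ∈ IM n r | pmul x x = x} := by
    rw [show genSet (pmul (n := n)) {x ∈ IM n r | pmul x x = x} = IM n r from h]
    exact ⟨shiftD_mem, shiftD_rank.trans hr⟩
  have hcol := colLike_of_gen (fun x hx => hx.1) _ hmem (by
    intro i j hi hj
    rw [shiftD_dom] at hi hj
    simp only [Set.mem_setOf_eq] at hi hj
    omega)
  have := hcol (Sum.inl ⟨1, by omega⟩) (Sum.inr ⟨0, by omega⟩) ((shiftD_lr _ _).2 (by simp))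
  simp [colIdx] at this

end Dgm
namespace Dgm

/-- One-sided pattern with `k` defects. -/
structure Pat (n k : ℕ) where
  f : Fin k → Fin n
  H : Fin n → Fin n → Prop
  mono : StrictMono f
  symm : ∀ x y, H x y → H y x
  func : ∀ x y z, H x y → H x z → y = z
  disj : ∀ i y, ¬ H (f i) y
  nest : ∀ x y i, H x y → x < f i → f i < y → False
  cross : ∀ x y z w, H x y → H z w → x < z → z < y → y < w → False

variable {n k : ℕ}

/-- label of a point of a pattern -/
def Pat.lab (P : Pat n k) (x : Fin n) : Fin k ⊕ Set (Fin n) :=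
  if h : ∃ i, P.f i = x then Sum.inl h.choose else Sum.inr {z | z = x ∨ P.H x z}

theorem Pat.lab_f (P : Pat n k) (i : Fin k) : P.lab (P.f i) = Sum.inl i := by
  have h : ∃ j, P.f j = P.f i := ⟨i, rfl⟩
  rw [Pat.lab, dif_pos h]
  rw [P.mono.injective h.choose_spec]

theorem Pat.lab_inl (P : Pat n k) (x : Fin n) (i : Fin k) : P.lab x = Sum.inl i ↔ P.f i = x := by
  constructor
  · intro h
    by_cases hx : ∃ j, P.f j = x
    · obtain ⟨j, rfl⟩ := hx
      rw [P.lab_f] at h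
      rw [Sum.inl.inj h]
    · rw [Pat.lab, dif_neg hx] at h
      simp at h
  · rintro rfl; exact P.lab_f i

theorem Pat.lab_eq (P : Pat n k) (x y : Fin n) : P.lab x = P.lab y ↔ x = y ∨ P.H x y := by
  constructor
  · intro h
    by_cases hx : ∃ j, P.f j = x
    · obtain ⟨j, rfl⟩ := hx
      rw [P.lab_f] at h
      left; exact (P.lab_inl _ _).1 h.symm
    · by_cases hy : ∃ j, P.f j = y
      · obtain ⟨j, rfl⟩ := hy
        rw [P.lab_f] at h
        left; exact ((P.lab_inl _ _).1 h).symm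
      · rw [Pat.lab, Pat.lab, dif_neg hx, dif_neg hy] at h
        have h' := Sum.inr.inj h
        have : y ∈ {z | z = x ∨ P.H x z} := by rw [h']; exact Or.inl rfl
        rcases this with e | e
        · exact Or.inl e.symm
        · exact Or.inr e
  · rintro (rfl | h)
    · rfl
    · have hx : ¬ ∃ j, P.f j = x := by rintro ⟨j, rfl⟩; exact P.disj _ _ h
      have hy : ¬ ∃ j, P.f j = y := by rintro ⟨j, rfl⟩; exact P.disj _ _ (P.symm _ _ h)
      rw [Pat.lab, Pat.lab, dif_neg hx, dif_neg hy]
      congr 1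
      ext z
      constructor
      · rintro (rfl | h')
        · exact Or.inr (P.symm _ _ h)
        · exact Or.inl (P.func _ _ _ h' h)
      · rintro (rfl | h')
        · exact Or.inr h
        · exact Or.inl (P.func _ _ _ h' (P.symm _ _ h))

/-- tag the non-line labels -/
def tagL (t : ℕ) : Fin k ⊕ Set (Fin n) → Fin k ⊕ (ℕ × Set (Fin n)) := Sum.map id (Prod.mk t)

theorem tagL_inj (t : ℕ) : Function.Injective (tagL (n := n) (k := k) t) := by
  rintro (a | a) (b | b) h <;> simpa [tagL] using h

theorem tagL_ne (s t : ℕ) (hst : s ≠ t) (x y : Fin k ⊕ Set (Fin n)) :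
    tagL s x = tagL t y ↔ ∃ i, x = Sum.inl i ∧ y = Sum.inl i := by
  rcases x with a | a <;> rcases y with b | b <;> simp [tagL, hst, eq_comm]

/-- the label of a vertex of the diagram with upper pattern `P` and lower pattern `Q` -/
def labD (P Q : Pat n k) : PBV n → Fin k ⊕ (ℕ × Set (Fin n)) :=
  Sum.elim (fun a => tagL 0 (P.lab a)) (fun b => tagL 1 (Q.lab b))

/-- the diagram with upper pattern `P` and lower pattern `Q` -/
def DD (P Q : Pat n k) : Dgm n := Setoid.ker (labD P Q)

theorem DD_ll (P Q : Pat n k) (a b : Fin n) :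
    (DD P Q).r (Sum.inl a) (Sum.inl b) ↔ a = b ∨ P.H a b := by
  change tagL 0 (P.lab a) = tagL 0 (P.lab b) ↔ _
  rw [(tagL_inj 0).eq_iff, P.lab_eq]

theorem DD_rr (P Q : Pat n k) (a b : Fin n) :
    (DD P Q).r (Sum.inr a) (Sum.inr b) ↔ a = b ∨ Q.H a b := by
  change tagL 1 (Q.lab a) = tagL 1 (Q.lab b) ↔ _
  rw [(tagL_inj 1).eq_iff, Q.lab_eq]

theorem DD_lr (P Q : Pat n k) (a b : Fin n) :
    (DD P Q).r (Sum.inl a) (Sum.inr b) ↔ ∃ i, P.f i = a ∧ Q.f i = b := by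
  change tagL 0 (P.lab a) = tagL 1 (Q.lab b) ↔ _
  rw [tagL_ne _ _ (by norm_num)]
  simp only [Pat.lab_inl]

theorem DD_rl (P Q : Pat n k) (a b : Fin n) :
    (DD P Q).r (Sum.inr b) (Sum.inl a) ↔ ∃ i, P.f i = a ∧ Q.f i = b := by
  rw [← DD_lr]; exact ⟨(DD P Q).iseqv.symm, (DD P Q).iseqv.symm⟩

theorem DD_PB (P Q : Pat n k) : IsPB (DD P Q) := by
  have key : ∀ (R : Pat n k) (x y z : Fin n), (x = y ∨ R.H x y) → (x = z ∨ R.H x z) →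
      x = y ∨ x = z ∨ y = z := by
    rintro R x y z (h | h) (h' | h')
    · exact Or.inl h
    · exact Or.inl h
    · exact Or.inr (Or.inl h')
    · exact Or.inr (Or.inr (R.func _ _ _ h h'))
  rintro (x | x) (y | y) (z | z) h h' <;> simp only [DD_ll, DD_lr, DD_rl, DD_rr] at h h'
  · rcases key P x y z h h' with e | e | e <;> simp [e]
  · obtain ⟨i, rfl, rfl⟩ := h'
    rcases h with h | h
    · simp [h]
    · exact absurd h (P.disj _ _)
  · obtain ⟨i, rfl, rfl⟩ := h
    rcases h' with h | h
    · simp [h]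
    · exact absurd h (P.disj _ _)
  · obtain ⟨i, rfl, rfl⟩ := h
    obtain ⟨j, h1, rfl⟩ := h'
    rw [P.mono.injective h1]; simp
  · obtain ⟨i, rfl, rfl⟩ := h
    obtain ⟨j, rfl, h1⟩ := h'
    rw [Q.mono.injective h1]; simp
  · obtain ⟨i, rfl, rfl⟩ := h
    rcases h' with h | h
    · simp [h]
    · exact absurd h (Q.disj _ _)
  · obtain ⟨i, rfl, rfl⟩ := h'
    rcases h with h | h
    · simp [h]
    · exact absurd h (Q.disj _ _)
  · rcases key Q x y z h h' with e | e | e <;> simp [e]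

theorem DD_planar (P Q : Pat n k) : IsPlanar (DD P Q) := by
  rintro (a | a) (b | b) (c | c) (d | d) h h' l1 l2 l3 <;>
    simp only [DD_ll, DD_lr, DD_rl, DD_rr] at h h' <;> simp only [vpos] at l1 l2 l3 <;>
    have ha := a.2 <;> have hb := b.2 <;> have hc := c.2 <;> have hd := d.2 <;>
    first | omega | skip
  · rcases h with h | h
    · subst h; omega
    · rcases h' with h' | h'
      · subst h'; omega
      · exact P.cross _ _ _ _ h h' l1 l2 l3
  · rcases h with h | h
    · subst h; omega
    · obtain ⟨i, rfl, rfl⟩ := h'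
      exact P.nest _ _ i h l1 l2
  · obtain ⟨i, rfl, rfl⟩ := h
    obtain ⟨j, rfl, rfl⟩ := h'
    have h1 : i < j := P.mono.lt_iff_lt.1 l1
    have h2 := Q.mono h1
    rw [Fin.lt_def] at h2
    omega
  · obtain ⟨i, rfl, rfl⟩ := h
    rcases h' with h' | h'
    · subst h'; omega
    · exact Q.nest _ _ i (Q.symm _ _ h') (by rw [Fin.lt_def]; omega) (by rw [Fin.lt_def]; omega)
  · rcases h with h | h
    · subst h; omega
    · rcases h' with h' | h'
      · subst h'; omega
      · exact Q.cross _ _ _ _ (Q.symm _ _ h') (Q.symm _ _ h) (by rw [Fin.lt_def]; omega)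
          (by rw [Fin.lt_def]; omega) (by rw [Fin.lt_def]; omega)

theorem DD_rank (P Q : Pat n k) : prank (DD P Q) = k := by
  have : domSet (DD P Q) = Set.range P.f := by
    ext a
    simp only [domSet, Set.mem_setOf_eq, DD_lr, Set.mem_range]
    constructor
    · rintro ⟨_, i, h, _⟩; exact ⟨i, h⟩
    · rintro ⟨i, h⟩; exact ⟨_, i, h, rfl⟩
  rw [prank, this, Set.ncard_range_of_injective P.mono.injective, Nat.card_fin]

/-- Compatibility of patterns in the middle row. -/
def Compat (Q Q' : Pat n k) : Prop :=
  (∃ l : Fin n → Option (Fin k), (∀ i, l (Q.f i) = some i) ∧ (∀ i, l (Q'.f i) = some i) ∧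
    (∀ x y, Q.H x y → l x = l y) ∧ (∀ x y, Q'.H x y → l x = l y)) ∧
  (∀ i, RGen (fun x y => Q.H x y ∨ Q'.H x y) (Q.f i) (Q'.f i))

theorem Compat_of_eq (Q Q' : Pat n k) (h : Q.f = Q'.f) : Compat Q Q' := by
  refine ⟨⟨fun x => if h : ∃ i, Q.f i = x then some h.choose else none, ?_, ?_, ?_, ?_⟩, ?_⟩
  · intro i
    have hi : ∃ j, Q.f j = Q.f i := ⟨i, rfl⟩
    simp only [dif_pos hi, Q.mono.injective hi.choose_spec]
  · intro i
    rw [← h]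
    have hi : ∃ j, Q.f j = Q.f i := ⟨i, rfl⟩
    simp only [dif_pos hi, Q.mono.injective hi.choose_spec]
  · intro x y hxy
    have hx : ¬ ∃ j, Q.f j = x := by rintro ⟨j, rfl⟩; exact Q.disj _ _ hxy
    have hy : ¬ ∃ j, Q.f j = y := by rintro ⟨j, rfl⟩; exact Q.disj _ _ (Q.symm _ _ hxy)
    simp only [dif_neg hx, dif_neg hy]
  · intro x y hxy
    have hx : ¬ ∃ j, Q.f j = x := by rw [h]; rintro ⟨j, rfl⟩; exact Q'.disj _ _ hxy
    have hy : ¬ ∃ j, Q.f j = y := by rw [h]; rintro ⟨j, rfl⟩; exact Q'.disj _ _ (Q'.symm _ _ hxy)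
    simp only [dif_neg hx, dif_neg hy]
  · intro i; rw [h]; exact RGen.refl _

theorem DD_mul (P Q Q' R : Pat n k) (hc : Compat Q Q') :
    pmul (DD P Q) (DD Q' R) = DD P R := by
  obtain ⟨⟨l, hl1, hl2, hl3, hl4⟩, hpath⟩ := hc
  let ml : Fin n → Fin k ⊕ (ℕ × Set (Fin n)) := fun x => match l x with
    | some i => Sum.inl i
    | none => Sum.inr (2, ∅)
  have hml : ∀ x y, l x = l y → ml x = ml y := by
    intro x y h; simp only [ml, h]
  have hml1 : ∀ i, ml (Q.f i) = Sum.inl i := by intro i; simp only [ml, hl1]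
  have hml2 : ∀ i, ml (Q'.f i) = Sum.inl i := by intro i; simp only [ml, hl2]
  let φ : V3 n → Fin k ⊕ (ℕ × Set (Fin n)) :=
    Sum.elim (fun a => tagL 0 (P.lab a)) (Sum.elim ml (fun b => tagL 1 (R.lab b)))
  have hφ : ∀ x : PBV n, φ (topBot x) = labD P R x := by rintro (x | x) <;> rfl
  apply Setoid.ext
  intro x y
  constructor
  · intro h
    have := RGen_label (r := prodEdges (DD P Q) (DD Q' R)) φ ?_ h
    · rw [hφ, hφ] at this; exact this
    · rintro x y (⟨a, b, hab, rfl, rfl⟩ | ⟨a, b, hab, rfl, rfl⟩)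
      · rcases a with a | a <;> rcases b with b | b
        · exact hab
        · rw [DD_lr] at hab
          obtain ⟨i, rfl, rfl⟩ := hab
          change tagL 0 (P.lab (P.f i)) = ml (Q.f i)
          rw [hml1, P.lab_f]; rfl
        · rw [DD_rl] at hab
          obtain ⟨i, rfl, rfl⟩ := hab
          change ml (Q.f i) = tagL 0 (P.lab (P.f i))
          rw [hml1, P.lab_f]; rfl
        · rw [DD_rr] at hab
          rcases hab with rfl | hab
          · rfl
          · exact hml _ _ (hl3 _ _ hab)
      · rcases a with a | a <;> rcases b with b | b
        · rw [DD_ll] at hab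
          rcases hab with rfl | hab
          · rfl
          · exact hml _ _ (hl4 _ _ hab)
        · rw [DD_lr] at hab
          obtain ⟨i, rfl, rfl⟩ := hab
          change ml (Q'.f i) = tagL 1 (R.lab (R.f i))
          rw [hml2, R.lab_f]; rfl
        · rw [DD_rl] at hab
          obtain ⟨i, rfl, rfl⟩ := hab
          change tagL 1 (R.lab (R.f i)) = ml (Q'.f i)
          rw [hml2, R.lab_f]; rfl
        · exact hab
  · have hmid : ∀ a b, RGen (fun x y => Q.H x y ∨ Q'.H x y) a b →
        RGen (prodEdges (DD P Q) (DD Q' R)) (Sum.inr (Sum.inl a)) (Sum.inr (Sum.inl b)) := by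
      intro a b h
      induction h with
      | @rel a b h =>
        rcases h with h | h
        · exact RGen.rel (Or.inl ⟨Sum.inr a, Sum.inr b, (DD_rr _ _ _ _).2 (Or.inr h), rfl, rfl⟩)
        · exact RGen.rel (Or.inr ⟨Sum.inl a, Sum.inl b, (DD_ll _ _ _ _).2 (Or.inr h), rfl, rfl⟩)
      | refl => exact RGen.refl _
      | symm _ ih => exact ih.symm
      | trans _ _ ih1 ih2 => exact ih1.trans ih2
    have hline : ∀ i, (pmul (DD P Q) (DD Q' R)).r (Sum.inl (P.f i)) (Sum.inr (R.f i)) := by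
      intro i
      refine RGen.trans (RGen.rel (Or.inl ⟨Sum.inl (P.f i), Sum.inr (Q.f i), ?_, rfl, rfl⟩))
        (RGen.trans (hmid _ _ (hpath i))
          (RGen.rel (Or.inr ⟨Sum.inl (Q'.f i), Sum.inr (R.f i), ?_, rfl, rfl⟩)))
      · exact (DD_lr _ _ _ _).2 ⟨i, rfl, rfl⟩
      · exact (DD_lr _ _ _ _).2 ⟨i, rfl, rfl⟩
    intro h
    change (DD P R).r x y at h
    change (pmul (DD P Q) (DD Q' R)).r x y
    rcases x with x | x <;> rcases y with y | y
    · exact RGen.rel (Or.inl ⟨Sum.inl x, Sum.inl y, h, rfl, rfl⟩)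
    · rw [DD_lr] at h
      obtain ⟨i, rfl, rfl⟩ := h
      exact hline i
    · rw [DD_rl] at h
      obtain ⟨i, rfl, rfl⟩ := h
      exact (hline i).symm
    · exact RGen.rel (Or.inr ⟨Sum.inr x, Sum.inr y, h, rfl, rfl⟩)

theorem Compat.symm {Q Q' : Pat n k} (h : Compat Q Q') : Compat Q' Q := by
  obtain ⟨⟨l, h1, h2, h3, h4⟩, hp⟩ := h
  refine ⟨⟨l, h2, h1, h4, h3⟩, fun i => ?_⟩
  have : (fun x y => Q'.H x y ∨ Q.H x y) = (fun x y => Q.H x y ∨ Q'.H x y) := by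
    funext x y; exact propext or_comm
  rw [this]
  exact (hp i).symm

/-- pattern without hooks -/
def pureP (f : Fin k → Fin n) (hf : StrictMono f) : Pat n k where
  f := f
  H := fun _ _ => False
  mono := hf
  symm := by tauto
  func := by tauto
  disj := by tauto
  nest := by tauto
  cross := by tauto

/-- pattern with one hook -/
def hookP (f : Fin k → Fin n) (hf : StrictMono f) (u v : Fin n)
    (hu : ∀ i, f i ≠ u) (hv : ∀ i, f i ≠ v) (h1 : ∀ i, ¬ (u < f i ∧ f i < v))
    (h2 : ∀ i, ¬ (v < f i ∧ f i < u)) : Pat n k where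
  f := f
  H := fun x y => (x = u ∧ y = v) ∨ (x = v ∧ y = u)
  mono := hf
  symm := by tauto
  func := by
    rintro x y z (⟨rfl, rfl⟩ | ⟨rfl, rfl⟩) (⟨h, rfl⟩ | ⟨h, rfl⟩) <;> first | rfl | exact h | exact h.symm
  disj := by
    rintro i y (⟨h, _⟩ | ⟨h, _⟩)
    · exact hu i h
    · exact hv i h
  nest := by
    rintro x y i (⟨rfl, rfl⟩ | ⟨rfl, rfl⟩) l1 l2
    · exact h1 i ⟨l1, l2⟩
    · exact h2 i ⟨l1, l2⟩
  cross := by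
    rintro x y z w (⟨rfl, rfl⟩ | ⟨rfl, rfl⟩) (⟨rfl, rfl⟩ | ⟨rfl, rfl⟩) l1 l2 l3 <;>
      first
        | exact absurd l1 (lt_irrefl _) | exact absurd l2 (lt_irrefl _)
        | exact absurd l3 (lt_irrefl _)

/-- elementary move -/
def Hop (f g : Fin k → Fin n) : Prop :=
  StrictMono f ∧ StrictMono g ∧ ∃ j u, (∀ i, i ≠ j → g i = f i) ∧
    ((f j < u ∧ u < g j) ∨ (g j < u ∧ u < f j))

theorem Hop.symm {f g : Fin k → Fin n} (h : Hop f g) : Hop g f := by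
  obtain ⟨hf, hg, j, u, h1, h2⟩ := h
  exact ⟨hg, hf, j, u, fun i hi => (h1 i hi).symm, h2.symm⟩

/-- the generated semigroup -/
abbrev GG (n r : ℕ) : Set (Dgm n) := genSet (pmul (n := n)) {x ∈ IM n r | pmul x x = x}

theorem DD_mem_GG {r : ℕ} (hk : k ≤ r) (P Q : Pat n k) (h : Compat P Q) : DD P Q ∈ GG n r :=
  MClo.base ⟨⟨⟨DD_PB P Q, DD_planar P Q⟩, (DD_rank P Q).trans_le hk⟩, DD_mul P Q P Q h.symm⟩

theorem Hop_mem {r : ℕ} (hk : k ≤ r) (f g : Fin k → Fin n) (hf : StrictMono f)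
    (hg : StrictMono g) (h : Hop f g) : DD (pureP f hf) (pureP g hg) ∈ GG n r := by
  obtain ⟨-, -, j, u, hfg, hu⟩ := h
  -- the other points avoid the interval
  have hout : ∀ i, i ≠ j → (f i < f j ∧ f i < g j) ∨ (f j < f i ∧ g j < f i) := by
    intro i hi
    rcases lt_or_gt_of_ne hi with l | l
    · left; exact ⟨hf l, by rw [← hfg i hi]; exact hg l⟩
    · right; exact ⟨hf l, by rw [← hfg i hi]; exact hg l⟩
  have a1 : ∀ i, f i ≠ u := by
    intro i e
    by_cases hi : i = j
    · subst hi; subst e; omega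
    · have := hout i hi; subst e; omega
  have a2 : ∀ i, f i ≠ g j := by
    intro i e
    by_cases hi : i = j
    · subst hi; omega
    · have := hout i hi; omega
  have a3 : ∀ i, ¬ (u < f i ∧ f i < g j) := by
    rintro i ⟨e1, e2⟩
    by_cases hi : i = j
    · subst hi; omega
    · have := hout i hi; omega
  have a4 : ∀ i, ¬ (g j < f i ∧ f i < u) := by
    rintro i ⟨e1, e2⟩
    by_cases hi : i = j
    · subst hi; omega
    · have := hout i hi; omega
  have b1 : ∀ i, g i ≠ f j := by
    intro i e
    by_cases hi : i = j
    · subst hi; omega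
    · have := hout i hi; rw [hfg i hi] at e; omega
  have b2 : ∀ i, g i ≠ u := by
    intro i e
    by_cases hi : i = j
    · subst hi; omega
    · rw [hfg i hi] at e; exact a1 i e
  have b3 : ∀ i, ¬ (f j < g i ∧ g i < u) := by
    rintro i ⟨e1, e2⟩
    by_cases hi : i = j
    · subst hi; omega
    · have := hout i hi; rw [hfg i hi] at e1 e2; omega
  have b4 : ∀ i, ¬ (u < g i ∧ g i < f j) := by
    rintro i ⟨e1, e2⟩
    by_cases hi : i = j
    · subst hi; omega
    · have := hout i hi; rw [hfg i hi] at e1 e2; omega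
  let X := hookP f hf u (g j) a1 a2 a3 a4
  let Y := hookP g hg (f j) u b1 b2 b3 b4
  have hXY : Compat X Y := by
    let l : Fin n → Option (Fin k) := fun x => if h : ∃ i, f i = x then some h.choose else
      if x = u ∨ x = g j then some j else none
    have l1 : ∀ i, l (f i) = some i := by
      intro i
      have hi : ∃ j, f j = f i := ⟨i, rfl⟩
      simp only [l, dif_pos hi, hf.injective hi.choose_spec]
    have l2 : l u = some j := by
      have hi : ¬ ∃ i, f i = u := by rintro ⟨i, hi⟩; exact a1 i hi
      simp only [l, dif_neg hi]; simp
    have l3 : l (g j) = some j := by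
      have hi : ¬ ∃ i, f i = g j := by rintro ⟨i, hi⟩; exact a2 i hi
      simp only [l, dif_neg hi]; simp
    refine ⟨⟨l, l1, ?_, ?_, ?_⟩, ?_⟩
    · intro i
      change l (g i) = some i
      by_cases hi : i = j
      · subst hi; exact l3
      · rw [hfg i hi]; exact l1 i
    · rintro x y (⟨rfl, rfl⟩ | ⟨rfl, rfl⟩)
      · rw [l2, l3]
      · rw [l2, l3]
    · rintro x y (⟨rfl, rfl⟩ | ⟨rfl, rfl⟩)
      · rw [l1, l2]
      · rw [l1, l2]
    · intro i
      change RGen _ (f i) (g i)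
      by_cases hi : i = j
      · subst hi
        exact RGen.trans (RGen.rel (Or.inr (Or.inl ⟨rfl, rfl⟩)))
          (RGen.rel (Or.inl (Or.inl ⟨rfl, rfl⟩)))
      · rw [hfg i hi]; exact RGen.refl _
  rw [← DD_mul (pureP f hf) X Y (pureP g hg) hXY]
  exact MClo.mul (DD_mem_GG hk _ _ (Compat_of_eq _ _ rfl)) (DD_mem_GG hk _ _ (Compat_of_eq _ _ rfl))

theorem reach_mem {r : ℕ} (hk : k ≤ r) (f g : Fin k → Fin n) (hf : StrictMono f)
    (h : Relation.ReflTransGen Hop f g) : ∀ hg : StrictMono g,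
    DD (pureP f hf) (pureP g hg) ∈ GG n r := by
  induction h with
  | refl => exact fun _ => DD_mem_GG hk _ _ (Compat_of_eq _ _ rfl)
  | @tail b c _ hbc ih =>
    intro hg
    rw [← DD_mul (pureP f hf) (pureP b hbc.1) (pureP b hbc.1) (pureP c hg) (Compat_of_eq _ _ rfl)]
    exact MClo.mul (ih hbc.1) (Hop_mem hk _ _ _ _ hbc)

theorem pack (t : ℕ) : ∀ (m : ℕ) (f : Fin k → Fin n), t ≤ k → m ≤ n → 2 * t + 2 ≤ m →
    StrictMono f → (∀ j : Fin k, (j : ℕ) < t → (f j : ℕ) < m) →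
    (∀ j : Fin k, t ≤ (j : ℕ) → m ≤ (f j : ℕ)) →
    ∃ g : Fin k → Fin n, StrictMono g ∧ Relation.ReflTransGen Hop f g ∧
      (∀ j : Fin k, (j : ℕ) < t → (g j : ℕ) = j) ∧ (∀ j : Fin k, t ≤ (j : ℕ) → g j = f j) := by
  induction t with
  | zero =>
    intro m f _ _ _ hf _ _
    exact ⟨f, hf, Relation.ReflTransGen.refl, fun j hj => absurd hj (by omega), fun _ _ => rfl⟩
  | succ t ih =>
    intro m f htk hmn hm hf hlo hhi
    let j0 : Fin k := ⟨t, by omega⟩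
    have claim : ∀ f : Fin k → Fin n, StrictMono f → 2 * t + 2 ≤ (f j0 : ℕ) →
        ∃ g : Fin k → Fin n, StrictMono g ∧ Relation.ReflTransGen Hop f g ∧
        (∀ j : Fin k, (j : ℕ) < t + 1 → (g j : ℕ) = j) ∧
        (∀ j : Fin k, t + 1 ≤ (j : ℕ) → g j = f j) := by
      intro f hf hj
      obtain ⟨g, hg, hfg, h1, h2⟩ := ih (f j0) f (by omega) (f j0).2.le hj hf
        (fun j hj => hf (show j < j0 from hj))
        (fun j hj => hf.monotone (show j0 ≤ j from hj))
      have hgj : g j0 = f j0 := h2 j0 le_rfl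
      have hfn := (f j0).2
      let g2 : Fin k → Fin n := Function.update g j0 ⟨t, by omega⟩
      have e1 : (g2 j0 : ℕ) = t := by simp [g2]
      have e2 : ∀ j, j ≠ j0 → g2 j = g j := fun j hj => by simp [g2, hj]
      have hg2 : StrictMono g2 := by
        intro a b hab
        have hgab := hg hab
        rw [Fin.lt_def] at hab hgab ⊢
        by_cases ha : a = j0
        · have hb : b ≠ j0 := by rintro rfl; rw [ha] at hab; omega
          rw [e2 b hb, ha, e1]
          rw [ha, hgj] at hgab
          omega
        · by_cases hb : b = j0
          · rw [e2 a ha, hb, e1]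
            rw [hb] at hab
            rw [h1 a hab]; exact hab
          · rw [e2 a ha, e2 b hb]; exact hgab
      refine ⟨g2, hg2, hfg.tail ⟨hg, hg2, j0, ⟨t + 1, by omega⟩, e2, Or.inr ⟨?_, ?_⟩⟩, ?_, ?_⟩
      · rw [Fin.lt_def, e1]; simp
      · rw [Fin.lt_def, hgj]; simp only []; omega
      · intro j hj
        by_cases h : j = j0
        · rw [h, e1]
        · rw [e2 j h]
          have : (j : ℕ) ≠ t := fun e => h (Fin.ext e)
          exact h1 j (by omega)
      · intro j hj
        have : j ≠ j0 := by rintro rfl; simp only [j0] at hj; omega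
        rw [e2 j this]; exact h2 j (by omega)
    by_cases hj : 2 * t + 2 ≤ (f j0 : ℕ)
    · exact claim f hf hj
    · let f1 : Fin k → Fin n := Function.update f j0 ⟨m - 1, by omega⟩
      have e1 : (f1 j0 : ℕ) = m - 1 := by simp [f1]
      have e2 : ∀ j, j ≠ j0 → f1 j = f j := fun j hj => by simp [f1, hj]
      have hf1 : StrictMono f1 := by
        intro a b hab
        have hfab := hf hab
        rw [Fin.lt_def] at hab hfab ⊢
        by_cases ha : a = j0
        · have hb : b ≠ j0 := by rintro rfl; rw [ha] at hab; omega
          rw [e2 b hb, ha, e1]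
          rw [ha] at hab
          have := hhi b hab
          omega
        · by_cases hb : b = j0
          · rw [e2 a ha, hb, e1]
            rw [hb] at hfab
            omega
          · rw [e2 a ha, e2 b hb]; exact hfab
      obtain ⟨g, hg, hfg, h1, h2⟩ := claim f1 hf1 (by omega)
      refine ⟨g, hg, Relation.ReflTransGen.head
        ⟨hf, hf1, j0, ⟨f j0 + 1, by omega⟩, e2, Or.inl ⟨?_, ?_⟩⟩ hfg, h1, ?_⟩
      · rw [Fin.lt_def]; simp
      · rw [Fin.lt_def, e1]; simp only []; omega
      · intro j hj
        have : j ≠ j0 := by rintro rfl; simp only [j0] at hj; omega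
        rw [h2 j hj, e2 j this]

theorem reach_symm {f g : Fin k → Fin n} (h : Relation.ReflTransGen Hop f g) :
    Relation.ReflTransGen Hop g f := by
  induction h with
  | refl => exact .refl
  | tail _ hbc ih => exact Relation.ReflTransGen.head hbc.symm ih

theorem reach_all (hkn : 2 * k + 2 ≤ n) (f g : Fin k → Fin n) (hf : StrictMono f)
    (hg : StrictMono g) : Relation.ReflTransGen Hop f g := by
  obtain ⟨f', -, h1, h2, -⟩ := pack k n f le_rfl le_rfl hkn hf (fun j _ => (f j).2)
    (fun j hj => absurd j.2 (by omega))
  obtain ⟨g', -, k1, k2, -⟩ := pack k n g le_rfl le_rfl hkn hg (fun j _ => (g j).2)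
    (fun j hj => absurd j.2 (by omega))
  have : f' = g' := by
    funext j; apply Fin.ext; rw [h2 j j.2, k2 j j.2]
  subst this
  exact h1.trans (reach_symm k1)

theorem exists_pat (α : Dgm n) (hα : α ∈ Mset n) :
    ∃ P Q : Pat n (prank α), α = DD P Q := by
  obtain ⟨hPB, hPl⟩ := hα
  have hs : ∀ {x y}, α.r x y → α.r y x := @α.iseqv.symm
  have ht : ∀ {x y z}, α.r x y → α.r y z → α.r x z := @α.iseqv.trans
  have hcard : (domFinset α).card = prank α := by
    rw [prank, ← Set.ncard_coe_finset]
    congr 1; ext i; simp [domFinset]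
  let f : Fin (prank α) → Fin n := (domFinset α).orderEmbOfFin hcard
  have hf : StrictMono f := ((domFinset α).orderEmbOfFin hcard).strictMono
  have hfd : ∀ i, f i ∈ domSet α := by
    intro i
    have := (domFinset α).orderEmbOfFin_mem hcard i
    have hm : f i ∈ domFinset α := this
    unfold domFinset at hm
    exact (Finset.mem_filter.1 hm).2
  have hfs : ∀ a, a ∈ domSet α → ∃ i, f i = a := by
    intro a ha
    have : a ∈ Set.range f := by
      rw [Finset.range_orderEmbOfFin]; simpa [domFinset] using ha
    exact this
  choose g hg using hfd
  have hgm : StrictMono g := by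
    intro i j hij
    have h1 := hf hij
    by_contra hlt
    rcases eq_or_lt_of_le (not_lt.1 hlt) with e | e
    · have hh : α.r (Sum.inl (f i)) (Sum.inl (f j)) := ht (hg i) (by rw [← e]; exact hs (hg j))
      rcases hPB _ _ _ hh (hg i) with e' | e' | e'
      · exact h1.ne (Sum.inl.inj e')
      · simp at e'
      · simp at e'
    · rw [Fin.lt_def] at h1 e
      refine hPl _ _ _ _ (hg i) (hg j) ?_ ?_ ?_ <;> have := (g i).2 <;> have := (f j).2 <;>
        simp only [vpos] <;> omega
  let P : Pat n (prank α) :=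
    { f := f
      H := fun x y => x ≠ y ∧ α.r (Sum.inl x) (Sum.inl y)
      mono := hf
      symm := fun x y h => ⟨h.1.symm, hs h.2⟩
      func := by
        rintro x y z ⟨h1, h2⟩ ⟨h3, h4⟩
        rcases hPB _ _ _ h2 h4 with e | e | e
        · exact absurd (Sum.inl.inj e) h1
        · exact absurd (Sum.inl.inj e) h3
        · exact Sum.inl.inj e
      disj := by
        rintro i y ⟨h1, h2⟩
        rcases hPB _ _ _ h2 (hg i) with e | e | e
        · exact absurd (Sum.inl.inj e) h1
        · simp at e
        · simp at e
      nest := by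
        rintro x y i ⟨h1, h2⟩ l1 l2
        rw [Fin.lt_def] at l1 l2
        refine hPl _ _ _ _ h2 (hg i) ?_ ?_ ?_ <;> have := (g i).2 <;> have := y.2 <;>
          simp only [vpos] <;> omega
      cross := by
        rintro x y z w ⟨_, h⟩ ⟨_, h'⟩ l1 l2 l3
        exact hPl _ _ _ _ h h' l1 l2 l3 }
  let Q : Pat n (prank α) :=
    { f := g
      H := fun x y => x ≠ y ∧ α.r (Sum.inr x) (Sum.inr y)
      mono := hgm
      symm := fun x y h => ⟨h.1.symm, hs h.2⟩
      func := by
        rintro x y z ⟨h1, h2⟩ ⟨h3, h4⟩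
        rcases hPB _ _ _ h2 h4 with e | e | e
        · exact absurd (Sum.inr.inj e) h1
        · exact absurd (Sum.inr.inj e) h3
        · exact Sum.inr.inj e
      disj := by
        rintro i y ⟨h1, h2⟩
        rcases hPB _ _ _ h2 (hs (hg i)) with e | e | e
        · exact absurd (Sum.inr.inj e) h1
        · simp at e
        · simp at e
      nest := by
        rintro x y i ⟨h1, h2⟩ l1 l2
        rw [Fin.lt_def] at l1 l2
        refine hPl _ _ _ _ (hg i) (hs h2) ?_ ?_ ?_ <;> have := (f i).2 <;> have := y.2 <;>
          simp only [vpos] <;> omega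
      cross := by
        rintro x y z w ⟨_, h⟩ ⟨_, h'⟩ l1 l2 l3
        rw [Fin.lt_def] at l1 l2 l3
        refine hPl _ _ _ _ (hs h') (hs h) ?_ ?_ ?_ <;> have := w.2 <;>
          simp only [vpos] <;> omega }
  refine ⟨P, Q, ?_⟩
  have hlr : ∀ x y, α.r (Sum.inl x) (Sum.inr y) ↔ ∃ i, f i = x ∧ g i = y := by
    intro x y
    constructor
    · intro h
      obtain ⟨i, rfl⟩ := hfs x ⟨y, h⟩
      refine ⟨i, rfl, ?_⟩
      rcases hPB _ _ _ h (hg i) with e | e | e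
      · simp at e
      · simp at e
      · exact (Sum.inr.inj e).symm
    · rintro ⟨i, rfl, rfl⟩; exact hg i
  apply Setoid.ext
  intro x y
  change α.r x y ↔ (DD P Q).r x y
  rcases x with x | x <;> rcases y with y | y
  · rw [DD_ll]
    constructor
    · intro h
      by_cases e : x = y
      · exact Or.inl e
      · exact Or.inr ⟨e, h⟩
    · rintro (rfl | h)
      · exact α.iseqv.refl _
      · exact h.2
  · rw [DD_lr]; exact hlr x y
  · rw [DD_rl]; exact Iff.trans ⟨hs, hs⟩ (hlr y x)
  · rw [DD_rr]
    constructor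
    · intro h
      by_cases e : x = y
      · exact Or.inl e
      · exact Or.inr ⟨e, h⟩
    · rintro (rfl | h)
      · exact α.iseqv.refl _
      · exact h.2

theorem idptGen_of_lt (n r : ℕ) (hr : r < n / 2) : IdptGen (pmul (n := n)) (IM n r) := by
  apply Set.Subset.antisymm
  · intro x hx
    have hx' : MClo (pmul (n := n)) {x ∈ IM n r | pmul x x = x} x := hx
    induction hx' with
    | base h => exact h.1
    | @mul y z hy hz ih1 ih2 =>
      exact ⟨Mset_pmul _ _ (ih1 hy).1 (ih2 hz).1, (prank_pmul_le _ _).trans (ih1 hy).2⟩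
  · rintro α ⟨hM, hrk⟩
    change α ∈ GG n r
    obtain ⟨P, Q, hPQ⟩ := exists_pat α hM
    have h1 := DD_mul P (pureP P.f P.mono) (pureP P.f P.mono) (pureP Q.f Q.mono)
      (Compat_of_eq _ _ rfl)
    have h2 := DD_mul P (pureP Q.f Q.mono) (pureP Q.f Q.mono) Q (Compat_of_eq _ _ rfl)
    rw [hPQ, ← h2, ← h1]
    refine MClo.mul (MClo.mul (DD_mem_GG hrk _ _ (Compat_of_eq _ _ rfl)) ?_)
      (DD_mem_GG hrk _ _ (Compat_of_eq _ _ rfl))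
    exact reach_mem hrk _ _ P.mono (reach_all (by omega) _ _ P.mono Q.mono) Q.mono

end Dgm

/-- For `n ≥ 2` and `0 ≤ r ≤ n`, the ideal `I_r(M_n)` is
idempotent-generated iff `r < ⌊n/2⌋`. -/
theorem IM_idempotent_generated_iff (n r : ℕ) (hn : 2 ≤ n) (hr : r ≤ n) :
    IdptGen (pmul (n := n)) (IM n r) ↔ r < n / 2 := by
  constructor
  · intro h
    by_contra hlt
    exact not_idptGen n r hn (not_lt.1 hlt) h
  · exact idptGen_of_lt n r
end
end

section
/- rank(I_0(M_n)) equals the number of projections in D_0(M_n). For 1 ≤ r ≤ n−1, rank(I_r(M_n)) = p(n,r) + p'(n,r−1), where p(n,r) is the number of projections in D_r(M_n) and p'(n,r−1) is the number of projections in D_{r−1}(M_n) having no unnested singleton block. Moreover, if n ≤ 1 or r < ⌊n/2⌋, then I_r(M_n) is idempotent-generated and idrank(I_r(M_n)) = rank(I_r(M_n)). -/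
/-!
Partial Brauer diagrams on `n` points are formalized as set partitions
(equivalence relations, i.e. `Setoid`s) of the vertex set
`{1,…,n} ∪ {1',…,n'}`, encoded as `Fin n ⊕ Fin n`
(`Sum.inl i` is the upper vertex `i`, `Sum.inr i` is the lower vertex `i'`),
all of whose blocks have size at most 2.  The product of two diagrams is
defined via connectivity (paths) in the product graph, and the involution `*`
by interchanging the two rows of vertices.
-/

noncomputable section

open scoped Classical

open Dgm
namespace Mtz

open Dgm

/-! ### generic gluing step -/

/-- one gluing step -/
def glue {W : Type*} (E : W → W → Prop) (p q : W) (x y : W) : Prop :=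
  E x y ∨ (E x p ∧ E q y) ∨ (E x q ∧ E p y)

theorem glue_equiv {W : Type*} {E : W → W → Prop} (hE : Equivalence E) (p q : W) :
    Equivalence (glue E p q) := by
  have hs := fun {x y} => @Equivalence.symm _ _ hE x y
  have ht := fun {x y z} => @Equivalence.trans _ _ hE x y z
  have hr := hE.refl
  refine ⟨fun x => Or.inl (hr x), ?_, ?_⟩
  · intro x y h
    unfold glue at *
    rcases h with h | ⟨h1, h2⟩ | ⟨h1, h2⟩
    · exact Or.inl (hs h)
    · exact Or.inr (Or.inr ⟨hs h2, hs h1⟩)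
    · exact Or.inr (Or.inl ⟨hs h2, hs h1⟩)
  · intro x y z h h'
    unfold glue at *
    rcases h with h | ⟨h1, h2⟩ | ⟨h1, h2⟩ <;> rcases h' with h' | ⟨h3, h4⟩ | ⟨h3, h4⟩
    · exact Or.inl (ht h h')
    · exact Or.inr (Or.inl ⟨ht h h3, h4⟩)
    · exact Or.inr (Or.inr ⟨ht h h3, h4⟩)
    · exact Or.inr (Or.inl ⟨h1, ht h2 h'⟩)
    · exact Or.inr (Or.inl ⟨h1, h4⟩)
    · exact Or.inl (ht h1 h4)
    · exact Or.inr (Or.inr ⟨h1, ht h2 h'⟩)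
    · exact Or.inl (ht h1 h4)
    · exact Or.inr (Or.inr ⟨h1, h4⟩)

/-- blocks of size at most two, among live vertices -/
def PBon {W : Type*} (E : W → W → Prop) (L : W → Prop) : Prop :=
  ∀ x y z, L x → L y → L z → E x y → E x z → x = y ∨ x = z ∨ y = z

/-- noncrossing, among live vertices -/
def NCon {W : Type*} (pos : W → ℕ) (E : W → W → Prop) (L : W → Prop) : Prop :=
  ∀ a b c d, L a → L b → L c → L d → E a b → E c d →
    pos a < pos c → pos c < pos b → pos b < pos d → False

theorem glue_PB {W : Type*} {E : W → W → Prop} (hE : Equivalence E) {L L' : W → Prop} {p q : W}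
    (hpq : p ≠ q) (hp : L p) (hq : L q) (hL : ∀ x, L' x → L x ∧ x ≠ p ∧ x ≠ q)
    (h : PBon E L) : PBon (glue E p q) L' := by
  have hs := fun {x y} => @Equivalence.symm _ _ hE x y
  have ht := fun {x y z} => @Equivalence.trans _ _ hE x y z
  intro x y z hx hy hz h1 h2
  obtain ⟨hx, hxp, hxq⟩ := hL x hx
  obtain ⟨hy, hyp, hyq⟩ := hL y hy
  obtain ⟨hz, hzp, hzq⟩ := hL z hz
  rcases h1 with h1 | ⟨h1, h1'⟩ | ⟨h1, h1'⟩ <;> rcases h2 with h2 | ⟨h2, h2'⟩ | ⟨h2, h2'⟩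
  · exact h x y z hx hy hz h1 h2
  · have := h x y p hx hy hp h1 h2; grind
  · have := h x y q hx hy hq h1 h2; grind
  · have := h x z p hx hz hp h2 h1; grind
  · have := h q y z hq hy hz h1' h2'; grind
  · have := h x p q hx hp hq h1 h2; grind
  · have := h x z q hx hz hq h2 h1; grind
  · have := h x p q hx hp hq h2 h1; grind
  · have := h p y z hp hy hz h1' h2'; grind

theorem glue_NC {W : Type*} {pos : W → ℕ} {E : W → W → Prop} (hinj : Function.Injective pos)
    (hE : Equivalence E) {L L' : W → Prop} {p q : W}
    (hpq : pos p < pos q) (hp : L p) (hq : L q) (hL : ∀ x, L' x → L x ∧ x ≠ p ∧ x ≠ q)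
    (hadj : ∀ x, L' x → pos x < pos p ∨ pos q < pos x)
    (h : PBon E L) (hN : NCon pos E L) : NCon pos (glue E p q) L' := by
  have hs := fun {x y} => @Equivalence.symm _ _ hE x y
  have ht := fun {x y z} => @Equivalence.trans _ _ hE x y z
  intro a b c d ha hb hc hd h1 h2 l1 l2 l3
  have aa := hadj a ha
  have ab := hadj b hb
  have ac := hadj c hc
  have ad := hadj d hd
  obtain ⟨ha, hap, haq⟩ := hL a ha
  obtain ⟨hb, hbp, hbq⟩ := hL b hb
  obtain ⟨hc, hcp, hcq⟩ := hL c hc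
  obtain ⟨hd, hdp, hdq⟩ := hL d hd
  have e1 : a ≠ c := by rintro rfl; omega
  have e2 : a ≠ d := by rintro rfl; omega
  have e3 : b ≠ c := by rintro rfl; omega
  have e4 : b ≠ d := by rintro rfl; omega
  rcases h1 with h1 | ⟨h1, h1'⟩ | ⟨h1, h1'⟩ <;> rcases h2 with h2 | ⟨h2, h2'⟩ | ⟨h2, h2'⟩
  · exact hN a b c d ha hb hc hd h1 h2 l1 l2 l3
  · have k1 := hN a b c p ha hb hc hp h1 h2 l1 l2
    have k2 := hN p c a b hp hc ha hb (hs h2) h1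
    have k3 := hN a b q d ha hb hq hd h1 h2'
    have k4 := hN a b c p ha hb hc hp h1 h2
    grind
  · have k1 := hN a b c q ha hb hc hq h1 h2 l1 l2
    have k2 := hN q c a b hq hc ha hb (hs h2) h1
    have k3 := hN a b p d ha hb hp hd h1 h2'
    grind
  · have k1 := hN a p c d ha hp hc hd h1 h2
    have k2 := hN c d q b hc hd hq hb h2 h1'
    have k3 := hN p a c d hp ha hc hd (hs h1) h2
    have k5 := hN q b c d hq hb hc hd h1' h2
    have k4 := hN c d b q hc hd hb hq h2 (hs h1')
    grind
  · have := h p a c hp ha hc (hs h1) (hs h2); grind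
  · have := h p a d hp ha hd (hs h1) h2'; grind
  · have k1 := hN a q c d ha hq hc hd h1 h2
    have k2 := hN c d p b hc hd hp hb h2 h1'
    have k4 := hN c d b p hc hd hb hp h2 (hs h1')
    have k3 := hN q a c d hq ha hc hd (hs h1) h2
    have k5 := hN p b c d hp hb hc hd h1' h2
    grind
  · have := h q a d hq ha hd (hs h1) h2'; grind
  · have := h q a c hq ha hc (hs h1) (hs h2); grind

/-! ### products -/

variable {n : ℕ}

/-- vertices of the disjoint union of two diagrams -/
abbrev W (n : ℕ) := PBV n ⊕ PBV n

def posW : W n → ℕ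
  | Sum.inl v => vpos v
  | Sum.inr v => 2 * n + vpos v

def EE (α β : Dgm n) : ℕ → W n → W n → Prop
  | 0 => fun x y => match x, y with
    | Sum.inl a, Sum.inl b => α.r a b
    | Sum.inr a, Sum.inr b => β.r a b
    | _, _ => False
  | k + 1 => if h : k < n then
      glue (EE α β k) (Sum.inl (Sum.inr ⟨k, h⟩)) (Sum.inr (Sum.inl ⟨k, h⟩)) else EE α β k

def Live (k : ℕ) (x : W n) : Prop := posW x < 2 * n - k ∨ 2 * n + k ≤ posW x

theorem vpos_lt (x : PBV n) : vpos x < 2 * n := by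
  rcases x with i | i <;> have := i.2 <;> simp only [vpos] <;> omega

theorem vpos_inj : Function.Injective (vpos (n := n)) := by
  rintro (i | i) (j | j) h <;> have := i.2 <;> have := j.2 <;> simp only [vpos] at h
  · congr 1; exact Fin.ext h
  · omega
  · omega
  · congr 1; apply Fin.ext; omega

theorem posW_inj : Function.Injective (posW (n := n)) := by
  rintro (i | i) (j | j) h <;> have hi := vpos_lt i <;> have hj := vpos_lt j <;>
    simp only [posW] at h
  · rw [vpos_inj h]
  · omega
  · omega
  · rw [vpos_inj (by omega : vpos i = vpos j)]

theorem EE_equiv (α β : Dgm n) (k : ℕ) : Equivalence (EE α β k) := by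
  induction k with
  | zero =>
    refine ⟨?_, ?_, ?_⟩
    · rintro (x | x)
      · exact α.iseqv.refl x
      · exact β.iseqv.refl x
    · rintro (x | x) (y | y) h
      · exact α.iseqv.symm h
      · exact h
      · exact h
      · exact β.iseqv.symm h
    · rintro (x | x) (y | y) (z | z) h h'
      all_goals first | exact α.iseqv.trans h h' | exact β.iseqv.trans h h' | exact h.elim | exact h'.elim
  | succ k ih =>
    unfold EE
    split
    · exact glue_equiv ih _ _
    · exact ih

theorem EE_mono (α β : Dgm n) {k l : ℕ} (hkl : k ≤ l) {x y : W n} (h : EE α β k x y) :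
    EE α β l x y := by
  induction l, hkl using Nat.le_induction with
  | base => exact h
  | succ l hl ih =>
    unfold EE
    split
    · exact Or.inl ih
    · exact ih

theorem EE_good {α β : Dgm n} (hα : α ∈ Mset n) (hβ : β ∈ Mset n) (k : ℕ) (hk : k ≤ n) :
    PBon (EE α β k) (Live k) ∧ NCon posW (EE α β k) (Live k) := by
  induction k with
  | zero =>
    constructor
    · rintro (x | x) (y | y) (z | z) _ _ _ h h'
      all_goals first | exact h.elim | exact h'.elim | skip
      · have := hα.1 x y z h h'; simpa using this
      · have := hβ.1 x y z h h'; simpa using this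
    · rintro (a | a) (b | b) (c | c) (d | d) _ _ _ _ h h' l1 l2 l3
      all_goals first | exact h.elim | exact h'.elim | skip
      · exact hα.2 a b c d h h' l1 l2 l3
      · have := vpos_lt b; simp only [posW] at *; omega
      · have := vpos_lt d; simp only [posW] at *; omega
      · simp only [posW] at l1 l2 l3
        exact hβ.2 a b c d h h' (by omega) (by omega) (by omega)
  | succ k ih =>
    obtain ⟨ih1, ih2⟩ := ih (by omega)
    have hk' : k < n := hk
    have e : EE α β (k+1) = glue (EE α β k) (Sum.inl (Sum.inr ⟨k, hk'⟩)) (Sum.inr (Sum.inl ⟨k, hk'⟩)) := by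
      conv_lhs => unfold EE
      simp [hk']
    have pp : posW (Sum.inl (Sum.inr ⟨k, hk'⟩) : W n) = 2 * n - 1 - k := rfl
    have pq : posW (Sum.inr (Sum.inl ⟨k, hk'⟩) : W n) = 2 * n + k := rfl
    have hL : ∀ x : W n, Live (k+1) x → Live k x ∧ x ≠ (Sum.inl (Sum.inr ⟨k, hk'⟩)) ∧ x ≠ (Sum.inr (Sum.inl ⟨k, hk'⟩)) := by
      intro x hx
      unfold Live at *
      refine ⟨by omega, ?_, ?_⟩
      · rintro rfl; omega
      · rintro rfl; omega
    have lp : Live k (Sum.inl (Sum.inr ⟨k, hk'⟩) : W n) := by unfold Live; omega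
    have lq : Live k (Sum.inr (Sum.inl ⟨k, hk'⟩) : W n) := by unfold Live; omega
    rw [e]
    exact ⟨glue_PB (EE_equiv α β k) (by simp) lp lq hL ih1,
      glue_NC posW_inj (EE_equiv α β k) (by omega) lp lq hL
        (by intro x hx; unfold Live at hx; omega) ih1 ih2⟩

def emb3 : V3 n → W n
  | Sum.inl i => Sum.inl (Sum.inl i)
  | Sum.inr (Sum.inl i) => Sum.inl (Sum.inr i)
  | Sum.inr (Sum.inr i) => Sum.inr (Sum.inr i)

theorem RGen_sub {V : Type*} {r E : V → V → Prop} (hE : Equivalence E) (h : ∀ x y, r x y → E x y)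
    {x y : V} (hxy : RGen r x y) : E x y := by
  induction hxy with
  | rel h' => exact h _ _ h'
  | refl x => exact hE.refl x
  | symm _ ih => exact hE.symm ih
  | trans _ _ ih1 ih2 => exact hE.trans ih1 ih2

theorem EE_glue (α β : Dgm n) (i : Fin n) :
    EE α β n (Sum.inl (Sum.inr i)) (Sum.inr (Sum.inl i)) := by
  apply EE_mono α β (show (i : ℕ) + 1 ≤ n from i.2)
  unfold EE
  rw [dif_pos i.2]
  exact Or.inr (Or.inl ⟨(EE_equiv α β _).refl _, (EE_equiv α β _).refl _⟩)

theorem pmul_EE {α β : Dgm n} {x y : PBV n} (h : (pmul α β).r x y) :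
    EE α β n (emb3 (topBot x)) (emb3 (topBot y)) := by
  have hE := EE_equiv α β n
  refine RGen_sub (E := fun u v => EE α β n (emb3 u) (emb3 v))
    ⟨fun x => hE.refl _, fun h => hE.symm h, fun h h' => hE.trans h h'⟩ ?_ h
  rintro _ _ (⟨a, b, h, rfl, rfl⟩ | ⟨a, b, h, rfl, rfl⟩)
  · have h0 : EE α β n (Sum.inl a) (Sum.inl b) := EE_mono α β (Nat.zero_le n) h
    rcases a with a | a <;> rcases b with b | b <;> exact h0
  · have h0 : EE α β n (Sum.inr a) (Sum.inr b) := EE_mono α β (Nat.zero_le n) h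
    have key : ∀ a : PBV n, EE α β n (emb3 (midBot a)) (Sum.inr a) := by
      rintro (a | a)
      · exact EE_glue α β a
      · exact hE.refl _
    exact hE.trans (key a) (hE.trans h0 (hE.symm (key b)))

theorem pmul_mem {α β : Dgm n} (hα : α ∈ Mset n) (hβ : β ∈ Mset n) : pmul α β ∈ Mset n := by
  obtain ⟨h1, h2⟩ := EE_good hα hβ n le_rfl
  have hl : ∀ x : PBV n, Live n (emb3 (topBot x)) := by
    rintro (i | i) <;> have := i.2 <;> simp only [Live, emb3, topBot, posW, vpos] <;> omega
  have hp : ∀ x y : PBV n, vpos x < vpos y → posW (emb3 (topBot x)) < posW (emb3 (topBot y)) := by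
    rintro (i | i) (j | j) <;> have := i.2 <;> have := j.2 <;>
      simp only [emb3, topBot, posW, vpos] <;> omega
  constructor
  · intro x y z h h'
    have inj : ∀ x y : PBV n, emb3 (topBot x) = emb3 (topBot y) → x = y := by
      rintro (i | i) (j | j) h <;> simp_all [emb3, topBot]
    rcases h1 _ _ _ (hl x) (hl y) (hl z) (pmul_EE h) (pmul_EE h') with h | h | h
    · exact Or.inl (inj _ _ h)
    · exact Or.inr (Or.inl (inj _ _ h))
    · exact Or.inr (Or.inr (inj _ _ h))
  · intro a b c d h h' l1 l2 l3
    exact h2 _ _ _ _ (hl a) (hl b) (hl c) (hl d) (pmul_EE h) (pmul_EE h') (hp _ _ l1) (hp _ _ l2) (hp _ _ l3)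

end Mtz

namespace Mtz

open Dgm

variable {n : ℕ}

/-! ### half diagrams -/

def cnt (A : Finset (Fin n)) (i : Fin n) : ℕ := (A.filter (· < i)).card

theorem cnt_lt {A : Finset (Fin n)} {i j : Fin n} (hi : i ∈ A) (h : i < j) : cnt A i < cnt A j := by
  apply Finset.card_lt_card
  rw [Finset.ssubset_iff_of_subset]
  · exact ⟨i, by simp [hi, h], by simp⟩
  · intro x; simp only [Finset.mem_filter]; rintro ⟨a, b⟩; exact ⟨a, b.trans h⟩

theorem cnt_inj {A : Finset (Fin n)} {i j : Fin n} (hi : i ∈ A) (hj : j ∈ A)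
    (h : cnt A i = cnt A j) : i = j := by
  rcases lt_trichotomy i j with h' | h' | h'
  · have := cnt_lt hi h'; omega
  · exact h'
  · have := cnt_lt hj h'; omega

theorem cnt_lt_card {A : Finset (Fin n)} {i : Fin n} (hi : i ∈ A) : cnt A i < A.card := by
  apply Finset.card_lt_card
  rw [Finset.ssubset_iff_of_subset (Finset.filter_subset _ _)]
  exact ⟨i, hi, by simp⟩

theorem cnt_surj {A : Finset (Fin n)} {k : ℕ} (hk : k < A.card) : ∃ i ∈ A, cnt A i = k := by
  have h1 : A.image (cnt A) = Finset.range A.card := by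
    apply Finset.eq_of_subset_of_card_le
    · intro x hx
      obtain ⟨i, hi, rfl⟩ := Finset.mem_image.1 hx
      exact Finset.mem_range.2 (cnt_lt_card hi)
    · rw [Finset.card_image_of_injOn, Finset.card_range]
      intro i hi j hj h
      exact cnt_inj hi hj h
  have : k ∈ A.image (cnt A) := by rw [h1]; exact Finset.mem_range.2 hk
  obtain ⟨i, hi, h⟩ := Finset.mem_image.1 this
  exact ⟨i, hi, h⟩

@[ext] structure Half (n : ℕ) where
  R : Fin n → Fin n → Prop
  A : Finset (Fin n)

structure Half.Ok (h : Half n) : Prop where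
  eqv : Equivalence h.R
  pb : ∀ x y z, h.R x y → h.R x z → x = y ∨ x = z ∨ y = z
  trv : ∀ a y, a ∈ h.A → h.R a y → y = a
  nc : ∀ a b c d, h.R a b → h.R c d → a < c → c < b → b < d → False
  un : ∀ a u v, a ∈ h.A → h.R u v → u < a → a < v → False

def up (α : Dgm n) : Half n := ⟨fun i j => α.r (Sum.inl i) (Sum.inl j), domFinset α⟩

def low (α : Dgm n) : Half n := up (pstar α)

theorem mem_up {α : Dgm n} {i : Fin n} : i ∈ (up α).A ↔ ∃ j, α.r (Sum.inl i) (Sum.inr j) := by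
  simp only [up, domFinset, Finset.mem_filter, Finset.mem_univ, true_and]
  exact Iff.rfl

theorem mem_low {α : Dgm n} {j : Fin n} : j ∈ (low α).A ↔ ∃ i, α.r (Sum.inl i) (Sum.inr j) := by
  unfold low
  rw [mem_up]
  exact ⟨fun ⟨i, h⟩ => ⟨i, α.iseqv.symm h⟩, fun ⟨i, h⟩ => ⟨i, α.iseqv.symm h⟩⟩

theorem swap_swap (x : PBV n) : swapUD (swapUD x) = x := by rcases x with x | x <;> rfl

theorem star_star (α : Dgm n) : pstar (pstar α) = α := by
  apply Setoid.ext
  intro a b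
  show α.r _ _ ↔ α.r _ _
  rw [swap_swap, swap_swap]

theorem low_star (α : Dgm n) : low (pstar α) = up α := by unfold low; rw [star_star]

theorem up_star (α : Dgm n) : up (pstar α) = low α := rfl

theorem vpos_swap (x : PBV n) : vpos (swapUD x) = 2 * n - 1 - vpos x := by
  rcases x with i | i <;> have := i.2 <;> simp only [vpos, swapUD] <;> omega

theorem swap_inj {x y : PBV n} (h : swapUD x = swapUD y) : x = y := by
  rw [← swap_swap x, h, swap_swap]

theorem star_mem {α : Dgm n} (h : α ∈ Mset n) : pstar α ∈ Mset n := by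
  constructor
  · intro x y z h1 h2
    rcases h.1 _ _ _ h1 h2 with h | h | h
    · exact Or.inl (swap_inj h)
    · exact Or.inr (Or.inl (swap_inj h))
    · exact Or.inr (Or.inr (swap_inj h))
  · intro a b c d h1 h2 l1 l2 l3
    have := vpos_lt a
    have := vpos_lt b
    have := vpos_lt c
    have := vpos_lt d
    apply h.2 (swapUD d) (swapUD c) (swapUD b) (swapUD a) (α.iseqv.symm h2) (α.iseqv.symm h1) <;>
      rw [vpos_swap, vpos_swap] <;> omega

def swap3 : V3 n → V3 n
  | Sum.inl i => Sum.inr (Sum.inr i)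
  | Sum.inr (Sum.inl i) => Sum.inr (Sum.inl i)
  | Sum.inr (Sum.inr i) => Sum.inl i

theorem RGen_map {V V' : Type*} {r : V → V → Prop} {r' : V' → V' → Prop} (f : V → V')
    (h : ∀ x y, r x y → r' (f x) (f y)) {x y : V} (hxy : RGen r x y) : RGen r' (f x) (f y) :=
  RGen_sub (E := fun x y => RGen r' (f x) (f y))
    ⟨fun _ => RGen.refl _, fun h => h.symm, fun h h' => h.trans h'⟩ (fun _ _ h' => RGen.rel (h _ _ h')) hxy

theorem star_mul_le {α β : Dgm n} {x y : PBV n} (h : (pmul α β).r x y) :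
    (pmul (pstar β) (pstar α)).r (swapUD x) (swapUD y) := by
  have h1 := RGen_map (r' := prodEdges (pstar β) (pstar α)) swap3 ?_ h
  · have e : ∀ x : PBV n, swap3 (topBot x) = topBot (swapUD x) := by rintro (x | x) <;> rfl
    rw [e, e] at h1
    exact h1
  · have e1 : ∀ x : PBV n, swap3 (topMid x) = midBot (swapUD x) := by rintro (x | x) <;> rfl
    have e2 : ∀ x : PBV n, swap3 (midBot x) = topMid (swapUD x) := by rintro (x | x) <;> rfl
    rintro _ _ (⟨a, b, h, rfl, rfl⟩ | ⟨a, b, h, rfl, rfl⟩)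
    · refine Or.inr ⟨swapUD a, swapUD b, ?_, e1 a, e1 b⟩
      show α.r _ _
      rwa [swap_swap, swap_swap]
    · refine Or.inl ⟨swapUD a, swapUD b, ?_, e2 a, e2 b⟩
      show β.r _ _
      rwa [swap_swap, swap_swap]

theorem star_mul (α β : Dgm n) : pstar (pmul α β) = pmul (pstar β) (pstar α) := by
  apply Setoid.ext
  intro a b
  constructor
  · intro h
    have := star_mul_le (α := α) (β := β) h
    rwa [swap_swap, swap_swap] at this
  · intro h
    have := star_mul_le h
    rwa [star_star, star_star] at this

theorem prank_eq (α : Dgm n) : prank α = (up α).A.card := by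
  unfold prank
  rw [← Set.ncard_coe_finset]
  congr 1
  ext i
  simp [up, domFinset]

theorem pb_tr {α : Dgm n} (h : α ∈ Mset n) {i i' j : Fin n} (h1 : α.r (Sum.inl i) (Sum.inr j))
    (h2 : α.r (Sum.inl i') (Sum.inr j)) : i = i' := by
  have := h.1 _ _ _ (α.iseqv.symm h1) (α.iseqv.symm h2)
  simpa using this

theorem pb_tr' {α : Dgm n} (h : α ∈ Mset n) {i j j' : Fin n} (h1 : α.r (Sum.inl i) (Sum.inr j))
    (h2 : α.r (Sum.inl i) (Sum.inr j')) : j = j' := by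
  have := h.1 _ _ _ h1 h2
  simpa using this

theorem pb_mix {α : Dgm n} (h : α ∈ Mset n) {i i' j : Fin n} (h1 : α.r (Sum.inl i) (Sum.inr j))
    (h2 : α.r (Sum.inl i) (Sum.inl i')) : i' = i := by
  have := h.1 _ _ _ h1 h2
  simpa [eq_comm] using this

theorem tr_mono {α : Dgm n} (h : α ∈ Mset n) {i i' j j' : Fin n} (h1 : α.r (Sum.inl i) (Sum.inr j))
    (h2 : α.r (Sum.inl i') (Sum.inr j')) (hl : i < i') : j < j' := by
  rcases lt_trichotomy j j' with h' | rfl | h'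
  · exact h'
  · exact absurd (pb_tr h h1 h2) hl.ne
  · exfalso
    have := i.2; have := i'.2; have := j.2; have := j'.2
    apply h.2 _ _ _ _ h1 h2 <;> simp only [vpos] <;> omega

theorem tr_mono' {α : Dgm n} (h : α ∈ Mset n) {i i' j j' : Fin n} (h1 : α.r (Sum.inl i) (Sum.inr j))
    (h2 : α.r (Sum.inl i') (Sum.inr j')) (hl : j < j') : i < i' := by
  rcases lt_trichotomy i i' with h' | rfl | h'
  · exact h'
  · exact absurd (pb_tr' h h1 h2) hl.ne
  · exact absurd (tr_mono h h2 h1 h') hl.asymm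

theorem card_le_aux {α : Dgm n} (h : α ∈ Mset n) : (up α).A.card ≤ (low α).A.card := by
  have : ∀ i : Fin n, ∃ j, i ∈ (up α).A → α.r (Sum.inl i) (Sum.inr j) := by
    intro i
    by_cases hi : i ∈ (up α).A
    · obtain ⟨j, hj⟩ := mem_up.1 hi; exact ⟨j, fun _ => hj⟩
    · exact ⟨i, fun h => absurd h hi⟩
  choose f hf using this
  apply Finset.card_le_card_of_injOn f
  · intro i hi; exact mem_low.2 ⟨i, hf i hi⟩
  · intro i hi j hj e
    have h1 := hf i hi
    rw [e] at h1
    exact pb_tr h h1 (hf j hj)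

theorem card_low {α : Dgm n} (h : α ∈ Mset n) : (low α).A.card = (up α).A.card := by
  apply le_antisymm _ (card_le_aux h)
  have := card_le_aux (star_mem h)
  rwa [low_star] at this

theorem prank_low {α : Dgm n} (h : α ∈ Mset n) : prank α = (low α).A.card := by
  rw [card_low h, prank_eq]

theorem tr_cnt {α : Dgm n} (h : α ∈ Mset n) {i j : Fin n} (h1 : α.r (Sum.inl i) (Sum.inr j)) :
    cnt (up α).A i = cnt (low α).A j := by
  unfold cnt
  have : ∀ i : Fin n, ∃ j, i ∈ (up α).A → α.r (Sum.inl i) (Sum.inr j) := by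
    intro i
    by_cases hi : i ∈ (up α).A
    · obtain ⟨j, hj⟩ := mem_up.1 hi; exact ⟨j, fun _ => hj⟩
    · exact ⟨i, fun h => absurd h hi⟩
  choose f hf using this
  apply Finset.card_bij (fun i _ => f i)
  · intro a ha
    simp only [Finset.mem_filter] at ha ⊢
    exact ⟨mem_low.2 ⟨a, hf a ha.1⟩, tr_mono h (hf a ha.1) h1 ha.2⟩
  · intro a ha b hb e
    simp only [Finset.mem_filter] at ha hb
    have h2 := hf a ha.1
    rw [e] at h2
    exact pb_tr h h2 (hf b hb.1)
  · intro b hb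
    simp only [Finset.mem_filter] at hb
    obtain ⟨a, ha⟩ := mem_low.1 hb.1
    have ha' : a ∈ (up α).A := mem_up.2 ⟨b, ha⟩
    refine ⟨a, ?_, pb_tr' h (hf a ha') ha⟩
    simp only [Finset.mem_filter]
    exact ⟨ha', tr_mono' h ha h1 hb.2⟩

theorem tr_iff {α : Dgm n} (h : α ∈ Mset n) (i j : Fin n) : α.r (Sum.inl i) (Sum.inr j) ↔
    i ∈ (up α).A ∧ j ∈ (low α).A ∧ cnt (up α).A i = cnt (low α).A j := by
  constructor
  · intro h1
    exact ⟨mem_up.2 ⟨j, h1⟩, mem_low.2 ⟨i, h1⟩, tr_cnt h h1⟩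
  · rintro ⟨hi, hj, e⟩
    obtain ⟨j', hj'⟩ := mem_up.1 hi
    have := tr_cnt h hj'
    rwa [cnt_inj hj (mem_low.2 ⟨i, hj'⟩) (e.symm.trans this)]

theorem ext_M {α β : Dgm n} (hα : α ∈ Mset n) (hβ : β ∈ Mset n) (h1 : up α = up β)
    (h2 : low α = low β) : α = β := by
  apply Setoid.ext
  have ht : ∀ i j, α.r (Sum.inl i) (Sum.inr j) ↔ β.r (Sum.inl i) (Sum.inr j) := by
    intro i j; rw [tr_iff hα, tr_iff hβ, h1, h2]
  rintro (i | i) (j | j)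
  · exact Iff.of_eq (congrFun (congrFun (congrArg Half.R h1) i) j)
  · exact ht i j
  · exact ⟨fun h => β.iseqv.symm ((ht j i).1 (α.iseqv.symm h)),
      fun h => α.iseqv.symm ((ht j i).2 (β.iseqv.symm h))⟩
  · exact Iff.of_eq (congrFun (congrFun (congrArg Half.R h2) i) j)

theorem up_ok {α : Dgm n} (h : α ∈ Mset n) : (up α).Ok where
  eqv := ⟨fun x => α.iseqv.refl _, fun h => α.iseqv.symm h, fun h h' => α.iseqv.trans h h'⟩
  pb x y z h1 h2 := by simpa using h.1 _ _ _ h1 h2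
  trv a y ha hy := by
    obtain ⟨j, hj⟩ := mem_up.1 ha
    exact pb_mix h hj hy
  nc a b c d h1 h2 l1 l2 l3 := h.2 _ _ _ _ h1 h2 l1 l2 l3
  un a u v ha h1 l1 l2 := by
    obtain ⟨j, hj⟩ := mem_up.1 ha
    have := j.2; have := v.2
    exact h.2 _ _ _ _ h1 hj l1 l2 (by simp only [vpos]; omega)

theorem low_ok {α : Dgm n} (h : α ∈ Mset n) : (low α).Ok := up_ok (star_mem h)

/-! ### construction -/

def lab (h : Half n) (b : Bool) (i : Fin n) : ℕ ⊕ (Bool × Set (Fin n)) :=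
  if i ∈ h.A then Sum.inl (cnt h.A i) else Sum.inr (b, {j | h.R i j})

def mkD (h k : Half n) : Dgm n := Setoid.ker fun x : PBV n =>
  match x with
  | Sum.inl i => lab h true i
  | Sum.inr i => lab k false i

theorem lab_iff {h : Half n} (hh : h.Ok) (b : Bool) (i j : Fin n) :
    lab h b i = lab h b j ↔ h.R i j := by
  have hE := hh.eqv
  unfold lab
  by_cases hi : i ∈ h.A <;> by_cases hj : j ∈ h.A <;> simp only [hi, hj, if_true, if_false]
  · constructor
    · intro e; rw [cnt_inj hi hj (Sum.inl.inj e)]; exact hE.refl _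
    · intro e; rw [hh.trv i j hi e]
  · simp only [reduceCtorEq, false_iff]
    intro e; have := hh.trv i j hi e; subst this; contradiction
  · simp only [reduceCtorEq, false_iff]
    intro e; have := hh.trv j i hj (hE.symm e); subst this; contradiction
  · constructor
    · intro e
      have e := congrArg Prod.snd (Sum.inr.inj e)
      have : j ∈ {l | h.R j l} := hE.refl j
      change {l | h.R i l} = {l | h.R j l} at e
      rw [← e] at this
      exact this
    · intro e
      congr 2
      ext l
      exact ⟨fun h' => hE.trans (hE.symm e) h', fun h' => hE.trans e h'⟩

theorem mkD_tr {h k : Half n} (i j : Fin n) : (mkD h k).r (Sum.inl i) (Sum.inr j) ↔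
    i ∈ h.A ∧ j ∈ k.A ∧ cnt h.A i = cnt k.A j := by
  show lab h true i = lab k false j ↔ _
  unfold lab
  by_cases hi : i ∈ h.A <;> by_cases hj : j ∈ k.A <;> simp [hi, hj]

theorem mkD_ul {h k : Half n} (hh : h.Ok) (i j : Fin n) :
    (mkD h k).r (Sum.inl i) (Sum.inl j) ↔ h.R i j := lab_iff hh _ i j

theorem mkD_ll {h k : Half n} (hk : k.Ok) (i j : Fin n) :
    (mkD h k).r (Sum.inr i) (Sum.inr j) ↔ k.R i j := lab_iff hk _ i j

theorem mkD_up {h k : Half n} (hh : h.Ok) (hc : h.A.card = k.A.card) : up (mkD h k) = h := by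
  apply Half.ext
  · funext i j; exact propext (mkD_ul (k := k) hh i j)
  · ext i
    rw [mem_up]
    constructor
    · rintro ⟨j, hj⟩; exact ((mkD_tr i j).1 hj).1
    · intro hi
      obtain ⟨j, hj, e⟩ := cnt_surj (A := k.A) (hc ▸ cnt_lt_card hi)
      exact ⟨j, (mkD_tr i j).2 ⟨hi, hj, e.symm⟩⟩

theorem mkD_low {h k : Half n} (hk : k.Ok) (hc : h.A.card = k.A.card) : low (mkD h k) = k := by
  apply Half.ext
  · funext i j; exact propext (mkD_ll (h := h) hk i j)
  · ext j
    rw [mem_low]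
    constructor
    · rintro ⟨i, hj⟩; exact ((mkD_tr i j).1 hj).2.1
    · intro hj
      obtain ⟨i, hi, e⟩ := cnt_surj (A := h.A) (hc ▸ cnt_lt_card hj)
      exact ⟨i, (mkD_tr i j).2 ⟨hi, hj, e⟩⟩

theorem mkD_rl {h k : Half n} (i j : Fin n) : (mkD h k).r (Sum.inr j) (Sum.inl i) ↔
    i ∈ h.A ∧ j ∈ k.A ∧ cnt h.A i = cnt k.A j := by
  rw [← mkD_tr]; exact ⟨(mkD h k).iseqv.symm, (mkD h k).iseqv.symm⟩

theorem cnt_lt' {A : Finset (Fin n)} {i j : Fin n} (hj : j ∈ A) (h : cnt A i < cnt A j) : i < j := by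
  by_contra hl
  rcases (not_lt.1 hl).lt_or_eq with h' | h'
  · have := cnt_lt hj h'; omega
  · subst h'; omega

theorem mkD_mem {h k : Half n} (hh : h.Ok) (hk : k.Ok) : mkD h k ∈ Mset n := by
  have hE := hh.eqv
  have hE' := hk.eqv
  constructor
  · rintro (x | x) (y | y) (z | z) h1 h2 <;>
      simp only [mkD_tr, mkD_rl, mkD_ul hh, mkD_ll hk] at h1 h2 <;>
      simp only [Sum.inl.injEq, Sum.inr.injEq, reduceCtorEq, false_or, or_false]
    · exact hh.pb _ _ _ h1 h2
    · exact (hh.trv _ _ h2.1 h1).symm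
    · exact (hh.trv _ _ h1.1 h2).symm
    · exact cnt_inj h1.2.1 h2.2.1 (h1.2.2.symm.trans h2.2.2)
    · exact cnt_inj h1.1 h2.1 (h1.2.2.trans h2.2.2.symm)
    · exact (hk.trv _ _ h1.2.1 h2).symm
    · exact (hk.trv _ _ h2.2.1 h1).symm
    · exact hk.pb _ _ _ h1 h2
  · have key : ∀ a b : Fin n, vpos (Sum.inr a : PBV n) < vpos (Sum.inl b : PBV n) → False := by
      intro a b hl
      have := a.2; have := b.2
      simp only [vpos] at hl; omega
    have kr : ∀ a b : Fin n, vpos (Sum.inr a : PBV n) < vpos (Sum.inr b : PBV n) → b < a := by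
      intro a b hl
      have := a.2; have := b.2
      simp only [vpos] at hl; omega
    have kl : ∀ a b : Fin n, vpos (Sum.inl a : PBV n) < vpos (Sum.inl b : PBV n) → a < b :=
      fun a b hl => hl
    rintro (a | a) (b | b) (c | c) (d | d) h1 h2 l1 l2 l3 <;>
      simp only [mkD_tr, mkD_rl, mkD_ul hh, mkD_ll hk] at h1 h2 <;>
      first
      | exact key _ _ l1
      | exact key _ _ l2
      | exact key _ _ l3
      | skip
    · exact hh.nc _ _ _ _ h1 h2 (kl _ _ l1) (kl _ _ l2) (kl _ _ l3)
    · exact hh.un _ _ _ h2.1 h1 (kl _ _ l1) (kl _ _ l2)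
    · have l1 := cnt_lt h1.1 (kl _ _ l1)
      have l3 := cnt_lt h2.2.1 (kr _ _ l3)
      omega
    · exact hk.un _ _ _ h1.2.1 (hE'.symm h2) (kr _ _ l3) (kr _ _ l2)
    · exact hk.nc _ _ _ _ (hE'.symm h2) (hE'.symm h1) (kr _ _ l3) (kr _ _ l2) (kr _ _ l1)

theorem eq_mkD {α : Dgm n} (h : α ∈ Mset n) : α = mkD (up α) (low α) :=
  ext_M h (mkD_mem (up_ok h) (low_ok h)) (mkD_up (up_ok h) (card_low h).symm).symm
    (mkD_low (low_ok h) (card_low h).symm).symm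

theorem star_mkD {h k : Half n} (hh : h.Ok) (hk : k.Ok) (hc : h.A.card = k.A.card) :
    pstar (mkD h k) = mkD k h := by
  apply ext_M (star_mem (mkD_mem hh hk)) (mkD_mem hk hh)
  · rw [up_star, mkD_low hk hc, mkD_up hk hc.symm]
  · rw [low_star, mkD_up hh hc, mkD_low hh hc.symm]

end Mtz

namespace Mtz

open Dgm

variable {n : ℕ}

theorem eA {α β : Dgm n} {a b : PBV n} (h : α.r a b) :
    RGen (prodEdges α β) (topMid a) (topMid b) := RGen.rel (Or.inl ⟨a, b, h, rfl, rfl⟩)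

theorem eB {α β : Dgm n} {a b : PBV n} (h : β.r a b) :
    RGen (prodEdges α β) (midBot a) (midBot b) := RGen.rel (Or.inr ⟨a, b, h, rfl, rfl⟩)

theorem RGen_inv {V : Type*} {r : V → V → Prop} (S : V → Prop) (h : ∀ x y, r x y → (S x ↔ S y))
    {x y : V} (hxy : RGen r x y) : S x ↔ S y :=
  RGen_sub (E := fun x y => S x ↔ S y) ⟨fun _ => Iff.rfl, fun h => h.symm, fun h h' => h.trans h'⟩ h hxy

theorem top_closed {α β : Dgm n} {i : Fin n} (hi : i ∉ (up α).A) {y : PBV n}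
    (h : (pmul α β).r (Sum.inl i) y) : ∃ j, y = Sum.inl j ∧ α.r (Sum.inl i) (Sum.inl j) := by
  have hi' : ∀ j, ¬ α.r (Sum.inl i) (Sum.inr j) := fun j hj => hi (mem_up.2 ⟨j, hj⟩)
  have := RGen_inv (fun v : V3 n => ∃ j, v = Sum.inl j ∧ α.r (Sum.inl i) (Sum.inl j)) ?_ h
  · obtain ⟨j, hj, hj'⟩ := this.1 ⟨i, rfl, α.iseqv.refl _⟩
    refine ⟨j, ?_, hj'⟩
    rcases y with y | y
    · simpa [topBot] using hj
    · simp [topBot] at hj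
  · have key : ∀ a b, α.r a b → (∃ j, topMid a = Sum.inl j ∧ α.r (Sum.inl i) (Sum.inl j)) →
        (∃ j, topMid b = Sum.inl j ∧ α.r (Sum.inl i) (Sum.inl j)) := by
      rintro (a | a) (b | b) h1 ⟨j, e, hj⟩ <;> simp only [topMid, Sum.inl.injEq, reduceCtorEq] at e
      · subst e; exact ⟨b, rfl, α.iseqv.trans hj h1⟩
      · subst e; exact absurd (α.iseqv.trans hj h1) (hi' b)
    rintro _ _ (⟨a, b, h, rfl, rfl⟩ | ⟨a, b, h, rfl, rfl⟩)
    · exact ⟨key a b h, key b a (α.iseqv.symm h)⟩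
    · rcases a with a | a <;> rcases b with b | b <;> simp [midBot]

theorem up_mono {α β : Dgm n} {i j : Fin n} (h : (up α).R i j) : (up (pmul α β)).R i j :=
  eA (a := Sum.inl i) (b := Sum.inl j) h

theorem dom_sub (α β : Dgm n) : (up (pmul α β)).A ⊆ (up α).A := by
  intro i hi
  by_contra hn
  obtain ⟨j, hj⟩ := mem_up.1 hi
  obtain ⟨k, hk, -⟩ := top_closed hn hj
  simp at hk

theorem low_mul (α β : Dgm n) : low (pmul α β) = up (pmul (pstar β) (pstar α)) := by
  unfold low; rw [star_mul]

theorem cod_sub (α β : Dgm n) : (low (pmul α β)).A ⊆ (low β).A := by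
  rw [low_mul]; exact dom_sub _ _

theorem prank_mul_left (α β : Dgm n) : prank (pmul α β) ≤ prank α := by
  rw [prank_eq, prank_eq]; exact Finset.card_le_card (dom_sub α β)

theorem prank_mul_right {α β : Dgm n} (hα : α ∈ Mset n) (hβ : β ∈ Mset n) :
    prank (pmul α β) ≤ prank β := by
  rw [prank_low (pmul_mem hα hβ), prank_low hβ]; exact Finset.card_le_card (cod_sub α β)

theorem new_pair {α β : Dgm n} (hm : pmul α β ∈ Mset n) {i j : Fin n}
    (h : (up (pmul α β)).R i j) (hn : ¬ (up α).R i j) :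
    (i ∈ (up α).A ∧ i ∉ (up (pmul α β)).A) ∧ (j ∈ (up α).A ∧ j ∉ (up (pmul α β)).A) ∧ i ≠ j := by
  have hne : i ≠ j := by rintro rfl; exact hn (α.iseqv.refl _)
  have h' : (up (pmul α β)).R j i := (pmul α β).iseqv.symm h
  refine ⟨⟨?_, ?_⟩, ⟨?_, ?_⟩, hne⟩
  · by_contra hi
    obtain ⟨k, e, hk⟩ := top_closed hi h
    obtain rfl : j = k := by simpa using e
    exact hn hk
  · intro hi; exact hne ((up_ok hm).trv i j hi h).symm
  · by_contra hi
    obtain ⟨k, e, hk⟩ := top_closed hi h'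
    obtain rfl : i = k := by simpa using e
    exact hn (α.iseqv.symm hk)
  · intro hi; exact hne ((up_ok hm).trv j i hi h')

theorem up_eq_of_sub {α β : Dgm n} (hm : pmul α β ∈ Mset n) (h : (up α).A ⊆ (up (pmul α β)).A) :
    up (pmul α β) = up α := by
  apply Half.ext
  · funext i j
    apply propext
    refine ⟨fun h' => ?_, up_mono⟩
    by_contra hn
    exact (new_pair hm h' hn).1.2 (h (new_pair hm h' hn).1.1)
  · exact Finset.Subset.antisymm (dom_sub _ _) h

theorem up_eq_of_rank {α β : Dgm n} (hm : pmul α β ∈ Mset n) (h : prank α ≤ prank (pmul α β)) :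
    up (pmul α β) = up α := by
  apply up_eq_of_sub hm
  rw [prank_eq, prank_eq] at h
  rw [Finset.eq_of_subset_of_card_le (dom_sub α β) h]

theorem low_eq_of_rank {α β : Dgm n} (hα : α ∈ Mset n) (hβ : β ∈ Mset n)
    (h : prank β ≤ prank (pmul α β)) : low (pmul α β) = low β := by
  have hm := pmul_mem hα hβ
  have hm' := pmul_mem (star_mem hβ) (star_mem hα)
  rw [low_mul]
  apply up_eq_of_rank hm'
  rw [← star_mul, prank_low (star_mem hm), low_star, ← prank_eq, prank_low (star_mem hβ), low_star,
    ← prank_eq]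
  exact h

theorem up_drop {α β : Dgm n} (hm : pmul α β ∈ Mset n) {x : Fin n}
    (h : (up α).A.erase x ⊆ (up (pmul α β)).A) (hx : x ∉ (up (pmul α β)).A) :
    up (pmul α β) = ⟨(up α).R, (up α).A.erase x⟩ := by
  apply Half.ext
  · funext i j
    apply propext
    refine ⟨fun h' => ?_, up_mono⟩
    by_contra hn
    obtain ⟨⟨h1, h2⟩, ⟨h3, h4⟩, h5⟩ := new_pair hm h' hn
    have e1 : i = x := by by_contra hne; exact h2 (h (Finset.mem_erase.2 ⟨hne, h1⟩))
    have e2 : j = x := by by_contra hne; exact h4 (h (Finset.mem_erase.2 ⟨hne, h3⟩))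
    exact h5 (e1.trans e2.symm)
  · apply Finset.Subset.antisymm _ h
    intro i hi
    refine Finset.mem_erase.2 ⟨?_, dom_sub _ _ hi⟩
    rintro rfl; exact hx hi

/-- `T i - M w`, `w` a singleton of `β`: then `i` dies. -/
theorem dies {α β : Dgm n} (hα : α ∈ Mset n) {x w : Fin n} (hx : α.r (Sum.inl x) (Sum.inr w))
    (hw : ∀ y, β.r (Sum.inl w) y → y = Sum.inl w) : x ∉ (up (pmul α β)).A := by
  intro hm
  obtain ⟨j, hj⟩ := mem_up.1 hm
  have := RGen_inv (fun v : V3 n => v = Sum.inl x ∨ v = Sum.inr (Sum.inl w)) ?_ hj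
  · simp [topBot] at this
  · have key1 : ∀ a b, α.r a b → (topMid a = Sum.inl x ∨ topMid a = Sum.inr (Sum.inl w)) →
        (topMid b = Sum.inl x ∨ topMid b = Sum.inr (Sum.inl w)) := by
      have e : ∀ a : PBV n, (topMid a = Sum.inl x ∨ topMid a = Sum.inr (Sum.inl w)) ↔
          (a = Sum.inl x ∨ a = Sum.inr w) := by
        rintro (a | a) <;> simp [topMid]
      intro a b h1
      rw [e, e]
      rintro (rfl | rfl)
      · have := hα.1 _ _ _ hx h1
        simp only [reduceCtorEq, false_or] at this
        tauto
      · have := hα.1 _ _ _ (α.iseqv.symm hx) h1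
        simp only [reduceCtorEq, false_or] at this
        tauto
    have key2 : ∀ a b, β.r a b → (midBot a = Sum.inl x ∨ midBot a = Sum.inr (Sum.inl w)) →
        (midBot b = Sum.inl x ∨ midBot b = Sum.inr (Sum.inl w)) := by
      have e : ∀ a : PBV n, (midBot a = Sum.inl x ∨ midBot a = Sum.inr (Sum.inl w)) ↔
          (a = Sum.inl w) := by
        rintro (a | a) <;> simp [midBot]
      intro a b h1
      rw [e, e]
      rintro rfl
      exact hw _ h1
    rintro _ _ (⟨a, b, h, rfl, rfl⟩ | ⟨a, b, h, rfl, rfl⟩)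
    · exact ⟨key1 a b h, key1 b a (α.iseqv.symm h)⟩
    · exact ⟨key2 a b h, key2 b a (β.iseqv.symm h)⟩

theorem lives {α β : Dgm n} {x w : Fin n} (hx : α.r (Sum.inl x) (Sum.inr w))
    (hw : w ∈ (up β).A) : x ∈ (up (pmul α β)).A := by
  obtain ⟨j, hj⟩ := mem_up.1 hw
  exact mem_up.2 ⟨j, (eA (β := β) hx).trans (eB (α := α) hj)⟩

theorem mul_eq {h k k' l : Half n} (hh : h.Ok) (hk : k.Ok) (hk' : k'.Ok) (hl : l.Ok)
    (c1 : h.A.card = k.A.card) (c2 : k'.A.card = l.A.card) (c3 : h.A.card = l.A.card)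
    (H : h.A ⊆ (up (pmul (mkD h k) (mkD k' l))).A) : pmul (mkD h k) (mkD k' l) = mkD h l := by
  have m1 := mkD_mem hh hk
  have m2 := mkD_mem hk' hl
  have hm := pmul_mem m1 m2
  have e1 := mkD_up hh c1
  have h1 : up (pmul (mkD h k) (mkD k' l)) = h := by
    rw [up_eq_of_sub hm (by rwa [e1]), e1]
  apply ext_M hm (mkD_mem hh hl)
  · rw [h1, mkD_up hh c3]
  · rw [mkD_low hl c3, low_eq_of_rank m1 m2, mkD_low hl c2]
    rw [prank_eq, prank_eq, h1, mkD_up hk' c2, c2, c3]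

theorem mul_same {h k k' l : Half n} (hh : h.Ok) (hk : k.Ok) (hk' : k'.Ok) (hl : l.Ok)
    (c1 : h.A.card = k.A.card) (c2 : k'.A.card = l.A.card) (e : k.A = k'.A) :
    pmul (mkD h k) (mkD k' l) = mkD h l := by
  apply mul_eq hh hk hk' hl c1 c2 (by rw [c1, e, c2])
  intro i hi
  have e1 := mkD_up hh c1
  rw [← e1] at hi
  obtain ⟨j, hj⟩ := mem_up.1 hi
  apply lives hj
  rw [mkD_up hk' c2, ← e]
  exact ((mkD_tr i j).1 hj).2.1

theorem mkD_prank {h k : Half n} (hh : h.Ok) (c : h.A.card = k.A.card) :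
    prank (mkD h k) = h.A.card := by rw [prank_eq, mkD_up hh c]

/-- projections -/
theorem proj_iff {α : Dgm n} (hα : α ∈ Mset n) : IsProj α ↔ up α = low α := by
  constructor
  · intro h; unfold low; rw [h.2]
  · intro h
    have ok := up_ok hα
    have e := eq_mkD hα
    rw [← h] at e
    refine ⟨?_, ?_⟩
    · rw [e]; exact mul_same ok ok ok ok rfl rfl rfl
    · rw [e]; exact star_mkD ok ok rfl

theorem proj_mkD {h : Half n} (hh : h.Ok) : IsProj (mkD h h) := by
  rw [proj_iff (mkD_mem hh hh), mkD_up hh rfl, mkD_low hh rfl]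

theorem proj_eq {α : Dgm n} (hα : α ∈ Mset n) (hp : IsProj α) : α = mkD (up α) (up α) := by
  have e := eq_mkD hα
  rwa [← (proj_iff hα).1 hp] at e

end Mtz

namespace Mtz

open Dgm

variable {n : ℕ}

def Special (h : Half n) : Prop :=
  ∀ x, x ∉ h.A → (∀ y, h.R x y → y = x) → ∃ u v, h.R u v ∧ u < x ∧ x < v

theorem upsing_iff {α : Dgm n} {x : Fin n} :
    UpperSingleton α x ↔ x ∉ (up α).A ∧ ∀ y, (up α).R x y → y = x := by
  constructor
  · intro h
    refine ⟨fun hx => ?_, fun y hy => ?_⟩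
    · obtain ⟨j, hj⟩ := mem_up.1 hx
      simpa using h _ hj
    · simpa using h _ hy
  · rintro ⟨h1, h2⟩ (y | y) hy
    · rw [h2 y hy]
    · exact absurd (mem_up.2 ⟨y, hy⟩) h1

theorem special_up {α : Dgm n} :
    (∀ x, UpperSingleton α x → UpperNested α x) ↔ Special (up α) := by
  constructor
  · intro h x h1 h2
    exact h x (upsing_iff.2 ⟨h1, h2⟩)
  · intro h x hx
    exact h x (upsing_iff.1 hx).1 (upsing_iff.1 hx).2

theorem lowsing_iff {α : Dgm n} {x : Fin n} : LowerSingleton α x ↔ UpperSingleton (pstar α) x := by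
  constructor
  · rintro h (y | y) hy
    · have := h (Sum.inr y) hy
      simpa using this
    · have := h (Sum.inl y) hy
      simp at this
  · rintro h (y | y) hy
    · have := h (Sum.inr y) hy
      simp at this
    · have := h (Sum.inl y) hy
      simpa using this

theorem special_iff {α : Dgm n} (hp : IsProj α) : NoUnnestedSingleton α ↔ Special (up α) := by
  rw [← special_up]
  constructor
  · exact fun h => h.1
  · intro h
    refine ⟨h, fun x hx => ?_⟩
    rw [lowsing_iff, hp.2] at hx
    obtain ⟨u, v, h1, h2⟩ := h x hx
    refine ⟨u, v, ?_, h2⟩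
    rw [← hp.2] at h1
    exact h1

theorem gen_sub {X : Set (Dgm n)} {r : ℕ} (hX : X ⊆ IM n r) {α : Dgm n} (h : MClo pmul X α) :
    α ∈ IM n r := by
  induction h with
  | base h => exact hX h
  | mul _ _ h1 h2 => exact ⟨pmul_mem h1.1 h2.1, (prank_mul_left _ _).trans h1.2⟩

theorem lb1 {X : Set (Dgm n)} {r : ℕ} (hX : X ⊆ IM n r) {α : Dgm n} (h : MClo pmul X α)
    (hr : prank α = r) : ∃ x ∈ X, prank x = r ∧ up x = up α := by
  induction h with
  | base h => exact ⟨_, h, hr, rfl⟩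
  | @mul β γ h1 h2 ih1 ih2 =>
    have a1 := gen_sub hX h1
    have a2 := gen_sub hX h2
    have := prank_mul_left β γ
    have h3 : prank β = r := by have := a1.2; omega
    obtain ⟨x, hx, e1, e2⟩ := ih1 h3
    exact ⟨x, hx, e1, e2.trans (up_eq_of_rank (pmul_mem a1.1 a2.1) (by omega)).symm⟩

theorem lb2 {X : Set (Dgm n)} {s : ℕ} (hX : X ⊆ IM n (s + 1)) {α : Dgm n} (h : MClo pmul X α)
    (hr : prank α = s) (hs : Special (up α)) : ∃ x ∈ X, prank x = s ∧ up x = up α := by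
  induction h with
  | base h => exact ⟨_, h, hr, rfl⟩
  | @mul β γ h1 h2 ih1 ih2 =>
    have a1 := gen_sub hX h1
    have a2 := gen_sub hX h2
    have hm := pmul_mem a1.1 a2.1
    have hle := prank_mul_left β γ
    by_cases h3 : prank β = s
    · have e := up_eq_of_rank hm (by omega)
      obtain ⟨x, hx, e1, e2⟩ := ih1 h3 (e ▸ hs)
      exact ⟨x, hx, e1, e2.trans e.symm⟩
    · exfalso
      have h4 : prank β = s + 1 := by have := a1.2; omega
      rw [prank_eq] at hr h4
      obtain ⟨x, hx, hx'⟩ := Finset.exists_mem_notMem_of_card_lt_card (s := (up (pmul β γ)).A)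
        (t := (up β).A) (by omega)
      have e : (up (pmul β γ)).A = (up β).A.erase x := by
        apply Finset.eq_of_subset_of_card_le
        · intro i hi
          refine Finset.mem_erase.2 ⟨?_, dom_sub _ _ hi⟩
          rintro rfl; exact hx' hi
        · rw [Finset.card_erase_of_mem hx]; omega
      have e2 := up_drop hm (by rw [e]) hx'
      have ok := up_ok a1.1
      rw [e2] at hs
      obtain ⟨u, v, h5, h6, h7⟩ := hs x (by simp) (fun y hy => ok.trv x y hx hy)
      exact ok.un x u v hx h5 h6 h7

instance finDgm : Finite (Dgm n) :=
  Finite.of_injective (fun s : Dgm n => s.r) (fun s t h => by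
    ext x y
    exact iff_of_eq (congrFun (congrFun h x) y))

def prj (n r : ℕ) : Set (Dgm n) := {α : Dgm n | α ∈ DM n r ∧ IsProj α}
def sprj (n r : ℕ) : Set (Dgm n) := {α : Dgm n | α ∈ DM n r ∧ IsProj α ∧ NoUnnestedSingleton α}

theorem proj_inj {α β : Dgm n} (h1 : α ∈ Mset n) (h2 : β ∈ Mset n) (p1 : IsProj α) (p2 : IsProj β)
    (h : up α = up β) : α = β := by
  rw [proj_eq h1 p1, proj_eq h2 p2, h]

theorem lower0 {X : Finset (Dgm n)} {r : ℕ} (hX : genSet pmul (X : Set (Dgm n)) = IM n r) :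
    (prj n r).ncard ≤ X.card := by
  have hs : (X : Set (Dgm n)) ⊆ IM n r := fun x hx => hX ▸ MClo.base hx
  have key : ∀ α ∈ prj n r, ∃ x ∈ (X : Set (Dgm n)), up x = up α := by
    intro α hα
    have : α ∈ genSet pmul (X : Set (Dgm n)) := hX ▸ ⟨hα.1.1, hα.1.2.le⟩
    obtain ⟨x, hx, -, h⟩ := lb1 hs this hα.1.2
    exact ⟨x, hx, h⟩
  choose! f hf hf' using key
  rw [← Set.ncard_coe_finset]
  apply Set.ncard_le_ncard_of_injOn f hf
  intro a ha b hb hab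
  exact proj_inj ha.1.1 hb.1.1 ha.2 hb.2 (by rw [← hf' a ha, ← hf' b hb, hab])

theorem disj (s : ℕ) : Disjoint (prj n (s + 1)) (sprj n s) := by
  rw [Set.disjoint_left]
  intro a h1 h2
  have := h1.1.2
  have := h2.1.2
  omega

theorem lower1 {X : Finset (Dgm n)} {s : ℕ} (hX : genSet pmul (X : Set (Dgm n)) = IM n (s + 1)) :
    (prj n (s + 1)).ncard + (sprj n s).ncard ≤ X.card := by
  have hs : (X : Set (Dgm n)) ⊆ IM n (s + 1) := fun x hx => hX ▸ MClo.base hx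
  have key : ∀ α ∈ prj n (s + 1) ∪ sprj n s, ∃ x ∈ (X : Set (Dgm n)), up x = up α := by
    rintro α (hα | hα)
    · have : α ∈ genSet pmul (X : Set (Dgm n)) := hX ▸ ⟨hα.1.1, hα.1.2.le⟩
      obtain ⟨x, hx, -, h⟩ := lb1 hs this hα.1.2
      exact ⟨x, hx, h⟩
    · have : α ∈ genSet pmul (X : Set (Dgm n)) := hX ▸ ⟨hα.1.1, by rw [hα.1.2]; omega⟩
      obtain ⟨x, hx, -, h⟩ := lb2 hs this hα.1.2 ((special_iff hα.2.1).1 hα.2.2)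
      exact ⟨x, hx, h⟩
  choose! f hf hf' using key
  rw [← Set.ncard_union_eq (disj s), ← Set.ncard_coe_finset]
  apply Set.ncard_le_ncard_of_injOn f hf
  have hm : ∀ a ∈ prj n (s + 1) ∪ sprj n s, a ∈ Mset n ∧ IsProj a := by
    rintro a (h | h)
    · exact ⟨h.1.1, h.2⟩
    · exact ⟨h.1.1, h.2.1⟩
  intro a ha b hb hab
  exact proj_inj (hm a ha).1 (hm b hb).1 (hm a ha).2 (hm b hb).2 (by rw [← hf' a ha, ← hf' b hb, hab])

end Mtz

namespace Mtz

open Dgm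

variable {n : ℕ}

def idH (A : Finset (Fin n)) : Half n := ⟨fun i j => i = j, A⟩

theorem idH_ok (A : Finset (Fin n)) : (idH A).Ok where
  eqv := ⟨fun _ => rfl, fun h => h.symm, fun h h' => h.trans h'⟩
  pb := fun _ _ _ h _ => Or.inl h
  trv := fun _ _ _ h => h.symm
  nc := fun a b c d h _ h1 h2 _ => by
    have h : a = b := h
    subst h; exact absurd (h1.trans h2) (lt_irrefl _)
  un := fun a u v _ h h1 h2 => by
    have h : u = v := h
    subst h; exact absurd (h1.trans h2) (lt_irrefl _)

theorem idH_ns {A : Finset (Fin n)} (h : A.card < n) : ¬ Special (idH A) := by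
  intro hs
  obtain ⟨x, hx⟩ : ∃ x, x ∉ A := by
    by_contra hc
    push Not at hc
    have : A = Finset.univ := by ext i; simp [hc i]
    simp [this] at h
  obtain ⟨u, v, h1, h2, h3⟩ := hs x hx (fun y hy => Eq.symm hy)
  have h1 : u = v := h1
  subst h1
  exact absurd (h2.trans h3) (lt_irrefl _)

def hookH (p q : Fin n) (A : Finset (Fin n)) : Half n :=
  ⟨fun a b => a = b ∨ (a = p ∧ b = q) ∨ (a = q ∧ b = p), A⟩

theorem hookH_ok {p q : Fin n} {A : Finset (Fin n)} (hpq : p < q) (hp : p ∉ A) (hq : q ∉ A)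
    (h : ∀ a ∈ A, p < a → a < q → False) : (hookH p q A).Ok where
  eqv := ⟨fun _ => Or.inl rfl, fun h => by simp only [hookH] at h ⊢; grind,
    fun h h' => by simp only [hookH] at h h' ⊢; grind⟩
  pb := fun _ _ _ h h' => by simp only [hookH] at h h'; grind
  trv := fun a b h h' => by simp only [hookH] at h h'; grind
  nc := fun a b c d h h' h1 h2 h3 => by simp only [hookH] at h h'; grind
  un := fun a u v h1 h2 h3 h4 => by
    simp only [hookH] at h1 h2
    have := h a h1
    grind

def fst (n s : ℕ) : Finset (Fin n) := Finset.univ.filter fun i => (i : ℕ) < s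

theorem mem_fst {s : ℕ} {i : Fin n} : i ∈ fst n s ↔ (i : ℕ) < s := by simp [fst]

theorem card_fst {s : ℕ} (h : s ≤ n) : (fst n s).card = s := by
  have : fst n s = Finset.univ.map (Fin.castLEEmb h) := by
    ext i
    simp only [mem_fst, Finset.mem_map, Finset.mem_univ, true_and, Fin.castLEEmb_apply]
    constructor
    · intro hi; exact ⟨⟨i, hi⟩, by ext; simp⟩
    · rintro ⟨j, rfl⟩; simp
  rw [this]; simp

theorem cnt_fst {s : ℕ} {i : Fin n} (h : (i : ℕ) ≤ s) : cnt (fst n s) i = i := by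
  have : (fst n s).filter (· < i) = fst n i := by
    ext j; simp only [Finset.mem_filter, mem_fst, Fin.lt_def]; omega
  unfold cnt
  rw [this, card_fst i.2.le]

theorem pos_aux {s i j : ℕ} (hs : s + 2 ≤ n) (hij : i ≤ j) (hj : j ≤ s) :
    ∃ (B : Finset (Fin n)) (w z : Fin n), B.card = s ∧ w ∉ B ∧ z ∉ B ∧ w ≠ z ∧
      cnt B w = i ∧ cnt B z = j := by
  let w : Fin n := ⟨i, by omega⟩
  let z : Fin n := ⟨j + 1, by omega⟩
  have hwz : w ≠ z := by simp only [w, z, ne_eq, Fin.mk.injEq]; omega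
  refine ⟨((fst n (s + 2)).erase w).erase z, w, z, ?_, by simp, by simp, hwz, ?_, ?_⟩
  · rw [Finset.card_erase_of_mem, Finset.card_erase_of_mem, card_fst hs]
    · omega
    · simp only [mem_fst, w]; omega
    · refine Finset.mem_erase.2 ⟨hwz.symm, ?_⟩
      simp only [mem_fst, z]; omega
  · have : (((fst n (s + 2)).erase w).erase z).filter (· < w) = fst n i := by
      ext k; simp only [Finset.mem_filter, Finset.mem_erase, mem_fst, Fin.lt_def, w, z, ne_eq, Fin.ext_iff]; omega
    unfold cnt
    rw [this, card_fst (by omega)]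
  · have : (((fst n (s + 2)).erase w).erase z).filter (· < z) = (fst n (j + 1)).erase w := by
      ext k; simp only [Finset.mem_filter, Finset.mem_erase, mem_fst, Fin.lt_def, w, z, ne_eq, Fin.ext_iff]; omega
    unfold cnt
    rw [this, Finset.card_erase_of_mem, card_fst (by omega)]
    · omega
    · simp only [mem_fst, w]; omega

theorem pos {s i j : ℕ} (hs : s + 2 ≤ n) (hi : i ≤ s) (hj : j ≤ s) :
    ∃ (B : Finset (Fin n)) (w z : Fin n), B.card = s ∧ w ∉ B ∧ z ∉ B ∧ w ≠ z ∧
      cnt B w = i ∧ cnt B z = j := by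
  rcases le_total i j with h | h
  · exact pos_aux hs h hj
  · obtain ⟨B, w, z, h1, h2, h3, h4, h5, h6⟩ := pos_aux hs h hi
    exact ⟨B, z, w, h1, h3, h2, h4.symm, h6, h5⟩

theorem cnt_insert (B : Finset (Fin n)) (w : Fin n) : cnt (insert w B) w = cnt B w := by
  unfold cnt
  congr 1
  ext i
  simp only [Finset.mem_filter, Finset.mem_insert]
  constructor
  · rintro ⟨rfl | h, h'⟩
    · exact absurd h' (lt_irrefl _)
    · exact ⟨h, h'⟩
  · rintro ⟨h, h'⟩; exact ⟨Or.inr h, h'⟩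

theorem exists_tr {h k : Half n} (c : h.A.card = k.A.card) {i : Fin n} (hi : i ∈ h.A) :
    ∃ j ∈ k.A, (mkD h k).r (Sum.inl i) (Sum.inr j) := by
  obtain ⟨j, hj, e⟩ := cnt_surj (A := k.A) (k := cnt h.A i) (c ▸ cnt_lt_card hi)
  exact ⟨j, hj, (mkD_tr i j).2 ⟨hi, hj, e.symm⟩⟩

theorem drop_up {h k k' l : Half n} (hh : h.Ok) (hk : k.Ok) (hk' : k'.Ok) (hl : l.Ok)
    (c1 : h.A.card = k.A.card) (c2 : k'.A.card = l.A.card) {x w : Fin n} (hx : x ∈ h.A)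
    (hw : w ∈ k.A) (hc : cnt h.A x = cnt k.A w) (hB : k.A.erase w ⊆ k'.A) (hw' : w ∉ k'.A)
    (hs : ∀ y, k'.R w y → y = w) :
    up (pmul (mkD h k) (mkD k' l)) = ⟨h.R, h.A.erase x⟩ := by
  have m1 := mkD_mem hh hk
  have m2 := mkD_mem hk' hl
  have hm := pmul_mem m1 m2
  have e1 := mkD_up hh c1
  have e2 := mkD_up hk' c2
  have hxw : (mkD h k).r (Sum.inl x) (Sum.inr w) := (mkD_tr x w).2 ⟨hx, hw, hc⟩
  have := up_drop hm (x := x) ?_ ?_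
  · rw [this, e1]
  · rw [e1]
    intro i hi
    obtain ⟨hne, hi⟩ := Finset.mem_erase.1 hi
    obtain ⟨j, hj, ht⟩ := exists_tr c1 hi
    apply lives ht
    rw [e2]
    apply hB
    refine Finset.mem_erase.2 ⟨?_, hj⟩
    rintro rfl
    exact hne (pb_tr m1 ht hxw)
  · apply dies m1 hxw
    exact upsing_iff.2 (by rw [e2]; exact ⟨hw', hs⟩)

theorem ok_insert {P : Half n} (hP : P.Ok) {x : Fin n} (hs : ∀ y, P.R x y → y = x)
    (hn : ¬ ∃ u v, P.R u v ∧ u < x ∧ x < v) : Half.Ok (⟨P.R, insert x P.A⟩ : Half n) where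
  eqv := hP.eqv
  pb := hP.pb
  nc := hP.nc
  trv := by
    intro a y ha h
    rcases Finset.mem_insert.1 ha with rfl | ha
    · exact hs y h
    · exact hP.trv a y ha h
  un := by
    intro a u v ha h h1 h2
    rcases Finset.mem_insert.1 ha with rfl | ha
    · exact hn ⟨u, v, h, h1, h2⟩
    · exact hP.un a u v ha h h1 h2

def Full (Y : Set (Dgm n)) (s : ℕ) : Prop :=
  ∀ P Q : Half n, P.Ok → Q.Ok → P.A.card = s → Q.A.card = s → MClo pmul Y (mkD P Q)

theorem stepC {Y : Set (Dgm n)} {s : ℕ} (hs : s + 2 ≤ n) (hD : Full Y (s + 1)) {P Q : Half n}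
    (hP : P.Ok) (hQ : Q.Ok) (cP : P.A.card = s) (cQ : Q.A.card = s) (nP : ¬ Special P)
    (nQ : ¬ Special Q) : MClo pmul Y (mkD P Q) := by
  unfold Special at nP nQ
  push Not at nP nQ
  obtain ⟨x, hx, xs, xn⟩ := nP
  obtain ⟨y, hy, ys, yn⟩ := nQ
  have okP := ok_insert hP xs (by push Not; exact xn)
  have okQ := ok_insert hQ ys (by push Not; exact yn)
  have lx : cnt (insert x P.A) x ≤ s := by
    have := cnt_lt_card (Finset.mem_insert_self x P.A)
    rw [Finset.card_insert_of_notMem hx] at this; omega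
  have ly : cnt (insert y Q.A) y ≤ s := by
    have := cnt_lt_card (Finset.mem_insert_self y Q.A)
    rw [Finset.card_insert_of_notMem hy] at this; omega
  obtain ⟨B, w, z, cB, hw, hz, hwz, ew, ez⟩ := pos hs lx ly
  have ok1 := idH_ok (insert w B)
  have ok2 := idH_ok (insert z B)
  have cP' : (insert x P.A).card = s + 1 := by rw [Finset.card_insert_of_notMem hx, cP]
  have cQ' : (insert y Q.A).card = s + 1 := by rw [Finset.card_insert_of_notMem hy, cQ]
  have cw : (insert w B).card = s + 1 := by rw [Finset.card_insert_of_notMem hw, cB]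
  have cz : (insert z B).card = s + 1 := by rw [Finset.card_insert_of_notMem hz, cB]
  have g1 := hD ⟨P.R, insert x P.A⟩ (idH (insert w B)) okP ok1 cP' cw
  have g2 := hD (idH (insert z B)) ⟨Q.R, insert y Q.A⟩ ok2 okQ cz cQ'
  have m1 := mkD_mem okP ok1
  have m2 := mkD_mem ok2 okQ
  have e : pmul (mkD ⟨P.R, insert x P.A⟩ (idH (insert w B)))
      (mkD (idH (insert z B)) ⟨Q.R, insert y Q.A⟩) = mkD P Q := by
    rw [eq_mkD (pmul_mem m1 m2)]
    congr 1
    · rw [drop_up okP ok1 ok2 okQ (cP'.trans cw.symm) (cz.trans cQ'.symm) (x := x) (w := w)]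
      · simp [Finset.erase_insert hx]
      · simp
      · simp [idH]
      · exact ew.symm.trans (cnt_insert B w).symm
      · simp only [idH]; rw [Finset.erase_insert hw]; exact Finset.subset_insert _ _
      · simp [idH, hwz, hw]
      · intro y hy; exact Eq.symm hy
    · rw [low_mul, star_mkD okP ok1 (cP'.trans cw.symm), star_mkD ok2 okQ (cz.trans cQ'.symm)]
      rw [drop_up okQ ok2 ok1 okP (cQ'.trans cz.symm) (cw.trans cP'.symm) (x := y) (w := z)]
      · simp [Finset.erase_insert hy]
      · simp
      · simp [idH]
      · exact ez.symm.trans (cnt_insert B z).symm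
      · simp only [idH]; rw [Finset.erase_insert hz]; exact Finset.subset_insert _ _
      · simp [idH, hwz.symm, hz]
      · intro y hy; exact Eq.symm hy
  rw [← e]
  exact MClo.mul g1 g2

end Mtz

namespace Mtz

open Dgm

variable {n : ℕ}

theorem exists_hook {P : Half n} (hP : P.Ok) (hc : P.A.card < n) (hs : Special P) :
    ∃ u v, u < v ∧ P.R u v ∧ (∀ u' v', P.R u' v' → u' < u → u < v' → False) ∧
      (∀ u' v', P.R u' v' → u' < v → v < v' → False) := by
  have h0 : ∃ q : Fin n × Fin n, q.1 < q.2 ∧ P.R q.1 q.2 := by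
    obtain ⟨x, hx⟩ : ∃ x, x ∉ P.A := by
      by_contra hcon
      push Not at hcon
      have : P.A = Finset.univ := by ext i; simp [hcon i]
      simp [this] at hc
    by_cases h : ∀ y, P.R x y → y = x
    · obtain ⟨u, v, h1, h2, h3⟩ := hs x hx h
      exact ⟨(u, v), h2.trans h3, h1⟩
    · push Not at h
      obtain ⟨y, h1, h2⟩ := h
      rcases lt_or_gt_of_ne h2 with h | h
      · exact ⟨(y, x), h, hP.eqv.symm h1⟩
      · exact ⟨(x, y), h, h1⟩
  obtain ⟨⟨u, v⟩, hm, hmax⟩ := Finset.exists_max_image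
    (Finset.univ.filter fun q : Fin n × Fin n => q.1 < q.2 ∧ P.R q.1 q.2)
    (fun q => (q.2 : ℕ) - (q.1 : ℕ)) (by obtain ⟨q, hq⟩ := h0; exact ⟨q, by simpa using hq⟩)
  simp only [Finset.mem_filter, Finset.mem_univ, true_and, Prod.forall] at hm hmax
  obtain ⟨huv, hR⟩ := hm
  have k1 : ∀ u' v', P.R u' v' → u' < u → u < v' → False := by
    intro u' v' h h1 h2
    have h3 : v < v' := by
      rcases lt_trichotomy v v' with h3 | h3 | h3
      · exact h3
      · subst h3
        have := hP.pb v u u' (hP.eqv.symm hR) (hP.eqv.symm h)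
        omega
      · exact (hP.nc u' v' u v h hR h1 h2 h3).elim
    have := hmax u' v' ⟨h1.trans h2, h⟩
    simp only [Fin.lt_def] at *
    omega
  refine ⟨u, v, huv, hR, k1, ?_⟩
  intro u' v' h h1 h2
  rcases lt_trichotomy u u' with h3 | h3 | h3
  · exact hP.nc u v u' v' hR h h3 h1 h2
  · subst h3
    have := hP.pb u v v' hR h
    omega
  · exact k1 u' v' h h3 (huv.trans h2)

def unhook (P : Half n) (u v : Fin n) : Half n :=
  ⟨fun i j => P.R i j ∧ (i = j ∨ (i ≠ u ∧ i ≠ v)), insert u (insert v P.A)⟩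

theorem unhook_ok {P : Half n} (hP : P.Ok) {u v : Fin n} (huv : u < v) (hR : P.R u v)
    (k1 : ∀ u' v', P.R u' v' → u' < u → u < v' → False)
    (k2 : ∀ u' v', P.R u' v' → u' < v → v < v' → False) : (unhook P u v).Ok := by
  have hR' := hP.eqv.symm hR
  have q1 : ∀ i, P.R u i → i = u ∨ i = v := by
    intro i hi
    have := hP.pb u v i hR hi
    grind
  have q2 : ∀ i, P.R v i → i = u ∨ i = v := by
    intro i hi
    have := hP.pb v u i hR' hi
    grind
  constructor
  · refine ⟨fun x => ⟨hP.eqv.refl x, Or.inl rfl⟩, ?_, ?_⟩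
    · rintro x y ⟨h, h'⟩
      refine ⟨hP.eqv.symm h, ?_⟩
      have a1 := q1 x
      have a2 := q2 x
      have h2 := hP.eqv.symm h
      by_cases e1 : y = u
      · subst e1; have := a1 h2; grind
      · by_cases e2 : y = v
        · subst e2; have := a2 h2; grind
        · exact Or.inr ⟨e1, e2⟩
    · rintro x y z ⟨h, h'⟩ ⟨h2, h2'⟩
      refine ⟨hP.eqv.trans h h2, ?_⟩
      rcases h' with rfl | h'
      · exact h2'
      · exact Or.inr h'
  · rintro x y z ⟨h, -⟩ ⟨h', -⟩
    exact hP.pb x y z h h'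
  · rintro a y ha ⟨h, h'⟩
    simp only [unhook, Finset.mem_insert] at ha
    rcases ha with rfl | rfl | ha
    · grind
    · grind
    · exact hP.trv a y ha h
  · rintro a b c d ⟨h, -⟩ ⟨h', -⟩
    exact hP.nc a b c d h h'
  · rintro a x y ha ⟨h, -⟩ h1 h2
    simp only [unhook, Finset.mem_insert] at ha
    rcases ha with rfl | rfl | ha
    · exact k1 _ _ h h1 h2
    · exact k2 _ _ h h1 h2
    · exact hP.un a x y ha h h1 h2

theorem stepD {Y : Set (Dgm n)} {s : ℕ} (hs : s + 3 ≤ n) (hD : Full Y (s + 1))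
    (hD2 : Full Y (s + 2)) {P : Half n} (hP : P.Ok) (cP : P.A.card = s) (sP : Special P) :
    ∃ N : Half n, N.Ok ∧ N.A.card = s ∧ ¬ Special N ∧ MClo pmul Y (mkD P N) := by
  obtain ⟨u, v, huv, hR, k1, k2⟩ := exists_hook hP (by omega) sP
  have ok1 := unhook_ok hP huv hR k1 k2
  have hR' := hP.eqv.symm hR
  have hu : u ∉ P.A := fun h => huv.ne' (hP.trv u v h hR)
  have hv : v ∉ P.A := fun h => huv.ne (hP.trv v u h hR')
  have c1 : (unhook P u v).A.card = s + 2 := by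
    simp only [unhook]
    rw [Finset.card_insert_of_notMem (by simp [hu, huv.ne]), Finset.card_insert_of_notMem hv, cP]
  have mu : u ∈ (unhook P u v).A := by simp [unhook]
  have mv : v ∈ (unhook P u v).A := by simp [unhook]
  have hcv : cnt (unhook P u v).A v = cnt (unhook P u v).A u + 1 := by
    unfold cnt
    rw [← Finset.card_insert_of_notMem (a := u) (by simp)]
    congr 1
    ext k
    simp only [unhook, Finset.mem_insert, Finset.mem_filter]
    have := hP.un k u v
    constructor
    · rintro ⟨rfl | rfl | h, h'⟩
      · simp
      · exact absurd h' (lt_irrefl _)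
      · right
        refine ⟨by simp [h], ?_⟩
        rcases lt_trichotomy k u with h3 | h3 | h3
        · exact h3
        · subst h3; exact absurd h hu
        · exact (this h hR h3 h').elim
    · rintro (rfl | ⟨h, h'⟩)
      · exact ⟨Or.inl rfl, huv⟩
      · exact ⟨h, h'.trans huv⟩
  have lv := cnt_lt_card mv
  rw [c1] at lv
  let i : Fin n := ⟨cnt (unhook P u v).A u, by omega⟩
  let j : Fin n := ⟨cnt (unhook P u v).A v, by omega⟩
  have hij : (j : ℕ) = i + 1 := hcv
  have hj2 : (j : ℕ) < s + 2 := lv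
  have hi2 : (i : ℕ) < s + 2 := by omega
  let F := fst n (s + 2)
  have cF : F.card = s + 2 := card_fst (by omega)
  let A := (F.erase i).erase j
  have hne : j ≠ i := by intro h; rw [h] at hij; omega
  have iF : i ∈ F := mem_fst.2 hi2
  have jF : j ∈ F := mem_fst.2 hj2
  have cA : A.card = s := by
    simp only [A]
    rw [Finset.card_erase_of_mem (Finset.mem_erase.2 ⟨hne, jF⟩), Finset.card_erase_of_mem iF, cF]
    omega
  have okF := idH_ok F
  have okA := idH_ok A
  have okK : (hookH i j A).Ok := by
    apply hookH_ok
    · rw [Fin.lt_def]; omega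
    · simp [A]
    · simp [A]
    · intro a _ h1 h2; rw [Fin.lt_def] at h1 h2; omega
  have nsK : ¬ Special (hookH i j A) := by
    intro hsp
    let z : Fin n := ⟨s + 2, by omega⟩
    have hzv : (z : ℕ) = s + 2 := rfl
    have zi : z ≠ i := by intro h; rw [h] at hzv; omega
    have zj : z ≠ j := by intro h; rw [h] at hzv; omega
    obtain ⟨a, b, h1, h2, h3⟩ := hsp z (by
      simp only [hookH, A, F, Finset.mem_erase, mem_fst]; omega) (by
      intro y hy
      simp only [hookH] at hy
      grind)
    simp only [hookH] at h1
    rw [Fin.lt_def] at h2 h3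
    rcases h1 with h1 | ⟨h1, h1'⟩ | ⟨h1, h1'⟩
    · subst h1; omega
    · subst h1 h1'; omega
    · subst h1 h1'; omega
  have nsA : ¬ Special (idH A) := idH_ns (by omega)
  refine ⟨idH A, okA, cA, nsA, ?_⟩
  have g1 := hD2 (unhook P u v) (idH F) ok1 okF c1 cF
  have g2 := stepC (by omega) hD okK okA cA cA nsK nsA
  have e1 : up (mkD (unhook P u v) (idH F)) = unhook P u v := mkD_up ok1 (c1.trans cF.symm)
  have e2 : up (mkD (hookH i j A) (idH A)) = hookH i j A := mkD_up okK rfl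
  have m1 := mkD_mem ok1 okF
  have m2 := mkD_mem okK okA
  have hm := pmul_mem m1 m2
  have tu : (mkD (unhook P u v) (idH F)).r (Sum.inl u) (Sum.inr i) :=
    (mkD_tr u i).2 ⟨mu, iF, (cnt_fst hi2.le).symm⟩
  have tv : (mkD (unhook P u v) (idH F)).r (Sum.inl v) (Sum.inr j) :=
    (mkD_tr v j).2 ⟨mv, jF, (cnt_fst hj2.le).symm⟩
  have tij : (mkD (hookH i j A) (idH A)).r (Sum.inl i) (Sum.inl j) :=
    (mkD_ul okK i j).2 (Or.inr (Or.inl ⟨rfl, rfl⟩))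
  have huvR : (up (pmul (mkD (unhook P u v) (idH F)) (mkD (hookH i j A) (idH A)))).R u v :=
    ((eA tu).trans (eB tij)).trans (eA tv).symm
  have okm := up_ok hm
  have nu : u ∉ (up (pmul (mkD (unhook P u v) (idH F)) (mkD (hookH i j A) (idH A)))).A :=
    fun h => huv.ne' (okm.trv _ _ h huvR)
  have nv : v ∉ (up (pmul (mkD (unhook P u v) (idH F)) (mkD (hookH i j A) (idH A)))).A :=
    fun h => huv.ne (okm.trv _ _ h (okm.eqv.symm huvR))
  have sub : P.A ⊆ (up (pmul (mkD (unhook P u v) (idH F)) (mkD (hookH i j A) (idH A)))).A := by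
    intro a ha
    have ha' : a ∈ (unhook P u v).A := by simp [unhook, ha]
    obtain ⟨b, hb, ht⟩ := exists_tr (k := idH F) (c1.trans cF.symm) ha'
    apply lives ht
    rw [e2]
    refine Finset.mem_erase.2 ⟨?_, Finset.mem_erase.2 ⟨?_, hb⟩⟩
    · rintro rfl; exact hv (pb_tr m1 ht tv ▸ ha)
    · rintro rfl; exact hu (pb_tr m1 ht tu ▸ ha)
  have eup : up (pmul (mkD (unhook P u v) (idH F)) (mkD (hookH i j A) (idH A))) = P := by
    apply Half.ext
    · funext a b
      apply propext
      constructor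
      · intro h
        by_cases h' : (up (mkD (unhook P u v) (idH F))).R a b
        · rw [e1] at h'; exact h'.1
        · obtain ⟨⟨h1, h2⟩, ⟨h3, h4⟩, h5⟩ := new_pair hm h h'
          rw [e1] at h1 h3
          simp only [unhook, Finset.mem_insert] at h1 h3
          have h2' : a ∉ P.A := fun h => h2 (sub h)
          have h4' : b ∉ P.A := fun h => h4 (sub h)
          rcases h1 with rfl | rfl | h1
          · rcases h3 with rfl | rfl | h3
            · exact absurd rfl h5
            · exact hR
            · exact absurd h3 h4'
          · rcases h3 with rfl | rfl | h3
            · exact hR'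
            · exact absurd rfl h5
            · exact absurd h3 h4'
          · exact absurd h1 h2'
      · intro h
        by_cases hab : a = b
        · subst hab; exact okm.eqv.refl _
        by_cases hau : a = u
        · subst hau
          have : v = b := by have := hP.pb a v b hR h; grind
          subst this; exact huvR
        by_cases hav : a = v
        · subst hav
          have : u = b := by have := hP.pb a u b hR' h; grind
          subst this; exact okm.eqv.symm huvR
        apply up_mono
        rw [e1]
        exact ⟨h, Or.inr ⟨hau, hav⟩⟩
    · apply Finset.Subset.antisymm _ sub
      intro a ha
      have := dom_sub _ _ ha
      rw [e1] at this
      simp only [unhook, Finset.mem_insert] at this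
      rcases this with rfl | rfl | h
      · exact absurd ha nu
      · exact absurd ha nv
      · exact h
  have elow : low (pmul (mkD (unhook P u v) (idH F)) (mkD (hookH i j A) (idH A))) = idH A := by
    rw [low_eq_of_rank m1 m2, mkD_low (h := hookH i j A) okA rfl]
    rw [prank_eq, prank_eq, eup, e2, cP]
    exact cA.le
  have e := eq_mkD hm
  rw [eup, elow] at e
  rw [← e]
  exact MClo.mul g1 g2

theorem gen_star {Y : Set (Dgm n)} (hY : ∀ y ∈ Y, pstar y ∈ Y) {α : Dgm n} (h : MClo pmul Y α) :
    MClo pmul Y (pstar α) := by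
  induction h with
  | base h => exact MClo.base (hY _ h)
  | mul _ _ h1 h2 => rw [star_mul]; exact MClo.mul h2 h1

theorem gen_trans {X Y : Set (Dgm n)} (hY : ∀ y ∈ Y, MClo pmul X y) {α : Dgm n}
    (h : MClo pmul Y α) : MClo pmul X α := by
  induction h with
  | base h => exact hY _ h
  | mul _ _ h1 h2 => exact MClo.mul h1 h2

/-- full generation from one layer and the special projections below it -/
theorem full_all {r : ℕ} (hr : r + 1 < n) {s : ℕ} (hs : s ≤ r + 1) :
    Full (DM n (r + 1) ∪ sprj n r) s := by
  have hstar : ∀ y ∈ DM n (r + 1) ∪ sprj n r, pstar y ∈ DM n (r + 1) ∪ sprj n r := by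
    rintro y (h | h)
    · left
      refine ⟨star_mem h.1, ?_⟩
      rw [prank_low (star_mem h.1), low_star, ← prank_eq, h.2]
    · right; rw [h.2.1.2]; exact h
  have key : ∀ d, ∀ s, s + d = r + 1 → Full (DM n (r + 1) ∪ sprj n r) s := by
    intro d
    induction d using Nat.strong_induction_on with
    | _ d ih =>
    intro s hsd
    rcases Nat.eq_zero_or_pos d with rfl | hd
    · intro P Q hP hQ cP cQ
      apply MClo.base
      left
      exact ⟨mkD_mem hP hQ, by rw [mkD_prank hP (cP.trans cQ.symm)]; omega⟩
    have hD : Full (DM n (r + 1) ∪ sprj n r) (s + 1) := ih (d - 1) (by omega) _ (by omega)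
    have stepN : ∀ P : Half n, P.Ok → P.A.card = s →
        ∃ N : Half n, N.Ok ∧ N.A.card = s ∧ ¬ Special N ∧
          MClo pmul (DM n (r + 1) ∪ sprj n r) (mkD P N) := by
      intro P hP cP
      by_cases sP : Special P
      · by_cases hd1 : d = 1
        · have nsA : ¬ Special (idH P.A) := idH_ns (by omega)
          refine ⟨idH P.A, idH_ok _, cP, nsA, ?_⟩
          rw [← mul_same hP hP (idH_ok P.A) (idH_ok P.A) rfl rfl rfl]
          apply MClo.mul
          · apply MClo.base
            right
            refine ⟨⟨mkD_mem hP hP, by rw [mkD_prank hP rfl]; omega⟩, proj_mkD hP, ?_⟩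
            rw [special_iff (proj_mkD hP), mkD_up hP rfl]
            exact sP
          · exact stepC (by omega) hD (idH_ok _) (idH_ok _) cP cP nsA nsA
        · exact stepD (by omega) hD (ih (d - 2) (by omega) _ (by omega)) hP cP sP
      · exact ⟨P, hP, cP, sP, stepC (by omega) hD hP hP cP cP sP sP⟩
    intro P Q hP hQ cP cQ
    obtain ⟨N, ok1, c1, ns1, g1⟩ := stepN P hP cP
    obtain ⟨N', ok2, c2, ns2, g2⟩ := stepN Q hQ cQ
    have g3 := stepC (by omega) hD ok1 ok2 c1 c2 ns1 ns2
    have g4 := gen_star hstar g2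
    rw [star_mkD hQ ok2 (cQ.trans c2.symm)] at g4
    have g5 := MClo.mul g1 g3
    rw [mul_same hP ok1 ok1 ok2 (cP.trans c1.symm) (c1.trans c2.symm) rfl] at g5
    have g6 := MClo.mul g5 g4
    rwa [mul_same hP ok2 ok2 hQ (cP.trans c2.symm) (c2.trans cQ.symm) rfl] at g6
  exact key (r + 1 - s) s (by omega)

theorem full_IM {r : ℕ} {Y : Set (Dgm n)} (h : ∀ s ≤ r, Full Y s) {α : Dgm n} (hα : α ∈ IM n r) :
    MClo pmul Y α := by
  rw [eq_mkD hα.1]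
  refine h _ hα.2 _ _ (up_ok hα.1) (low_ok hα.1) (prank_eq α).symm (prank_low hα.1).symm

def cyc (n r : ℕ) (σ : Equiv.Perm (Dgm n)) : Set (Dgm n) :=
  (fun π => mkD (up π) (up (σ π))) '' prj n r

theorem mkD_prj {r : ℕ} {P : Half n} (hP : P.Ok) (c : P.A.card = r) : mkD P P ∈ prj n r :=
  ⟨⟨mkD_mem hP hP, by rw [mkD_prank hP rfl, c]⟩, proj_mkD hP⟩

theorem exists_cyc (n r : ℕ) : ∃ X : Set (Dgm n), X.ncard ≤ (prj n r).ncard ∧ X ⊆ DM n r ∧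
    Full X r := by
  have hfin : (prj n r).Finite := Set.toFinite _
  have : Fintype (Dgm n) := Fintype.ofFinite _
  obtain ⟨σ, hσ, -⟩ := Finset.exists_cycleOn hfin.toFinset
  rw [Set.Finite.coe_toFinset] at hσ
  have hmap : ∀ π ∈ prj n r, σ π ∈ prj n r := fun π h => hσ.1.mapsTo h
  have hc : ∀ π ∈ prj n r, (up π).A.card = r := fun π h => by rw [← prank_eq]; exact h.1.2
  refine ⟨cyc n r σ, Set.ncard_image_le hfin, ?_, ?_⟩
  · rintro _ ⟨π, h, rfl⟩
    have h' := hmap π h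
    refine ⟨mkD_mem (up_ok h.1.1) (up_ok h'.1.1), ?_⟩
    show prank (mkD _ _) = r
    rw [mkD_prank (up_ok h.1.1) (by rw [hc _ h, hc _ h']), hc _ h]
  · intro P Q hP hQ cP cQ
    have hpow : ∀ m : ℕ, ∀ π ∈ prj n r, (σ ^ m) π ∈ prj n r := by
      intro m
      induction m with
      | zero => intro π h; simpa using h
      | succ m ih => intro π h; rw [pow_succ']; exact hmap _ (ih π h)
    have key : ∀ m : ℕ, ∀ π ∈ prj n r, MClo pmul (cyc n r σ) (mkD (up π) (up ((σ ^ (m + 1)) π))) := by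
      intro m
      induction m with
      | zero => intro π h; exact MClo.base ⟨π, h, by simp⟩
      | succ m ih =>
        intro π h
        have h1 := hpow (m + 1) π h
        have h2 := hmap _ h1
        have g := MClo.mul (ih π h) (MClo.base (m := pmul) ⟨_, h1, rfl⟩)
        dsimp only at g
        rw [mul_same (up_ok h.1.1) (up_ok h1.1.1) (up_ok h1.1.1) (up_ok h2.1.1)
          (by rw [hc _ h, hc _ h1]) (by rw [hc _ h1, hc _ h2]) rfl] at g
        rw [pow_succ']
        exact g
    have p1 := mkD_prj hP cP
    have p2 := mkD_prj hQ cQ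
    rw [← Set.Finite.coe_toFinset hfin] at hσ
    obtain ⟨m, -, hm⟩ := hσ.exists_pow_eq (a := σ (mkD P P)) (b := mkD Q Q)
      (by simpa using hmap _ p1) (by simpa using p2)
    have g := key m _ p1
    rw [pow_succ, Equiv.Perm.mul_apply, hm, mkD_up hP rfl, mkD_up hQ rfl] at g
    exact g

theorem upper0 : ∃ X : Finset (Dgm n), X.card ≤ (prj n 0).ncard ∧
    genSet pmul (X : Set (Dgm n)) = IM n 0 := by
  obtain ⟨X, h1, h2, h3⟩ := exists_cyc n 0
  have hfin : X.Finite := Set.toFinite _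
  refine ⟨hfin.toFinset, by rwa [← Set.ncard_eq_toFinset_card X hfin], ?_⟩
  rw [Set.Finite.coe_toFinset]
  apply Set.Subset.antisymm
  · intro a ha
    exact gen_sub (fun x hx => ⟨(h2 hx).1, (h2 hx).2.le⟩) ha
  · intro a ha
    refine full_IM (fun s hs => ?_) ha
    obtain rfl : s = 0 := by omega
    exact h3

theorem layer_gen {r : ℕ} (hr : r + 1 < n) {X : Set (Dgm n)} (hX : X ⊆ DM n (r + 1))
    (hF : Full X (r + 1)) : genSet pmul (X ∪ sprj n r) = IM n (r + 1) := by
  apply Set.Subset.antisymm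
  · intro a ha
    refine gen_sub ?_ ha
    rintro x (hx | hx)
    · exact ⟨(hX hx).1, (hX hx).2.le⟩
    · exact ⟨hx.1.1, by rw [hx.1.2]; omega⟩
  · intro a ha
    refine gen_trans ?_ (full_IM (fun s hs => full_all hr hs) ha)
    rintro y (hy | hy)
    · rw [eq_mkD hy.1]
      exact gen_trans (fun y hy => MClo.base (Or.inl hy))
        (hF _ _ (up_ok hy.1) (low_ok hy.1) ((prank_eq y).symm.trans hy.2)
          ((prank_low hy.1).symm.trans hy.2))
    · exact MClo.base (Or.inr hy)

theorem upper1 {r : ℕ} (hr : r + 1 < n) : ∃ X : Finset (Dgm n),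
    X.card ≤ (prj n (r + 1)).ncard + (sprj n r).ncard ∧
    genSet pmul (X : Set (Dgm n)) = IM n (r + 1) := by
  obtain ⟨X, h1, h2, h3⟩ := exists_cyc n (r + 1)
  have hfin : (X ∪ sprj n r).Finite := Set.toFinite _
  refine ⟨hfin.toFinset, ?_, ?_⟩
  · rw [← Set.ncard_eq_toFinset_card _ hfin]
    exact (Set.ncard_union_le _ _).trans (by omega)
  · rw [Set.Finite.coe_toFinset]
    exact layer_gen hr h2 h3

theorem rnk_eq {T : Set (Dgm n)} {k : ℕ}
    (h1 : ∃ X : Finset (Dgm n), X.card ≤ k ∧ genSet pmul (X : Set (Dgm n)) = T)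
    (h2 : ∀ X : Finset (Dgm n), genSet pmul (X : Set (Dgm n)) = T → k ≤ X.card) :
    rnk pmul T = k := by
  obtain ⟨X, hX, hg⟩ := h1
  have e : X.card = k := le_antisymm hX (h2 X hg)
  apply le_antisymm
  · exact Nat.sInf_le ⟨X, e, hg⟩
  · refine le_csInf (s := {k | ∃ X : Finset (Dgm n), X.card = k ∧ genSet pmul ↑X = T}) ⟨k, X, e, hg⟩ ?_
    rintro _ ⟨X', rfl, hg'⟩
    exact h2 X' hg'

theorem rnk0 : rnk (pmul (n := n)) (IM n 0) = (prj n 0).ncard :=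
  rnk_eq upper0 (fun _ h => lower0 h)

theorem rnk1 {r : ℕ} (hr : r + 1 < n) :
    rnk (pmul (n := n)) (IM n (r + 1)) = (prj n (r + 1)).ncard + (sprj n r).ncard :=
  rnk_eq (upper1 hr) (fun _ h => lower1 h)

theorem idem_case {r : ℕ} (h : ∀ α ∈ IM n r, pmul α α = α) :
    IdptGen (pmul (n := n)) (IM n r) ∧
        idrnk (pmul (n := n)) (IM n r) = rnk (pmul (n := n)) (IM n r) := by
  constructor
  · unfold IdptGen
    apply Set.Subset.antisymm
    · intro a ha; exact gen_sub (fun x hx => hx.1) ha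
    · intro a ha; exact MClo.base ⟨ha, h a ha⟩
  · unfold idrnk rnk
    congr 1
    ext k
    constructor
    · rintro ⟨X, h1, -, h2⟩; exact ⟨X, h1, h2⟩
    · rintro ⟨X, h1, h2⟩
      exact ⟨X, h1, fun x hx => h x (h2 ▸ MClo.base hx), h2⟩

theorem idem0 : ∀ α ∈ IM n 0, pmul α α = α := by
  intro α hα
  have h0 : (up α).A.card = 0 := by rw [← prank_eq]; have := hα.2; omega
  have c := card_low hα.1
  rw [eq_mkD hα.1]
  apply mul_eq (up_ok hα.1) (low_ok hα.1) (up_ok hα.1) (low_ok hα.1) c.symm c.symm c.symm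
  rw [Finset.card_eq_zero.1 h0]
  exact Finset.empty_subset _

theorem idem1 (hn : n ≤ 1) (r : ℕ) : ∀ α ∈ IM n r, pmul α α = α := by
  intro α hα
  have : Subsingleton (Fin n) := by
    constructor; intro a b; ext; omega
  have c := card_low hα.1
  by_cases h0 : (up α).A = ∅
  · apply idem0
    refine ⟨hα.1, ?_⟩
    rw [prank_eq, h0]; simp
  · have hA : (up α).A = (low α).A := by
      obtain ⟨i, hi⟩ := Finset.nonempty_iff_ne_empty.2 h0
      obtain ⟨j, hj⟩ : (low α).A.Nonempty := by
        rw [← Finset.card_pos, c, Finset.card_pos]; exact ⟨i, hi⟩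
      ext k
      rw [Subsingleton.elim k i]
      simp only [hi, true_iff]
      rw [Subsingleton.elim i j]; exact hj
    rw [eq_mkD hα.1]
    exact mul_same (up_ok hα.1) (low_ok hα.1) (up_ok hα.1) (low_ok hα.1) c.symm c.symm hA.symm

end Mtz

namespace Mtz

open Dgm

variable {n : ℕ}

inductive Wd : List Bool → List Bool → Prop
  | refl (u) : Wd u u
  | symm {u v} : Wd u v → Wd v u
  | trans {u v w} : Wd u v → Wd v w → Wd u w
  | cons (x) {u v} : Wd u v → Wd (x :: u) (x :: v)
  | a (v) : Wd (true :: false :: false :: v) (false :: false :: true :: v)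
  | b (v) : Wd (true :: false :: false :: false :: v) (false :: false :: false :: true :: v)

theorem Wd_count {u v : List Bool} (h : Wd u v) : u.length = v.length ∧ u.count true = v.count true := by
  induction h with
  | refl => exact ⟨rfl, rfl⟩
  | symm _ h => exact ⟨h.1.symm, h.2.symm⟩
  | trans _ _ h h' => exact ⟨h.1.trans h'.1, h.2.trans h'.2⟩
  | cons x _ h => simp [List.count_cons, h.1, h.2]
  | a => simp [List.count_cons]
  | b => simp [List.count_cons]

theorem Wd_central (x : Bool) (v : List Bool) : Wd (x :: false :: false :: v) (false :: false :: x :: v) := by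
  cases x
  · exact Wd.refl _
  · exact Wd.a v

theorem Wd_front (u v : List Bool) : Wd (u ++ false :: false :: v) (false :: false :: (u ++ v)) := by
  induction u with
  | nil => exact Wd.refl _
  | cons x u ih => exact (Wd.cons x ih).trans (Wd_central x _)

theorem Wd_perm {u v : List Bool} (h : u.Perm v) : Wd (false :: false :: u) (false :: false :: v) := by
  induction h with
  | nil => exact Wd.refl _
  | cons x _ ih => exact ((Wd_central x _).symm.trans (Wd.cons x ih)).trans (Wd_central x _)
  | swap x y l =>
    have : Wd (false :: false :: true :: false :: l) (false :: false :: false :: true :: l) :=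
      (Wd.a _).symm.trans (Wd.b l)
    cases x <;> cases y
    · exact Wd.refl _
    · exact this
    · exact this.symm
    · exact Wd.refl _
  | trans _ _ h h' => exact h.trans h'

theorem has_SS (w : List Bool) : (∃ u v, w = u ++ false :: false :: v) ∨
    (w.count false ≤ w.count true + 1 ∧ (w.head? ≠ some false → w.count false ≤ w.count true)) := by
  induction w with
  | nil => right; simp
  | cons x w ih =>
    rcases ih with ⟨u, v, rfl⟩ | ⟨h1, h2⟩
    · left; exact ⟨x :: u, v, rfl⟩
    · cases x
      · by_cases hh : w.head? = some false
        · left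
          rcases w with _ | ⟨y, w⟩
          · simp at hh
          · simp only [List.head?_cons, Option.some.injEq] at hh
            subst hh
            exact ⟨[], w, rfl⟩
        · right
          have := h2 hh
          simp [List.count_cons]
          omega
      · right
        simp [List.count_cons]
        omega

theorem cnt_len (w : List Bool) : w.count true + w.count false = w.length := by
  induction w with
  | nil => rfl
  | cons x w ih => cases x <;> simp [List.count_cons] <;> omega

theorem Wd_conn {w w' : List Bool} (h1 : w.length = w'.length) (h2 : w.count true = w'.count true)
    (h : 2 * w.count true + 2 ≤ w.length) : Wd w w' := by
  have a1 := cnt_len w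
  have a2 := cnt_len w'
  obtain ⟨u, v, rfl⟩ : ∃ u v, w = u ++ false :: false :: v := by
    rcases has_SS w with h | h
    · exact h
    · omega
  obtain ⟨u', v', rfl⟩ : ∃ u v, w' = u ++ false :: false :: v := by
    rcases has_SS w' with h | h
    · exact h
    · omega
  refine ((Wd_front u v).trans (Wd_perm ?_)).trans (Wd_front u' v').symm
  rw [List.perm_iff_count]
  intro x
  simp only [List.count_append, List.count_cons, List.length_append, List.length_cons] at *
  cases x <;> simp at * <;> omega

/-- idempotent part -/
def Cn (r : ℕ) (A B : Finset (Fin n)) : Prop :=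
  A.card = r ∧ B.card = r ∧ MClo pmul (prj n r) (mkD (idH A) (idH B))

theorem Cn.symm {r : ℕ} {A B : Finset (Fin n)} (h : Cn r A B) : Cn r B A := by
  refine ⟨h.2.1, h.1, ?_⟩
  rw [← star_mkD (idH_ok A) (idH_ok B) (h.1.trans h.2.1.symm)]
  exact gen_star (fun y hy => by rw [hy.2.2]; exact hy) h.2.2

theorem Cn.trans {r : ℕ} {A B C : Finset (Fin n)} (h : Cn r A B) (h' : Cn r B C) : Cn r A C := by
  refine ⟨h.1, h'.2.1, ?_⟩
  rw [← mul_same (idH_ok A) (idH_ok B) (idH_ok B) (idH_ok C) (h.1.trans h.2.1.symm)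
    (h'.1.trans h'.2.1.symm) rfl]
  exact MClo.mul h.2.2 h'.2.2

theorem Cn.refl {r : ℕ} {A : Finset (Fin n)} (h : A.card = r) : Cn r A A :=
  ⟨h, h, MClo.base (mkD_prj (idH_ok A) h)⟩

theorem toId {r : ℕ} {P : Half n} (hP : P.Ok) (c : P.A.card = r) :
    MClo pmul (prj n r) (mkD P (idH P.A)) := by
  rw [← mul_same hP hP (idH_ok P.A) (idH_ok P.A) rfl rfl rfl]
  exact MClo.mul (MClo.base (mkD_prj hP c)) (MClo.base (mkD_prj (idH_ok _) c))

theorem ofId {r : ℕ} {P : Half n} (hP : P.Ok) (c : P.A.card = r) :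
    MClo pmul (prj n r) (mkD (idH P.A) P) := by
  rw [← mul_same (idH_ok P.A) (idH_ok P.A) hP hP rfl rfl rfl]
  exact MClo.mul (MClo.base (mkD_prj (idH_ok _) c)) (MClo.base (mkD_prj hP c))

theorem Cn.of_mkD {r : ℕ} {P Q : Half n} (hP : P.Ok) (hQ : Q.Ok) (c : P.A.card = r)
    (c' : Q.A.card = r) (h : MClo pmul (prj n r) (mkD P Q)) : Cn r P.A Q.A := by
  refine ⟨c, c', ?_⟩
  have g := MClo.mul (MClo.mul (ofId hP c) h) (toId hQ c')
  rw [mul_same (idH_ok P.A) hP hP hQ rfl (c.trans c'.symm) rfl,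
    mul_same (k := Q) (idH_ok P.A) hQ hQ (idH_ok Q.A) (c.trans c'.symm) rfl rfl] at g
  exact g

theorem mkD_self {h : Half n} {i : Fin n} (hi : i ∈ h.A) : (mkD h h).r (Sum.inl i) (Sum.inr i) :=
  (mkD_tr i i).2 ⟨hi, hi, rfl⟩

theorem move {r : ℕ} {A : Finset (Fin n)} (c : A.card = r) {i p q : Fin n} (hi : i ∈ A)
    (hip : i < p) (hpq : p < q) (hf : ∀ a ∈ A, i < a → a ≤ q → False) :
    Cn r A (insert q (A.erase i)) := by
  have hq : q ∉ A := fun h => hf q h (hip.trans hpq) le_rfl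
  have hp : p ∉ A := fun h => hf p h hip hpq.le
  have c' : (insert q (A.erase i)).card = r := by
    rw [Finset.card_insert_of_notMem (by simp [hq]), Finset.card_erase_of_mem hi]
    have : 0 < A.card := Finset.card_pos.2 ⟨i, hi⟩
    omega
  have okP : (hookH p q A).Ok := hookH_ok hpq hp hq
    (fun a ha h1 h2 => hf a ha (hip.trans h1) h2.le)
  have okQ : (hookH i p (insert q (A.erase i))).Ok := by
    apply hookH_ok hip
    · simp [(hip.trans hpq).ne]
    · simp [hpq.ne, hp]
    · intro a ha h1 h2
      rcases Finset.mem_insert.1 ha with rfl | ha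
      · exact absurd (h2.trans hpq) (lt_irrefl _)
      · exact hf a (Finset.mem_of_mem_erase ha) h1 (h2.trans hpq).le
  apply Cn.of_mkD (P := hookH p q A) (Q := hookH i p (insert q (A.erase i))) okP okQ c c'
  have e := mul_eq okP okP okQ okQ rfl rfl (c.trans c'.symm) ?_
  · rw [← e]
    exact MClo.mul (MClo.base (mkD_prj okP c)) (MClo.base (mkD_prj okQ c'))
  · intro a ha
    by_cases hai : a = i
    · subst hai
      have t1 := mkD_self (h := hookH p q A) ha
      have t2 : (mkD (hookH a p (insert q (A.erase a))) (hookH a p (insert q (A.erase a)))).r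
          (Sum.inl a) (Sum.inl p) := (mkD_ul okQ a p).2 (Or.inr (Or.inl ⟨rfl, rfl⟩))
      have t3 : (mkD (hookH p q A) (hookH p q A)).r (Sum.inr p) (Sum.inr q) :=
        (mkD_ll okP p q).2 (Or.inr (Or.inl ⟨rfl, rfl⟩))
      have t4 := mkD_self (h := hookH a p (insert q (A.erase a))) (i := q) (Finset.mem_insert_self _ _)
      exact mem_up.2 ⟨q, (((eA t1).trans (eB t2)).trans (eA t3)).trans (eB t4)⟩
    · apply lives (mkD_self ha)
      rw [mkD_up okQ rfl]
      exact Finset.mem_insert_of_mem (Finset.mem_erase.2 ⟨hai, ha⟩)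

def wset (n : ℕ) (w : List Bool) : Finset (Fin n) :=
  Finset.univ.filter fun i => w[(i : ℕ)]? = some true

theorem card_wset {w : List Bool} (h : w.length = n) : (wset n w).card = w.count true := by
  subst h
  have := Fin.card_filter_univ_eq_vector_get_eq_count true (⟨w, rfl⟩ : List.Vector Bool w.length)
  simp only [List.Vector.toList_mk] at this
  rw [← this]
  unfold wset
  congr 1
  ext i
  rw [Finset.mem_filter, Finset.mem_filter]
  simp [List.Vector.get]

theorem wset_move (u : List Bool) {w w' : List Bool} {r k : ℕ} (hk : 2 ≤ k)
    (hl : (u ++ w).length = n) (hkw : k < w.length)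
    (hc : (wset n (u ++ w)).card = r)
    (h0 : w[0]? = some true) (h1 : ∀ j, 1 ≤ j → j ≤ k → w[j]? = some false)
    (h2 : ∀ j, w'[j]? = some true ↔ (j = k ∨ (w[j]? = some true ∧ j ≠ 0))) :
    Cn r (wset n (u ++ w)) (wset n (u ++ w')) := by
  rw [List.length_append] at hl
  let i : Fin n := ⟨u.length, by omega⟩
  let p : Fin n := ⟨u.length + 1, by omega⟩
  let q : Fin n := ⟨u.length + k, by omega⟩
  have e : wset n (u ++ w') = insert q ((wset n (u ++ w)).erase i) := by
    ext j
    simp only [wset, Finset.mem_filter, Finset.mem_univ, true_and, Finset.mem_insert,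
      Finset.mem_erase, List.getElem?_append, i, q, Fin.ext_iff, ne_eq]
    by_cases hj : (j : ℕ) < u.length
    · simp only [hj, if_true]
      constructor
      · intro h; exact Or.inr ⟨by omega, h⟩
      · rintro (h | h)
        · omega
        · exact h.2
    · simp only [hj, if_false]
      rw [h2]
      constructor
      · rintro (h | h)
        · left; omega
        · right; exact ⟨by omega, h.1⟩
      · rintro (h | h)
        · left; omega
        · right; exact ⟨h.2, by omega⟩
  rw [e]
  apply move hc (p := p)
  · simp only [wset, Finset.mem_filter, Finset.mem_univ, true_and, i]
    rw [List.getElem?_append_right le_rfl]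
    simpa using h0
  · simp only [i, p, Fin.lt_def]; omega
  · simp only [p, q, Fin.lt_def]; omega
  · intro a ha h3 h4
    simp only [i, q, Fin.lt_def, Fin.le_def] at h3 h4
    simp only [wset, Finset.mem_filter, Finset.mem_univ, true_and] at ha
    rw [List.getElem?_append_right (by omega), h1 _ (by omega) (by omega)] at ha
    simp at ha

theorem Wd_Cn {r : ℕ} {w w' : List Bool} (h : Wd w w') : ∀ u : List Bool, (u ++ w).length = n →
    (u ++ w).count true = r → Cn r (wset n (u ++ w)) (wset n (u ++ w')) := by
  induction h with
  | refl v => intro u h1 h2; exact Cn.refl ((card_wset h1).trans h2)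
  | @symm v v' h ih =>
    intro u h1 h2
    have := Wd_count h
    simp only [List.length_append, List.count_append] at *
    exact (ih u (by omega) (by omega)).symm
  | @trans v v' v'' h h' ih ih' =>
    intro u h1 h2
    have := Wd_count h
    simp only [List.length_append, List.count_append] at *
    exact (ih u (by omega) (by omega)).trans (ih' u (by omega) (by omega))
  | @cons x v v' h ih =>
    intro u h1 h2
    have := ih (u ++ [x])
    simp only [List.append_assoc, List.singleton_append] at this
    exact this h1 h2
  | a v =>
    intro u h1 h2
    refine wset_move u (k := 2) le_rfl h1 (by simp) ((card_wset h1).trans h2) rfl ?_ ?_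
    · intro j h3 h4; interval_cases j <;> rfl
    · intro j
      rcases j with _ | _ | _ | j <;> simp
  | b v =>
    intro u h1 h2
    refine wset_move u (k := 3) (by omega) h1 (by simp) ((card_wset h1).trans h2) rfl ?_ ?_
    · intro j h3 h4; interval_cases j <;> rfl
    · intro j
      rcases j with _ | _ | _ | _ | j <;> simp

theorem Cn_all {r : ℕ} (hr : 2 * r + 2 ≤ n) {A B : Finset (Fin n)} (hA : A.card = r)
    (hB : B.card = r) : Cn r A B := by
  have key : ∀ A : Finset (Fin n), ∃ w : List Bool, w.length = n ∧ wset n w = A := by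
    intro A
    refine ⟨List.ofFn fun i : Fin n => decide (i ∈ A), by simp, ?_⟩
    ext i
    simp [wset]
  obtain ⟨w, l1, rfl⟩ := key A
  obtain ⟨w', l2, rfl⟩ := key B
  rw [card_wset l1] at hA
  rw [card_wset l2] at hB
  exact Wd_Cn (Wd_conn (l1.trans l2.symm) (hA.trans hB.symm) (by omega)) [] l1 hA

theorem full_prj {r : ℕ} (hr : 2 * r + 2 ≤ n) : Full (prj n r) r := by
  intro P Q hP hQ cP cQ
  have g := MClo.mul (MClo.mul (toId hP cP) (Cn_all hr cP cQ).2.2) (ofId hQ cQ)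
  rw [mul_same hP (idH_ok P.A) (idH_ok P.A) (idH_ok Q.A) rfl (cP.trans cQ.symm) rfl,
    mul_same (l := Q) hP (idH_ok Q.A) (idH_ok Q.A) hQ (cP.trans cQ.symm) rfl rfl] at g
  exact g

theorem idem_big {r : ℕ} (hr : 2 * (r + 1) + 2 ≤ n) :
    IdptGen (pmul (n := n)) (IM n (r + 1)) ∧
        idrnk (pmul (n := n)) (IM n (r + 1)) = rnk (pmul (n := n)) (IM n (r + 1)) := by
  have hg := layer_gen (n := n) (r := r) (by omega) (fun x hx => hx.1) (full_prj hr)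
  have hid : ∀ x ∈ prj n (r + 1) ∪ sprj n r, pmul x x = x := by
    rintro x (h | h)
    · exact h.2.1
    · exact h.2.1.1
  constructor
  · unfold IdptGen
    apply Set.Subset.antisymm
    · intro a ha; exact gen_sub (fun x hx => hx.1) ha
    · intro a ha
      rw [← hg] at ha
      refine gen_trans (fun y hy => MClo.base (x := y) ?_) ha
      exact ⟨by rw [← hg]; exact MClo.base hy, hid y hy⟩
  · rw [rnk1 (by omega)]
    have hfin : (prj n (r + 1) ∪ sprj n r).Finite := Set.toFinite _
    have hX : genSet pmul (hfin.toFinset : Set (Dgm n)) = IM n (r + 1) := by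
      rw [Set.Finite.coe_toFinset]; exact hg
    have hc : hfin.toFinset.card = (prj n (r + 1)).ncard + (sprj n r).ncard := by
      rw [← Set.ncard_eq_toFinset_card _ hfin, Set.ncard_union_eq (disj r)]
    have hi : ∀ x ∈ hfin.toFinset, pmul x x = x := fun x hx => hid x (by simpa using hx)
    apply le_antisymm
    · exact Nat.sInf_le ⟨hfin.toFinset, hc, hi, hX⟩
    · refine le_csInf (s := {k | ∃ X : Finset (Dgm n), X.card = k ∧ (∀ x ∈ X, pmul x x = x) ∧
        genSet pmul ↑X = IM n (r + 1)}) ⟨_, hfin.toFinset, hc, hi, hX⟩ ?_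
      rintro _ ⟨X', rfl, -, hg'⟩
      exact lower1 hg'

theorem main (n : ℕ) :
    rnk (pmul (n := n)) (IM n 0) = Set.ncard {α : Dgm n | α ∈ DM n 0 ∧ IsProj α} ∧
    (∀ r : ℕ, 1 ≤ r → r < n →
      rnk (pmul (n := n)) (IM n r) =
        Set.ncard {α : Dgm n | α ∈ DM n r ∧ IsProj α} +
          Set.ncard {α : Dgm n | α ∈ DM n (r - 1) ∧ IsProj α ∧ NoUnnestedSingleton α}) ∧
    (∀ r : ℕ, r ≤ n → (n ≤ 1 ∨ r < n / 2) →
      IdptGen (pmul (n := n)) (IM n r) ∧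
        idrnk (pmul (n := n)) (IM n r) = rnk (pmul (n := n)) (IM n r)) := by
  refine ⟨rnk0, ?_, ?_⟩
  · intro r h1 h2
    obtain ⟨s, rfl⟩ : ∃ s, r = s + 1 := ⟨r - 1, by omega⟩
    exact rnk1 h2
  · intro r _ h
    rcases h with h | h
    · exact idem_case (idem1 h r)
    · rcases r with _ | r
      · exact idem_case idem0
      · exact idem_big (by omega)

end Mtz

/-- `rank(I_0(M_n))` is the number of projections in
`D_0(M_n)`; for `1 ≤ r ≤ n - 1`, `rank(I_r(M_n)) = p(n,r) + p'(n,r-1)`,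
where `p(n,r)` is the number of projections in `D_r(M_n)` and `p'(n,r-1)` the
number of projections in `D_{r-1}(M_n)` with no unnested singleton block;
and if `n ≤ 1` or `r < ⌊n/2⌋` then `I_r(M_n)` is idempotent-generated with
`idrank = rank`. -/
theorem rank_IM (n : ℕ) :
    rnk (pmul (n := n)) (IM n 0) = Set.ncard {α : Dgm n | α ∈ DM n 0 ∧ IsProj α} ∧
    (∀ r : ℕ, 1 ≤ r → r < n →
      rnk (pmul (n := n)) (IM n r) =
        Set.ncard {α : Dgm n | α ∈ DM n r ∧ IsProj α} +
          Set.ncard {α : Dgm n | α ∈ DM n (r - 1) ∧ IsProj α ∧ NoUnnestedSingleton α}) ∧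
    (∀ r : ℕ, r ≤ n → (n ≤ 1 ∨ r < n / 2) →
      IdptGen (pmul (n := n)) (IM n r) ∧
        idrnk (pmul (n := n)) (IM n r) = rnk (pmul (n := n)) (IM n r)) := by
  exact Mtz.main n
end
end
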